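/- (E^p_{c,q} ≈ ℓ^q) Let 0 < p < q < 1 and let Z_q denote the space of entire functions f with ‖f‖_{Z_q} = (∫_ℂ e^{-qπ|Im z|} |Im z|^{q/p-2} |f(z)|^q dA(z))^{1/q} < ∞. Then Z_q is isomorphic to ℓ^q: there exist a linear bijection T : Z_q → ℓ^q(ℕ, ℂ) and a constant C > 0 such that C^{-1} ‖f‖_{Z_q} ≤ ‖T f‖_{ℓ^q} ≤ C ‖f‖_{Z_q} for all f ∈ Z_q. -/

import Mathlib

open MeasureTheory Real Complex
open scoped ENNReal NNReal

/-- The `Z_q`-quasi-norm `(∫_ℂ e^{-qπ|Im z|} |Im z|^{q/p-2} |f(z)|^q dA(z))^{1/q}`. -/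
noncomputable def ZqNorm (p q : ℝ) (f : ℂ → ℂ) : ℝ≥0∞ :=
  (∫⁻ z : ℂ, ENNReal.ofReal
      (Real.exp (-q * Real.pi * |z.im|) * |z.im| ^ (q / p - 2)) *
    (‖f z‖₊ : ℝ≥0∞) ^ q) ^ (1 / q)

/-- Membership in `Z_q`: entire with finite `Z_q`-quasi-norm. -/
def MemZq (p q : ℝ) (f : ℂ → ℂ) : Prop :=
  Differentiable ℂ f ∧ ZqNorm p q f < ⊤

namespace ZqAux

lemma log_sub {f : ℂ → ℂ} (hf : Differentiable ℂ f) {c : ℂ} {r : ℝ} (hr : 0 < r)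
    (hc : f c ≠ 0) : Real.log ‖f c‖ ≤ circleAverage (fun z => Real.log ‖f z‖) c r := by
  have han : AnalyticOnNhd ℂ f (Metric.closedBall c |r|) := fun z _ => hf.analyticAt z
  rw [AnalyticOnNhd.circleAverage_log_norm hr.ne' han hc]
  have : 0 ≤ ∑ᶠ u, (MeromorphicOn.divisor f (Metric.closedBall c |r|) u : ℝ) *
      Real.log (r * ‖c - u‖⁻¹) := by
    apply finsum_nonneg
    intro u
    by_cases hu : u ∈ Metric.closedBall c |r|
    · apply mul_nonneg
      · have := MeromorphicOn.AnalyticOnNhd.divisor_nonneg han u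
        exact_mod_cast this
      · by_cases h0 : c = u
        · simp [h0]
        · apply Real.log_nonneg
          rw [Metric.mem_closedBall, dist_comm, dist_eq_norm, abs_of_pos hr] at hu
          have : 0 < ‖c - u‖ := norm_pos_iff.2 (sub_ne_zero.2 h0)
          rw [← div_eq_mul_inv, le_div_iff₀ this]
          linarith
    · simp [hu]
  linarith

lemma sub_circle {f : ℂ → ℂ} (hf : Differentiable ℂ f) {c : ℂ} {r q : ℝ} (hr : 0 < r)
    (hq : 0 < q) : ‖f c‖ ^ q ≤ circleAverage (fun z => ‖f z‖ ^ q) c r := by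
  have hcont : Continuous (fun z => ‖f z‖ ^ q) :=
    (hf.continuous.norm).rpow_const (fun _ => Or.inr hq.le)
  have hci : CircleIntegrable (fun z => ‖f z‖ ^ q) c r := hcont.continuousOn.circleIntegrable'
  by_cases hc : f c = 0
  · rw [hc, norm_zero, Real.zero_rpow hq.ne']
    exact circleAverage_nonneg_of_nonneg fun z _ => by positivity
  have hpos : 0 < ‖f c‖ := norm_pos_iff.2 hc
  have hA0 : 0 ≤ circleAverage (fun z => ‖f z‖ ^ q) c r :=
    circleAverage_nonneg_of_nonneg fun z _ => by positivity
  set A := circleAverage (fun z => ‖f z‖ ^ q) c r with hA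
  apply le_of_forall_pos_le_add
  intro ε hε
  set B := A + ε with hB
  have hBpos : 0 < B := by linarith
  have h1 := log_sub hf hr hc
  have hli : CircleIntegrable (fun z => Real.log ‖f z‖) c r :=
    MeromorphicOn.circleIntegrable_log_norm (fun z _ => (hf.analyticAt z).meromorphicAt)
  -- zero set has measure zero on circle
  have h2 : circleAverage (fun z => q * Real.log ‖f z‖) c r
      ≤ circleAverage (fun z => (‖f z‖ ^ q / B - 1) + Real.log B) c r := by
    unfold circleAverage
    simp only [smul_eq_mul]
    apply mul_le_mul_of_nonneg_left _ (by positivity)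
    have hz : ∀ᵐ θ : ℝ, f (circleMap c r θ) ≠ 0 := by
      have hcnt : (f ⁻¹' {0}).Countable := by
        have : AnalyticOnNhd ℂ f Set.univ := fun z _ => hf.analyticAt z
        have h3 := AnalyticOnNhd.preimage_zero_mem_codiscrete (f := f) this (x := c) hc
        have h4 := compl_mem_codiscrete_iff.1 (by simpa using h3 : (f ⁻¹' {0})ᶜ ∈ Filter.codiscrete ℂ)
        exact (HereditarilyLindelofSpace.isLindelof (f ⁻¹' {0})).countable_of_isDiscrete h4.2
      have := (hcnt.preimage_circleMap c hr.ne').measure_zero volume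
      rw [measure_eq_zero_iff_ae_notMem] at this
      filter_upwards [this] with θ h h'
      exact h (by simpa using h')
    apply intervalIntegral.integral_mono_ae (by positivity)
    · exact (hli.const_mul q)
    · have : Continuous (fun z => (‖f z‖ ^ q / B - 1) + Real.log B) := by fun_prop
      exact (this.continuousOn.circleIntegrable' : CircleIntegrable _ c r)
    · filter_upwards [hz] with θ hθ
      have hp : 0 < ‖f (circleMap c r θ)‖ := norm_pos_iff.2 hθ
      have := Real.log_le_sub_one_of_pos (x := ‖f (circleMap c r θ)‖ ^ q / B) (by positivity)
      rw [Real.log_div (by positivity) (by positivity), Real.log_rpow hp] at this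
      linarith
  have h3 : circleAverage (fun z => (‖f z‖ ^ q / B - 1) + Real.log B) c r
      = A / B - 1 + Real.log B := by
    have e : (fun z => (‖f z‖ ^ q / B - 1) + Real.log B) =
       (fun z => (B⁻¹ • ‖f z‖ ^ q) + (Real.log B - 1)) := by
      funext z; rw [smul_eq_mul]; ring
    rw [e, circleAverage_fun_add, circleAverage_fun_smul, circleAverage_const]
    · rw [smul_eq_mul]; ring
    · exact hci.const_mul _
    · exact circleIntegrable_const _ _ _
  have h4 : circleAverage (fun z => q * Real.log ‖f z‖) c r =
      q * circleAverage (fun z => Real.log ‖f z‖) c r := by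
    simp_rw [← smul_eq_mul (a := q)]
    rw [circleAverage_fun_smul]
  have h5 : q * Real.log ‖f c‖ ≤ Real.log B := by
    have : A / B ≤ 1 := by rw [div_le_one hBpos]; linarith
    have := mul_le_mul_of_nonneg_left h1 hq.le
    linarith
  rw [← Real.log_rpow hpos] at h5
  exact (Real.log_le_log_iff (by positivity) hBpos).1 h5

lemma norm_Q (c : ℂ) (r θ : ℝ) :
    ‖(circleMap c r θ - c.re) ^ 2 - ((r ^ 2 - c.im ^ 2 : ℝ) : ℂ)‖
      = 2 * |(circleMap c r θ).im| * |r| := by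
  have e : (circleMap c r θ - c.re) ^ 2 - ((r ^ 2 - c.im ^ 2 : ℝ) : ℂ)
      = 2 * ((circleMap c r θ).im : ℂ) * (Complex.I * (r * Complex.exp (θ * Complex.I))) := by
    rw [Complex.exp_mul_I, ← Complex.ofReal_cos, ← Complex.ofReal_sin]
    have h := Real.sin_sq_add_cos_sq θ
    apply Complex.ext
    · simp [circleMap, Complex.exp_mul_I, pow_two, ← Complex.ofReal_cos, ← Complex.ofReal_sin]
      linear_combination (r^2) * h
    · simp [circleMap, Complex.exp_mul_I, pow_two, ← Complex.ofReal_cos, ← Complex.ofReal_sin]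
      ring
  rw [e]
  simp [Complex.norm_exp_ofReal_mul_I]

lemma sub_circle_weight {f : ℂ → ℂ} (hf : Differentiable ℂ f) {c : ℂ} {r q : ℝ} (hr : 0 < r)
    (hq : 0 < q) (N : ℕ) :
    r ^ (N * q) * ‖f c‖ ^ q ≤
      2 ^ (N * q) * circleAverage (fun z => |z.im| ^ (N * q) * ‖f z‖ ^ q) c r := by
  set Q : ℂ → ℂ := fun z => (z - c.re) ^ 2 - ((r ^ 2 - c.im ^ 2 : ℝ) : ℂ) with hQ
  have hg : Differentiable ℂ (fun z => Q z ^ N * f z) := by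
    apply Differentiable.mul _ hf
    fun_prop
  have h := sub_circle hg (c := c) hr hq
  have hQc : ‖Q c‖ = r ^ 2 := by
    have : Q c = -((r ^ 2 : ℝ) : ℂ) := by
      simp only [hQ]
      apply Complex.ext <;> simp [pow_two]
      ring
    rw [this, norm_neg, Complex.norm_real, Real.norm_of_nonneg (by positivity)]
  have h1 : circleAverage (fun z => ‖Q z ^ N * f z‖ ^ q) c r
      = circleAverage (fun z => (2 * r) ^ (N * q) • (|z.im| ^ (N * q) * ‖f z‖ ^ q)) c r := by
    unfold circleAverage
    congr 2
    funext θ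
    simp only [hQ]
    rw [norm_mul, norm_pow, norm_Q, abs_of_pos hr, Real.mul_rpow (by positivity) (by positivity),
      ← Real.rpow_natCast, ← Real.rpow_mul (by positivity), smul_eq_mul, ← mul_assoc]
    congr 1
    rw [← Real.mul_rpow (by positivity) (by positivity)]
    congr 1; ring
  rw [h1, circleAverage_fun_smul, norm_mul, norm_pow, hQc, Real.mul_rpow (by positivity) (by positivity),
    ← Real.rpow_natCast, ← Real.rpow_mul (by positivity), smul_eq_mul,
    Real.mul_rpow (by positivity) (by positivity), pow_two, Real.mul_rpow (by positivity) (by positivity)] at h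
  have hp : 0 < r ^ (N * q) := by positivity
  refine le_of_mul_le_mul_left ?_ hp
  linarith

lemma sub_area {f : ℂ → ℂ} (hf : Differentiable ℂ f) {c : ℂ} {R q : ℝ} (hR : 0 < R)
    (hq : 0 < q) (N : ℕ) :
    ENNReal.ofReal (2 * π * (2 ^ (N * q))⁻¹ * (R / 2) ^ (N * q + 2) * ‖f c‖ ^ q) ≤
      ∫⁻ z in Metric.ball c R, ENNReal.ofReal (|z.im| ^ (N * q) * ‖f z‖ ^ q) := by
  set h : ℂ → ℝ := fun z => |z.im| ^ (N * q) * ‖f z‖ ^ q with hh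
  have hcont : Continuous h := by
    apply Continuous.mul
    · exact (by fun_prop : Continuous fun z : ℂ => |z.im|).rpow_const (fun _ => Or.inr (by positivity))
    · exact (hf.continuous.norm).rpow_const (fun _ => Or.inr hq.le)
  have hnn : ∀ z, 0 ≤ h z := fun z => by positivity
  have e1 : ∫⁻ z in Metric.ball c R, ENNReal.ofReal (h z)
      = ∫⁻ z, (Metric.ball (0:ℂ) R).indicator (fun z => ENNReal.ofReal (h (c + z))) z := by
    rw [← lintegral_indicator Metric.isOpen_ball.measurableSet,
      ← lintegral_add_left_eq_self _ c]
    congr 1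
    funext z
    simp only [Set.indicator, Metric.mem_ball, dist_self_add_left, dist_zero_right]
  rw [e1, ← Complex.lintegral_comp_polarCoord_symm]
  have e2 : ∫⁻ p in Set.Ioo (R/2) R ×ˢ Set.Ioo (-π) π, ENNReal.ofReal (R/2) *
        ENNReal.ofReal (h (c + Complex.polarCoord.symm p))
      ≤ ∫⁻ p in polarCoord.target, ENNReal.ofReal p.1 • (Metric.ball (0:ℂ) R).indicator (fun z => ENNReal.ofReal (h (c + z))) (Complex.polarCoord.symm p) := by
    have hsub : Set.Ioo (R/2) R ×ˢ Set.Ioo (-π) π ⊆ polarCoord.target := by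
      rintro ⟨a, b⟩ ⟨h1, h2⟩
      simp only [polarCoord_target, Set.mem_prod, Set.mem_Ioi]
      exact ⟨by have := h1.1; simp at this; linarith, h2⟩
    refine le_trans ?_ (lintegral_mono_set hsub)
    apply setLIntegral_mono' (measurableSet_Ioo.prod measurableSet_Ioo)
    rintro ⟨a, b⟩ ⟨h1, h2⟩
    simp only [Set.mem_Ioo] at h1
    rw [Set.indicator_of_mem, smul_eq_mul]
    · gcongr
      exact h1.1.le
    · rw [mem_ball_zero_iff, Complex.norm_polarCoord_symm, abs_of_pos (by linarith)]
      exact h1.2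
  refine le_trans ?_ e2
  rw [Measure.volume_eq_prod, ← Measure.prod_restrict, lintegral_prod _ (by
    apply Measurable.aemeasurable
    have : Measurable fun p : ℝ × ℝ => h (c + Complex.polarCoord.symm p) := by
      apply hcont.measurable.comp
      simp only [Complex.polarCoord_symm_apply]
      fun_prop
    exact this.ennreal_ofReal.const_mul _)]
  have e3 : ∀ r ∈ Set.Ioo (R/2) R, ENNReal.ofReal (2 * π * (2 ^ (N * q))⁻¹ * (R / 2) ^ (N * q + 1) * ‖f c‖ ^ q)
      ≤ ∫⁻ θ in Set.Ioo (-π) π, ENNReal.ofReal (R/2) * ENNReal.ofReal (h (c + Complex.polarCoord.symm (r, θ))) := by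
    intro r hr
    have hr0 : 0 < r := by have := hr.1; linarith
    have hm : Continuous fun θ : ℝ => h (circleMap c r θ) := by fun_prop
    have e4 : ∀ θ : ℝ, c + Complex.polarCoord.symm (r, θ) = circleMap c r θ := by
      intro θ
      simp [Complex.polarCoord_symm_apply, circleMap, Complex.exp_mul_I]
    simp_rw [e4]
    rw [lintegral_const_mul _ (by fun_prop), ← ofReal_integral_eq_lintegral_ofReal, ← ENNReal.ofReal_mul (by positivity)]
    · apply ENNReal.ofReal_le_ofReal
      have := sub_circle_weight hf (c := c) hr0 hq N
      have e5 : ∫ θ in Set.Ioo (-π) π, h (circleMap c r θ) = 2 * π * circleAverage h c r := by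
        rw [circleAverage_eq_integral_add (-π), ← integral_Ioc_eq_integral_Ioo,
          ← intervalIntegral.integral_of_le (by linarith [Real.pi_pos])]
        rw [intervalIntegral.integral_comp_add_right (fun θ => h (circleMap c r θ))]
        rw [smul_eq_mul, ← mul_assoc, mul_inv_cancel₀ (by positivity), one_mul]
        congr 1 <;> ring
      rw [e5]
      have h6 : (R/2) ^ (N * q) ≤ r ^ (N * q) := Real.rpow_le_rpow (by positivity) hr.1.le (by positivity)
      rw [Real.rpow_add (by positivity), Real.rpow_one]
      have h7 : (R/2) ^ (N * q) * ‖f c‖ ^ q ≤ r ^ (N * q) * ‖f c‖ ^ q := by gcongr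
      have h8 := h7.trans this
      rw [← inv_mul_le_iff₀ (by positivity)] at h8
      have := mul_le_mul_of_nonneg_left h8 (by positivity : 0 ≤ 2 * π * (R / 2))
      linarith
    · exact (hm.integrableOn_Icc).mono_set Set.Ioo_subset_Icc_self
    · exact Filter.Eventually.of_forall fun θ => hnn _
  refine le_trans ?_ (setLIntegral_mono' measurableSet_Ioo e3)
  rw [setLIntegral_const, Real.volume_Ioo, ← ENNReal.ofReal_mul (by positivity)]
  apply ENNReal.ofReal_le_ofReal
  apply le_of_eq
  rw [show (N * q + 2 : ℝ) = N * q + 1 + 1 by ring, Real.rpow_add (by positivity) (N * q + 1),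
    Real.rpow_one]
  ring

end ZqAux

namespace ZqAux

/-- normalized modulus -/
noncomputable def uu (f : ℂ → ℂ) (z : ℂ) : ℝ := ‖f z‖ * Real.exp (-π * |z.im|)

lemma uu_nonneg (f : ℂ → ℂ) (z : ℂ) : 0 ≤ uu f z := by unfold uu; positivity

/-- the `q`-th power of the quasi-norm -/
noncomputable def JJ (p q : ℝ) (f : ℂ → ℂ) : ℝ≥0∞ :=
  ∫⁻ z : ℂ, ENNReal.ofReal (|z.im| ^ (q / p - 2) * uu f z ^ q)

lemma ZqNorm_eq (p q : ℝ) (hq : 0 < q) (f : ℂ → ℂ) : ZqNorm p q f = JJ p q f ^ (1 / q) := by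
  unfold ZqNorm JJ
  congr 2
  funext z
  have : (‖f z‖₊ : ℝ≥0∞) = ENNReal.ofReal ‖f z‖ := by
    rw [ofReal_norm]; rfl
  rw [this, ENNReal.ofReal_rpow_of_nonneg (norm_nonneg _) hq.le,
    ← ENNReal.ofReal_mul (by positivity)]
  congr 1
  unfold uu
  rw [Real.mul_rpow (by positivity) (by positivity), ← Real.exp_mul]
  rw [show -q * π * |z.im| = -π * |z.im| * q by ring]
  ring

lemma uu_far {f : ℂ → ℂ} (hf : Differentiable ℂ f) {q : ℝ} (hq : 0 < q) {c : ℂ}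
    (hc : 0 < |c.im|) :
    ENNReal.ofReal (π / 8 * |c.im| ^ 2 * uu f c ^ q) ≤
      ∫⁻ z in Metric.ball c (|c.im| / 2), ENNReal.ofReal (uu f z ^ q) := by
  obtain ⟨s, hs1, hs⟩ : ∃ s : ℝ, |s| = 1 ∧ s * c.im = |c.im| := by
    rcases le_total 0 c.im with h | h
    · exact ⟨1, by simp, by rw [abs_of_nonneg h]; ring⟩
    · exact ⟨-1, by simp, by rw [abs_of_nonpos h]; ring⟩
  have hss : ∀ z ∈ Metric.ball c (|c.im| / 2), s * z.im = |z.im| := by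
    intro z hz
    rw [Metric.mem_ball, dist_eq_norm] at hz
    have h1 : |z.im - c.im| ≤ ‖z - c‖ := by
      have := Complex.abs_im_le_norm (z - c); simpa using this
    have h2 : |s * (z.im - c.im)| ≤ ‖z - c‖ := by rw [abs_mul, hs1, one_mul]; exact h1
    have h3 := (abs_le.1 h2).1
    have h4 : 0 < s * z.im := by nlinarith
    rw [← abs_of_pos h4, abs_mul, hs1, one_mul]
  have hg : Differentiable ℂ (fun z => f z * Complex.exp ((s * π : ℝ) * Complex.I * z)) :=
    hf.mul (by fun_prop)
  have hn : ∀ z, s * z.im = |z.im| → ‖f z * Complex.exp ((s * π : ℝ) * Complex.I * z)‖ = uu f z := by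
    intro z hz
    rw [norm_mul, Complex.norm_exp]
    unfold uu
    congr 2
    simp
    linear_combination π * hz
  have h := sub_area hg (c := c) (R := |c.im| / 2) (by positivity) hq 0
  rw [hn c hs] at h
  refine le_trans (ENNReal.ofReal_le_ofReal ?_) (h.trans ?_)
  · apply le_of_eq
    simp only [Nat.cast_zero, zero_mul, Real.rpow_zero, zero_add]
    rw [Real.rpow_two]; ring
  · apply setLIntegral_mono' Metric.isOpen_ball.measurableSet
    intro z hz
    rw [hn z (hss z hz)]
    simp

lemma rpow_comp {a b : ℝ} (α : ℝ) (ha : 0 < a) (h1 : a / 2 ≤ b) (h2 : b ≤ 2 * a) :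
    a ^ α ≤ 2 ^ |α| * b ^ α := by
  have hb : 0 < b := by linarith
  rcases le_total 0 α with h | h
  · rw [abs_of_nonneg h, ← Real.mul_rpow (by positivity) (by positivity)]
    exact Real.rpow_le_rpow ha.le (by linarith) h
  · rw [abs_of_nonpos h]
    have : a ^ α ≤ (b / 2) ^ α := Real.rpow_le_rpow_of_nonpos (by linarith) (by linarith) h
    rw [Real.div_rpow hb.le (by norm_num)] at this
    rw [Real.rpow_neg (by norm_num)]
    rw [div_eq_inv_mul] at this
    exact this

lemma uu_far' {f : ℂ → ℂ} (hf : Differentiable ℂ f) {p q : ℝ} (hq : 0 < q)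
    (hJ : JJ p q f ≠ ⊤) {c : ℂ} (hc : 0 < |c.im|) :
    π / 8 * |c.im| ^ (q / p) * uu f c ^ q ≤ 2 ^ |q / p - 2| * (JJ p q f).toReal := by
  have h := uu_far hf hq hc
  have h2 : ENNReal.ofReal (|c.im| ^ (q / p - 2)) *
      ∫⁻ z in Metric.ball c (|c.im| / 2), ENNReal.ofReal (uu f z ^ q)
      ≤ ENNReal.ofReal (2 ^ |q / p - 2|) * JJ p q f := by
    unfold JJ
    rw [← lintegral_const_mul' _ _ ENNReal.ofReal_ne_top, ← lintegral_const_mul' _ _ ENNReal.ofReal_ne_top]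
    refine le_trans ?_ (setLIntegral_le_lintegral (Metric.ball c (|c.im| / 2)) _)
    apply setLIntegral_mono' Metric.isOpen_ball.measurableSet
    intro z hz
    rw [Metric.mem_ball, dist_eq_norm] at hz
    have h1 : |z.im - c.im| ≤ ‖z - c‖ := by
      have := Complex.abs_im_le_norm (z - c); simpa using this
    have h3 := abs_sub_abs_le_abs_sub z.im c.im
    have h4 := abs_sub_abs_le_abs_sub c.im z.im
    rw [abs_sub_comm] at h4
    rw [← ENNReal.ofReal_mul (by positivity), ← ENNReal.ofReal_mul (by positivity)]
    apply ENNReal.ofReal_le_ofReal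
    have := rpow_comp (q / p - 2) hc (b := |z.im|) (by linarith) (by linarith)
    have h5 : 0 ≤ uu f z ^ q := Real.rpow_nonneg (uu_nonneg _ _) _
    nlinarith
  have h3 := (mul_le_mul_right h (ENNReal.ofReal (|c.im| ^ (q / p - 2)))).trans h2
  rw [← ENNReal.ofReal_toReal hJ, ← ENNReal.ofReal_mul (by positivity),
    ← ENNReal.ofReal_mul (by positivity), ENNReal.ofReal_le_ofReal_iff (by positivity)] at h3
  refine le_trans (le_of_eq ?_) h3
  rw [Real.rpow_sub hc, Real.rpow_two]
  field_simp

lemma uu_near {p q : ℝ} (hq : 0 < q) : ∃ K : ℝ, 0 < K ∧ ∀ f : ℂ → ℂ, Differentiable ℂ f →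
    JJ p q f ≠ ⊤ → ∀ c : ℂ, |c.im| ≤ 1 → uu f c ^ q ≤ K * (JJ p q f).toReal := by
  set α := q / p - 2 with hα
  obtain ⟨N, hN⟩ := exists_nat_gt ((|α| + 1) / q)
  have hNq : |α| + 1 < N * q := by rwa [div_lt_iff₀ hq] at hN
  set κ : ℝ := 2 * π * (2 ^ (N * q))⁻¹ * (1 / 2) ^ (N * q + 2) with hκ
  have hκ0 : 0 < κ := by positivity
  set D : ℝ := 2 ^ (N * q - α) * Real.exp (2 * π * q) with hD
  have hD0 : 0 < D := by positivity
  refine ⟨D / κ, by positivity, fun f hf hJ c hc => ?_⟩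
  have h := sub_area hf (c := c) one_pos hq N
  have h2 : ∫⁻ z in Metric.ball c 1, ENNReal.ofReal (|z.im| ^ (N * q) * ‖f z‖ ^ q)
      ≤ ENNReal.ofReal D * JJ p q f := by
    unfold JJ
    rw [← lintegral_const_mul' _ _ ENNReal.ofReal_ne_top]
    refine le_trans ?_ (setLIntegral_le_lintegral (Metric.ball c 1) _)
    apply setLIntegral_mono' Metric.isOpen_ball.measurableSet
    intro z hz
    rw [Metric.mem_ball, dist_eq_norm] at hz
    have h1 : |z.im - c.im| ≤ ‖z - c‖ := by
      have := Complex.abs_im_le_norm (z - c); simpa using this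
    have h3 := abs_sub_abs_le_abs_sub z.im c.im
    have hy : |z.im| ≤ 2 := by linarith
    rw [← ENNReal.ofReal_mul (by positivity)]
    apply ENNReal.ofReal_le_ofReal
    have ha := le_abs_self α
    have h5 : |z.im| ^ (N * q) ≤ 2 ^ (N * q - α) * |z.im| ^ α := by
      rcases (abs_nonneg z.im).eq_or_lt with h0 | h0
      · rw [← h0, Real.zero_rpow (by have := abs_nonneg α; linarith)]
        positivity
      · have : (N * q : ℝ) = (N * q - α) + α := by ring
        conv_lhs => rw [this, Real.rpow_add h0]
        gcongr
        linarith
    have h6 : ‖f z‖ ^ q ≤ Real.exp (2 * π * q) * uu f z ^ q := by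
      unfold uu
      rw [Real.mul_rpow (by positivity) (by positivity), ← Real.exp_mul]
      have : 1 ≤ Real.exp (2 * π * q) * Real.exp (-π * |z.im| * q) := by
        rw [← Real.exp_add]
        apply Real.one_le_exp
        have : |z.im| * (π * q) ≤ 2 * (π * q) := by gcongr
        linarith
      have h7 : 0 ≤ ‖f z‖ ^ q := by positivity
      nlinarith
    calc |z.im| ^ (N * q) * ‖f z‖ ^ q ≤ (2 ^ (N * q - α) * |z.im| ^ α) * (Real.exp (2 * π * q) * uu f z ^ q) := by
          gcongr
      _ = _ := by rw [hD]; ring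
  have h3 := h.trans h2
  rw [← ENNReal.ofReal_toReal hJ, ← ENNReal.ofReal_mul (by positivity), ENNReal.ofReal_le_ofReal_iff (by positivity)] at h3
  have h4 : uu f c ^ q ≤ ‖f c‖ ^ q := by
    apply Real.rpow_le_rpow (uu_nonneg _ _) _ hq.le
    unfold uu
    have : Real.exp (-π * |c.im|) ≤ 1 := Real.exp_le_one_iff.2 (by have := abs_nonneg c.im; have := Real.pi_pos; nlinarith)
    have := norm_nonneg (f c)
    nlinarith
  rw [div_mul_eq_mul_div, le_div_iff₀ hκ0]
  have : uu f c ^ q * κ ≤ ‖f c‖ ^ q * κ := by gcongr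
  linarith

lemma uu_bounded {f : ℂ → ℂ} (hf : Differentiable ℂ f) {p q : ℝ} (hp : 0 < p) (hq : 0 < q)
    (hJ : JJ p q f ≠ ⊤) : ∃ M : ℝ, 0 ≤ M ∧ ∀ z, uu f z ≤ M := by
  obtain ⟨K, hK, h⟩ := uu_near (p := p) hq
  set B := max (K * (JJ p q f).toReal) (8 / π * (2 ^ |q / p - 2| * (JJ p q f).toReal)) with hB
  have hB0 : 0 ≤ B := le_max_of_le_left (by positivity)
  refine ⟨B ^ (1 / q), by positivity, fun z => ?_⟩
  have : uu f z ^ q ≤ B := by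
    rcases le_total |z.im| 1 with h1 | h1
    · exact (h f hf hJ z h1).trans (le_max_left _ _)
    · refine le_trans ?_ (le_max_right _ _)
      have h2 := uu_far' hf hq hJ (c := z) (by linarith)
      have h3 : 1 ≤ |z.im| ^ (q / p) := Real.one_le_rpow h1 (by positivity)
      have h4 : 0 ≤ uu f z ^ q := Real.rpow_nonneg (uu_nonneg _ _) _
      rw [div_mul_eq_mul_div, le_div_iff₀ Real.pi_pos]
      have h5 : uu f z ^ q * π ≤ |z.im| ^ (q / p) * uu f z ^ q * π := by
        have := Real.pi_pos
        nlinarith [mul_nonneg h4 this.le]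
      linarith
  have h2 := Real.rpow_le_rpow (Real.rpow_nonneg (uu_nonneg _ _) _) this (by positivity : 0 ≤ 1 / q)
  rwa [← Real.rpow_mul (uu_nonneg _ _), mul_one_div_cancel hq.ne', Real.rpow_one] at h2

lemma uu_tendsto {f : ℂ → ℂ} (hf : Differentiable ℂ f) {p q : ℝ} (hp : 0 < p) (hq : 0 < q)
    (hJ : JJ p q f ≠ ⊤) :
    Filter.Tendsto (fun t : ℝ => uu f (t * Complex.I)) Filter.atTop (nhds 0) := by
  set B := 8 / π * (2 ^ |q / p - 2| * (JJ p q f).toReal) with hB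
  have hB0 : 0 ≤ B := by positivity
  have hb : ∀ t : ℝ, 0 < t → uu f (t * Complex.I) ≤ (B * t ^ (-(q / p))) ^ (1 / q) := by
    intro t ht
    have h2 := uu_far' hf hq hJ (c := t * Complex.I) (by simpa using ht.ne')
    simp only [mul_im, ofReal_re, I_im, mul_one, ofReal_im, I_re, mul_zero, add_zero, abs_of_pos ht] at h2
    have : uu f (t * Complex.I) ^ q ≤ B * t ^ (-(q / p)) := by
      rw [Real.rpow_neg ht.le, ← div_eq_mul_inv, le_div_iff₀ (by positivity), hB, div_mul_eq_mul_div, le_div_iff₀ Real.pi_pos]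
      linarith
    have h3 := Real.rpow_le_rpow (Real.rpow_nonneg (uu_nonneg _ _) _) this (by positivity : 0 ≤ 1 / q)
    rwa [← Real.rpow_mul (uu_nonneg _ _), mul_one_div_cancel hq.ne', Real.rpow_one] at h3
  have hl : Filter.Tendsto (fun t : ℝ => (B * t ^ (-(q / p))) ^ (1 / q)) Filter.atTop (nhds 0) := by
    have h1 := (tendsto_rpow_neg_atTop (y := q / p) (by positivity)).const_mul B
    rw [mul_zero] at h1
    have h2 := h1.rpow_const (p := 1 / q) (Or.inr (by positivity))
    rwa [Real.zero_rpow (by positivity)] at h2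
  refine squeeze_zero' (Filter.Eventually.of_forall fun t => uu_nonneg _ _) ?_ hl
  filter_upwards [Filter.eventually_gt_atTop 0] with t ht
  exact hb t ht

end ZqAux

namespace ZqAux

lemma norm_sin_sq (z : ℂ) : ‖Complex.sin z‖ ^ 2 = Real.sin z.re ^ 2 + Real.sinh z.im ^ 2 := by
  conv_lhs => rw [← Complex.re_add_im z, Complex.sin_add_mul_I]
  rw [← Complex.normSq_eq_norm_sq, ← Complex.ofReal_sin, ← Complex.ofReal_cosh,
    ← Complex.ofReal_cos, ← Complex.ofReal_sinh, ← Complex.ofReal_mul, ← Complex.ofReal_mul,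
    Complex.normSq_add_mul_I]
  have h1 := Real.sin_sq_add_cos_sq z.re
  have h2 := Real.cosh_sq z.im
  have h3 : Real.cos z.re ^ 2 = 1 - Real.sin z.re ^ 2 := by linarith
  rw [mul_pow, mul_pow, h2, h3]; ring

lemma norm_sin_ge_cosh (z : ℂ) : |Real.sin z.re| * Real.cosh z.im ≤ ‖Complex.sin z‖ := by
  apply le_of_sq_le_sq _ (norm_nonneg _)
  rw [norm_sin_sq, mul_pow, sq_abs, Real.cosh_sq]
  nlinarith [Real.sin_sq_le_one z.re, sq_nonneg (Real.sinh z.im)]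

lemma norm_sin_ge_sinh (z : ℂ) : |Real.sinh z.im| ≤ ‖Complex.sin z‖ := by
  apply le_of_sq_le_sq _ (norm_nonneg _)
  rw [norm_sin_sq, sq_abs]
  nlinarith [sq_nonneg (Real.sin z.re)]

lemma exp_abs_le_cosh (y : ℝ) : Real.exp |y| / 2 ≤ Real.cosh y := by
  rw [← Real.cosh_abs, Real.cosh_eq]
  have := Real.exp_pos (-|y|)
  linarith

lemma norm_sin_le (z : ℂ) : ‖Complex.sin z‖ ≤ Real.exp |z.im| := by
  apply le_of_sq_le_sq _ (Real.exp_pos _).le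
  have h : Real.cosh z.im ≤ Real.exp |z.im| := by
    rw [← Real.cosh_abs, Real.cosh_eq]
    have : Real.exp (-|z.im|) ≤ Real.exp |z.im| := Real.exp_le_exp.2 (by linarith [abs_nonneg z.im])
    linarith
  rw [norm_sin_sq]
  calc Real.sin z.re ^ 2 + Real.sinh z.im ^ 2 ≤ Real.cosh z.im ^ 2 := by
        rw [Real.cosh_sq]; linarith [Real.sin_sq_le_one z.re]
    _ ≤ _ := pow_le_pow_left₀ (Real.cosh_pos _).le h 2

lemma exp_le_sinh {y : ℝ} (hy : 1 ≤ |y|) : Real.exp (π * |y|) / 4 ≤ |Real.sinh (π * y)| := by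
  have h0 : |Real.sinh (π * y)| = Real.sinh (π * |y|) := by
    rw [Real.abs_sinh, abs_mul, abs_of_pos Real.pi_pos]
  rw [h0, Real.sinh_eq]
  have h1 : Real.exp (-(π * |y|)) ≤ 1 / 2 := by
    have : (1:ℝ) + 1 ≤ Real.exp (π * |y|) := by
      have := Real.add_one_le_exp (π * |y|)
      nlinarith [Real.pi_gt_three]
    rw [Real.exp_neg, ← one_div]
    apply one_div_le_one_div_of_le <;> linarith
  have h2 : 2 ≤ Real.exp (π * |y|) := by
      have := Real.add_one_le_exp (π * |y|)
      nlinarith [Real.pi_gt_three]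
  linarith

lemma sinpi_far {z : ℂ} (hy : 1 ≤ |z.im|) :
    Real.exp (π * |z.im|) / 4 ≤ ‖Complex.sin (π * z)‖ := by
  have := norm_sin_ge_sinh (π * z)
  rw [show ((π:ℂ) * z).im = π * z.im by simp] at this
  exact (exp_le_sinh hy).trans this

lemma sinpi_side {z : ℂ} (n : ℤ) (h : |z.re - n| = 1 / 2) :
    Real.cosh (π * z.im) ≤ ‖Complex.sin (π * z)‖ := by
  have := norm_sin_ge_cosh (π * z)
  rw [show ((π:ℂ) * z).im = π * z.im by simp, show ((π:ℂ) * z).re = π * z.re by simp] at this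
  have h1 : |Real.sin (π * z.re)| = 1 := by
    have : π * z.re = π * (z.re - n) + n * π := by ring
    rw [this, Real.sin_add_int_mul_pi, abs_mul]
    rcases eq_or_eq_neg_of_abs_eq h with h | h
    · rw [h, show π * (1/2) = π/2 by ring, Real.sin_pi_div_two]; simp
    · rw [h, show π * -(1/2) = -(π/2) by ring, Real.sin_neg, Real.sin_pi_div_two]; simp
  rwa [h1, one_mul] at this

lemma sinpi_int (n : ℤ) : Complex.sin (π * n) = 0 := by
  rw [mul_comm]; exact Complex.sin_int_mul_pi n

lemma sinpi_zero {z : ℂ} (h : Complex.sin (π * z) = 0) : ∃ n : ℤ, z = n := by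
  rw [Complex.sin_eq_zero_iff] at h
  obtain ⟨k, hk⟩ := h
  refine ⟨k, ?_⟩
  have : (π:ℂ) ≠ 0 := by exact_mod_cast Real.pi_ne_zero
  rw [mul_comm] at hk
  exact mul_right_cancel₀ this hk

lemma hasDerivAt_sinpi (z : ℂ) :
    HasDerivAt (fun w : ℂ => Complex.sin (π * w)) (π * Complex.cos (π * z)) z := by
  have := ((hasDerivAt_id z).const_mul (π:ℂ)).csin
  simpa [mul_comm] using this

/-- quotient by `sin (π z)` with removable singularities filled in -/
noncomputable def quo (G : ℂ → ℂ) (z : ℂ) : ℂ :=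
  open Classical in
  if Complex.sin (π * z) = 0 then deriv G z / (π * Complex.cos (π * z)) else G z / Complex.sin (π * z)

lemma cospi_ne {z : ℂ} (h : Complex.sin (π * z) = 0) : Complex.cos (π * z) ≠ 0 := by
  intro h2
  have := Complex.sin_sq_add_cos_sq (π * z)
  rw [h, h2] at this
  norm_num at this

lemma int_dist {m n : ℤ} (h : ‖(m:ℂ) - n‖ < 1) : m = n := by
  have : ‖((m - n : ℤ) : ℂ)‖ < 1 := by push_cast; exact h
  rw [Complex.norm_intCast] at this
  have h2 : |m - n| < 1 := by exact_mod_cast this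
  rw [Int.abs_lt_one_iff] at h2
  omega

lemma quo_diff {G : ℂ → ℂ} (hG : Differentiable ℂ G) (h0 : ∀ n : ℤ, G n = 0) :
    Differentiable ℂ (quo G) := by
  intro z
  have hs : Differentiable ℂ (fun w : ℂ => Complex.sin (π * w)) :=
    fun w => (hasDerivAt_sinpi w).differentiableAt
  by_cases h : Complex.sin (π * z) = 0
  · obtain ⟨n, rfl⟩ := sinpi_zero h
    have e : quo G =ᶠ[nhds (n:ℂ)] fun w => dslope G n w / dslope (fun w : ℂ => Complex.sin (π * w)) n w := by
      filter_upwards [Metric.ball_mem_nhds (n:ℂ) one_pos] with w hw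
      by_cases hwn : w = n
      · subst hwn
        rw [dslope_same, dslope_same, (hasDerivAt_sinpi n).deriv]
        simp [quo, h]
      · have hsw : Complex.sin (π * w) ≠ 0 := by
          intro h3
          obtain ⟨m, rfl⟩ := sinpi_zero h3
          rw [Metric.mem_ball, dist_eq_norm] at hw
          exact hwn (by rw [int_dist hw])
        have h4 : w - n ≠ 0 := sub_ne_zero.2 hwn
        rw [dslope_of_ne _ hwn, dslope_of_ne _ hwn, slope_def_field, slope_def_field, h0, h]
        simp only [quo, hsw, if_false, sub_zero]
        field_simp
    refine DifferentiableAt.congr_of_eventuallyEq ?_ e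
    have d1 : ∀ F : ℂ → ℂ, Differentiable ℂ F → DifferentiableAt ℂ (dslope F n) n := fun F hF =>
      (((Complex.differentiableOn_dslope (s := Set.univ) (Filter.univ_mem)).2 hF.differentiableOn).differentiableAt Filter.univ_mem)
    refine (d1 _ hG).div (d1 _ hs) ?_
    rw [dslope_same, (hasDerivAt_sinpi n).deriv]
    exact mul_ne_zero (by exact_mod_cast Real.pi_ne_zero) (cospi_ne h)
  · have e : quo G =ᶠ[nhds z] fun w => G w / Complex.sin (π * w) := by
      have : ∀ᶠ w in nhds z, Complex.sin (π * w) ≠ 0 :=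
        (hs.continuous.continuousAt).eventually_ne h
      filter_upwards [this] with w hw
      simp [quo, hw]
    exact DifferentiableAt.congr_of_eventuallyEq ((hG z).div (hs z) h) e

lemma norm_eq_uu (f : ℂ → ℂ) (z : ℂ) : ‖f z‖ = uu f z * Real.exp (π * |z.im|) := by
  unfold uu
  rw [mul_assoc, ← Real.exp_add]; simp

lemma quo_bdd_far {G : ℂ → ℂ} {z : ℂ} (hz : 1 ≤ |z.im|) : ‖quo G z‖ ≤ 4 * uu G z := by
  have h := sinpi_far hz
  have hpos := Real.exp_pos (π * |z.im|)
  have hne : Complex.sin (π * z) ≠ 0 := by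
    rw [← norm_pos_iff]; linarith
  simp only [quo, hne, if_false]
  rw [norm_div, div_le_iff₀ (by linarith), norm_eq_uu G z]
  nlinarith [uu_nonneg G z]

lemma quo_bdd {G : ℂ → ℂ} (hG : Differentiable ℂ G) (h0 : ∀ n : ℤ, G n = 0) {C : ℝ}
    (hC : ∀ z, uu G z ≤ C) (z : ℂ) : ‖quo G z‖ ≤ 4 * C := by
  have hd := quo_diff hG h0
  rcases le_total 1 |z.im| with hz | hz
  · exact (quo_bdd_far hz).trans (by linarith [hC z])
  set n : ℤ := round z.re with hn
  have hzn : |z.re - n| ≤ 1 / 2 := abs_sub_round z.re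
  set U : Set ℂ := (Set.Ioo ((n:ℝ) - 1 / 2) (n + 1 / 2)) ×ℂ (Set.Ioo (-1 : ℝ) 1) with hU
  have hcl : closure U = (Set.Icc ((n:ℝ) - 1 / 2) (n + 1 / 2)) ×ℂ (Set.Icc (-1 : ℝ) 1) := by
    rw [hU, Complex.closure_reProdIm, closure_Ioo (by linarith), closure_Ioo (by norm_num)]
  have hzU : z ∈ closure U := by
    rw [hcl, Complex.mem_reProdIm]
    rw [abs_le] at hzn hz
    exact ⟨⟨by linarith, by linarith⟩, hz⟩
  have hopen : IsOpen U := isOpen_Ioo.reProdIm isOpen_Ioo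
  refine Complex.norm_le_of_forall_mem_frontier_norm_le (U := U) ?_ hd.diffContOnCl ?_ hzU
  · exact (Metric.isBounded_Ioo _ _).reProdIm (Metric.isBounded_Ioo _ _)
  · intro w hw
    rw [frontier, hopen.interior_eq, hcl] at hw
    obtain ⟨hw1, hw2⟩ := hw
    rw [Complex.mem_reProdIm] at hw1
    rw [hU, Complex.mem_reProdIm] at hw2
    by_cases h1 : |w.im| < 1
    · have h2 : |w.re - n| = 1 / 2 := by
        have : ¬ (w.re ∈ Set.Ioo ((n:ℝ) - 1 / 2) (n + 1 / 2)) := fun h => hw2 ⟨h, abs_lt.1 h1⟩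
        have h3 : |w.re - n| ≤ 1 / 2 := abs_le.2 ⟨by linarith [hw1.1.1], by linarith [hw1.1.2]⟩
        refine le_antisymm h3 ?_
        by_contra h4
        push Not at h4
        rw [abs_lt] at h4
        exact this ⟨by linarith, by linarith⟩
      have h3 := sinpi_side n h2
      have h4 := exp_abs_le_cosh (π * w.im)
      rw [abs_mul, abs_of_pos Real.pi_pos] at h4
      have hpos := Real.exp_pos (π * |w.im|)
      have hne : Complex.sin (π * w) ≠ 0 := by
        rw [← norm_pos_iff]; linarith
      simp only [quo, hne, if_false]
      rw [norm_div, div_le_iff₀ (by linarith), norm_eq_uu G w]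
      have := uu_nonneg G w
      have h7 := hC w
      nlinarith
    · exact (quo_bdd_far (not_lt.1 h1)).trans (by linarith [hC w])

/-- Lemma S: uniqueness from integer samples. -/
lemma uniq {G : ℂ → ℂ} (hG : Differentiable ℂ G) (h0 : ∀ n : ℤ, G n = 0) {C : ℝ}
    (hC : ∀ z, uu G z ≤ C)
    (hlim : Filter.Tendsto (fun t : ℝ => uu G (t * Complex.I)) Filter.atTop (nhds 0)) :
    ∀ z, G z = 0 := by
  have hd := quo_diff hG h0
  have hb : Bornology.IsBounded (Set.range (quo G)) := by
    rw [isBounded_iff_forall_norm_le]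
    exact ⟨4 * C, by rintro _ ⟨z, rfl⟩; exact quo_bdd hG h0 hC z⟩
  have hc : ∀ z, quo G z = quo G 0 := fun z => hd.apply_eq_apply_of_bounded hb z 0
  have hz : ‖quo G 0‖ ≤ 0 := by
    have h1 : Filter.Tendsto (fun t : ℝ => 4 * uu G (t * Complex.I)) Filter.atTop (nhds 0) := by
      simpa using hlim.const_mul 4
    refine ge_of_tendsto h1 ?_
    filter_upwards [Filter.eventually_ge_atTop 1] with t ht
    rw [← hc (t * Complex.I)]
    apply quo_bdd_far
    simp
    rw [abs_of_pos] <;> linarith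
  have hz' : quo G 0 = 0 := norm_le_zero_iff.1 hz
  intro z
  by_cases h : Complex.sin (π * z) = 0
  · obtain ⟨n, rfl⟩ := sinpi_zero h
    exact h0 n
  · have := hc z
    rw [hz'] at this
    simp only [quo, h, if_false] at this
    exact (div_eq_zero_iff.1 this).resolve_right h

end ZqAux

namespace ZqAux

/-- the cardinal sine -/
noncomputable def sc (z : ℂ) : ℂ := dslope (fun w : ℂ => Complex.sin (π * w)) 0 z / π

lemma pi_ne : (π : ℂ) ≠ 0 := by exact_mod_cast Real.pi_ne_zero

lemma sc_zero : sc 0 = 1 := by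
  unfold sc
  rw [dslope_same, (hasDerivAt_sinpi 0).deriv]
  simp

lemma sc_mul (z : ℂ) : π * z * sc z = Complex.sin (π * z) := by
  unfold sc
  by_cases h : z = 0
  · simp [h]
  · rw [dslope_of_ne _ h, slope_def_field]
    have := pi_ne
    simp
    field_simp

lemma sc_of_ne {z : ℂ} (h : z ≠ 0) : sc z = Complex.sin (π * z) / (π * z) := by
  rw [← sc_mul, mul_div_cancel_left₀]
  exact mul_ne_zero pi_ne h

lemma sc_neg (z : ℂ) : sc (-z) = sc z := by
  by_cases h : z = 0
  · simp [h]
  · rw [sc_of_ne h, sc_of_ne (neg_ne_zero.2 h)]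
    simp

lemma sc_int {n : ℤ} (h : n ≠ 0) : sc n = 0 := by
  rw [sc_of_ne (by exact_mod_cast h), sinpi_int, zero_div]

lemma sc_diff : Differentiable ℂ sc := by
  have hs : Differentiable ℂ (fun w : ℂ => Complex.sin (π * w)) :=
    fun w => (hasDerivAt_sinpi w).differentiableAt
  have : Differentiable ℂ (dslope (fun w : ℂ => Complex.sin (π * w)) 0) := by
    rw [← differentiableOn_univ] at hs ⊢
    exact (Complex.differentiableOn_dslope Filter.univ_mem).2 hs
  exact this.div_const _

lemma sc_bound : ∃ C : ℝ, 0 < C ∧ ∀ z : ℂ, ‖sc z‖ ≤ C * Real.exp (π * |z.im|) / (1 + ‖z‖) := by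
  obtain ⟨C0, hC0⟩ := (isCompact_closedBall (0:ℂ) 1).exists_bound_of_continuousOn
    sc_diff.continuous.continuousOn
  refine ⟨2 * |C0| + 1, by positivity, fun z => ?_⟩
  have he : 1 ≤ Real.exp (π * |z.im|) := Real.one_le_exp (by positivity)
  rw [le_div_iff₀ (by positivity)]
  rcases le_total ‖z‖ 1 with h | h
  · have h1 := hC0 z (by simpa using h)
    have h2 := le_abs_self C0
    have h3 := norm_nonneg (sc z)
    have h4 := norm_nonneg z
    calc ‖sc z‖ * (1 + ‖z‖) ≤ |C0| * 2 := by
          apply mul_le_mul <;> linarith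
      _ ≤ (2 * |C0| + 1) * 1 := by linarith
      _ ≤ _ := by gcongr
  · have h1 : π * ‖z‖ * ‖sc z‖ ≤ Real.exp (π * |z.im|) := by
      have h2 := norm_sin_le (π * z)
      rw [← sc_mul, norm_mul, norm_mul, show ((π:ℂ) * z).im = π * z.im by simp, abs_mul,
        Complex.norm_real, Real.norm_eq_abs, abs_of_pos Real.pi_pos] at h2
      exact h2
    have h3 := norm_nonneg (sc z)
    have h5 : ‖sc z‖ * (1 + ‖z‖) ≤ π * ‖z‖ * ‖sc z‖ := by
      have : 1 + ‖z‖ ≤ π * ‖z‖ := by nlinarith [Real.pi_gt_three]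
      nlinarith
    have : 0 ≤ 2 * |C0| * Real.exp (π * |z.im|) := by positivity
    nlinarith

/-- rapidly decaying multiplier of type `π/3` -/
noncomputable def SS (N : ℕ) (z : ℂ) : ℂ := sc (z / (3 * N)) ^ N

/-- the basic kernel -/
noncomputable def Phi (N : ℕ) (z : ℂ) : ℂ := sc z * SS N z

lemma SS_diff (N : ℕ) : Differentiable ℂ (SS N) := by
  unfold SS
  exact (sc_diff.comp (differentiable_id.div_const _)).pow N

lemma Phi_diff (N : ℕ) : Differentiable ℂ (Phi N) := sc_diff.mul (SS_diff N)

lemma SS_zero (N : ℕ) : SS N 0 = 1 := by simp [SS, sc_zero]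

lemma Phi_zero (N : ℕ) : Phi N 0 = 1 := by simp [Phi, SS_zero, sc_zero]

lemma Phi_int (N : ℕ) {n : ℤ} (h : n ≠ 0) : Phi N n = 0 := by simp [Phi, sc_int h]

lemma Phi_neg (N : ℕ) (z : ℂ) : Phi N (-z) = Phi N z := by
  simp [Phi, SS, sc_neg, neg_div]

lemma SS_bound {N : ℕ} (hN : 0 < N) : ∃ C : ℝ, 0 < C ∧ ∀ z : ℂ,
    ‖SS N z‖ ≤ C * Real.exp (π / 3 * |z.im|) / (1 + ‖z‖) ^ N := by
  obtain ⟨C, hC, h⟩ := sc_bound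
  have hN' : (0:ℝ) < N := by exact_mod_cast hN
  have hN1 : (1:ℝ) ≤ N := by exact_mod_cast hN
  refine ⟨(3 * N * C) ^ N, by positivity, fun z => ?_⟩
  have e3 : z / (3 * N) = ((1 / (3 * N) : ℝ) : ℂ) * z := by push_cast; ring
  have h1 := h (z / (3 * N))
  have him : |(z / (3 * N)).im| = |z.im| / (3 * N) := by
    rw [e3, Complex.im_ofReal_mul, abs_mul, abs_of_pos (by positivity)]; ring
  have hnn : ‖z / (3 * N)‖ = ‖z‖ / (3 * N) := by
    rw [norm_div]; simp
  rw [him, hnn] at h1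
  unfold SS
  rw [norm_pow]
  have h2 : ‖sc (z / (3 * N))‖ ≤ (3 * N * C) * Real.exp (π / 3 * |z.im| / N) / (1 + ‖z‖) := by
    refine h1.trans ?_
    rw [div_le_div_iff₀ (by positivity) (by positivity)]
    rw [show π * (|z.im| / (3 * N)) = π / 3 * |z.im| / N by field_simp]
    have : (1 + ‖z‖) ≤ 3 * N * (1 + ‖z‖ / (3 * N)) := by
      rw [mul_add, mul_div_cancel₀ _ (by positivity)]; nlinarith
    calc C * Real.exp (π / 3 * |z.im| / N) * (1 + ‖z‖) ≤ C * Real.exp (π / 3 * |z.im| / N) * (3 * N * (1 + ‖z‖ / (3 * N))) := by gcongr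
      _ = _ := by ring
  calc ‖sc (z / (3 * N))‖ ^ N ≤ ((3 * N * C) * Real.exp (π / 3 * |z.im| / N) / (1 + ‖z‖)) ^ N := by gcongr
    _ = _ := by
      rw [div_pow, mul_pow, ← Real.exp_nat_mul, mul_div_cancel₀ _ hN'.ne']

lemma Phi_bound {N : ℕ} (hN : 0 < N) : ∃ C : ℝ, 0 < C ∧ ∀ z : ℂ,
    ‖Phi N z‖ ≤ C * Real.exp (4 * π / 3 * |z.im|) / (1 + ‖z‖) ^ N := by
  obtain ⟨C1, hC1, h1⟩ := sc_bound
  obtain ⟨C2, hC2, h2⟩ := SS_bound hN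
  refine ⟨C1 * C2, by positivity, fun z => ?_⟩
  unfold Phi
  rw [norm_mul]
  have h3 : ‖sc z‖ ≤ C1 * Real.exp (π * |z.im|) :=
    (h1 z).trans (div_le_self (by positivity) (by linarith [norm_nonneg z]))
  calc ‖sc z‖ * ‖SS N z‖ ≤ C1 * Real.exp (π * |z.im|) * (C2 * Real.exp (π / 3 * |z.im|) / (1 + ‖z‖) ^ N) := by
        gcongr; exact h2 z
    _ = C1 * C2 * (Real.exp (π * |z.im|) * Real.exp (π / 3 * |z.im|)) / (1 + ‖z‖) ^ N := by ring
    _ = _ := by rw [← Real.exp_add]; congr 3; ring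

lemma summable_int_sq : Summable (fun n : ℤ => ((1 + |(n:ℝ)|) ^ 2)⁻¹) := by
  have h1 : Summable (fun n : ℕ => ((1 + (n:ℝ)) ^ 2)⁻¹) := by
    have := (summable_nat_add_iff 1).2 (Real.summable_nat_pow_inv.2 (one_lt_two))
    refine this.congr fun n => ?_
    push_cast; ring
  apply Summable.of_nat_of_neg
  · refine h1.congr fun n => by simp
  · refine h1.congr fun n => by simp

lemma one_add_norm_mul {E : Type*} [NormedAddCommGroup E] (a b : E) : 1 + ‖a‖ ≤ (1 + ‖b‖) * (1 + ‖b - a‖) := by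
  have : ‖a‖ ≤ ‖b‖ + ‖b - a‖ := by
    have := norm_sub_le b (b - a); simpa using this
  nlinarith [norm_nonneg b, norm_nonneg (b - a), mul_nonneg (norm_nonneg b) (norm_nonneg (b - a))]

lemma sampling {G : ℂ → ℂ} (hG : Differentiable ℂ G) {C : ℝ}
    (hC : ∀ z, ‖G z‖ ≤ C * Real.exp (π * |z.im|) / (1 + ‖z‖) ^ 2) (z : ℂ) :
    HasSum (fun n : ℤ => G n * sc (z - n)) (G z) := by
  obtain ⟨C1, hC1, h1⟩ := sc_bound
  have hGn : ∀ n : ℤ, ‖G n‖ ≤ C * ((1 + |(n:ℝ)|) ^ 2)⁻¹ := by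
    intro n
    have := hC n
    simpa [div_eq_mul_inv] using this
  have hsumG : Summable (fun n : ℤ => ‖G n‖) :=
    Summable.of_nonneg_of_le (fun _ => norm_nonneg _) hGn (summable_int_sq.mul_left C)
  have hsc : ∀ (w : ℂ) (n : ℤ), ‖sc (w - n)‖ ≤ C1 * Real.exp (π * |w.im|) / (1 + |w.im|) := by
    intro w n
    have h2 := h1 (w - n)
    have h3 := Complex.abs_im_le_norm (w - n)
    simp only [Complex.sub_im, Complex.intCast_im, sub_zero] at h2 h3
    exact h2.trans (by gcongr)
  have hterm : ∀ (w : ℂ) (n : ℤ), ‖G n * sc (w - n)‖ ≤ ‖G n‖ * (C1 * Real.exp (π * |w.im|) / (1 + |w.im|)) := by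
    intro w n
    rw [norm_mul]
    exact mul_le_mul_of_nonneg_left (hsc w n) (norm_nonneg _)
  have hsum : ∀ w : ℂ, Summable (fun n : ℤ => ‖G n * sc (w - n)‖) := fun w =>
    Summable.of_nonneg_of_le (fun _ => norm_nonneg _) (hterm w) (hsumG.mul_right _)
  set F : ℂ → ℂ := fun w => ∑' n : ℤ, G n * sc (w - n) with hF
  have hFd : Differentiable ℂ F := by
    intro w
    set U : Set ℂ := {v | |v.im| < |w.im| + 1} with hU
    have hUo : IsOpen U := isOpen_lt (by fun_prop) continuous_const
    have : DifferentiableOn ℂ F U := by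
      refine differentiableOn_tsum_of_summable_norm
        (u := fun n => ‖G n‖ * (C1 * Real.exp (π * (|w.im| + 1)))) (hsumG.mul_right _) ?_ hUo ?_
      · intro n
        exact ((sc_diff.comp (differentiable_id.sub_const _)).const_mul _).differentiableOn
      · intro n v hv
        refine (hterm v n).trans ?_
        have hv' : |v.im| ≤ |w.im| + 1 := le_of_lt hv
        gcongr
        refine (div_le_self (by positivity) (by linarith [abs_nonneg v.im])).trans ?_
        gcongr
    exact this.differentiableAt (hUo.mem_nhds (by simp [hU]))
  have hFb : ∀ w, uu F w ≤ (∑' n : ℤ, ‖G n‖) * C1 / (1 + |w.im|) := by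
    intro w
    have h3 : ‖F w‖ ≤ (∑' n : ℤ, ‖G n‖) * (C1 * Real.exp (π * |w.im|) / (1 + |w.im|)) := by
      rw [← tsum_mul_right]
      exact tsum_of_norm_bounded ((hsumG.mul_right _).hasSum) (hterm w)
    unfold uu
    calc ‖F w‖ * Real.exp (-π * |w.im|) ≤ (∑' n : ℤ, ‖G n‖) * (C1 * Real.exp (π * |w.im|) / (1 + |w.im|)) * Real.exp (-π * |w.im|) := by gcongr
      _ = (∑' n : ℤ, ‖G n‖) * C1 / (1 + |w.im|) * (Real.exp (π * |w.im|) * Real.exp (-π * |w.im|)) := by ring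
      _ = _ := by rw [← Real.exp_add]; simp
  have hC0 : 0 ≤ C := by
    have := (norm_nonneg _).trans (hC 0); simpa using this
  have hGb : ∀ w, uu G w ≤ C / (1 + |w.im|) := by
    intro w
    unfold uu
    have h4 : 1 + |w.im| ≤ (1 + ‖w‖) ^ 2 := by
      nlinarith [Complex.abs_im_le_norm w, norm_nonneg w]
    calc ‖G w‖ * Real.exp (-π * |w.im|) ≤ C * Real.exp (π * |w.im|) / (1 + |w.im|) * Real.exp (-π * |w.im|) := by
          gcongr; exact (hC w).trans (by gcongr)
      _ = C / (1 + |w.im|) * (Real.exp (π * |w.im|) * Real.exp (-π * |w.im|)) := by ring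
      _ = _ := by rw [← Real.exp_add]; simp
  set D := (∑' n : ℤ, ‖G n‖) * C1 + C with hD
  have hsub : ∀ w, uu (fun w => G w - F w) w ≤ D / (1 + |w.im|) := by
    intro w
    have : uu (fun w => G w - F w) w ≤ uu G w + uu F w := by
      unfold uu; rw [← add_mul]; gcongr; exact norm_sub_le _ _
    refine this.trans ?_
    rw [hD, add_div, add_comm]
    exact add_le_add (hFb w) (hGb w)
  have hD0 : 0 ≤ D := by
    have : 0 ≤ ∑' n : ℤ, ‖G n‖ := tsum_nonneg fun _ => norm_nonneg _
    positivity
  have hz := uniq (G := fun w => G w - F w) (hG.sub hFd) ?_ (C := D) ?_ ?_ z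
  · have e : G z = F z := sub_eq_zero.1 hz
    rw [e]
    exact (hsum z).of_norm.hasSum
  · intro m
    have : F m = G m := by
      simp only [hF]
      rw [tsum_eq_single m]
      · simp [sc_zero]
      · intro n hn
        have := sc_int (n := m - n) (by omega)
        push_cast at this
        rw [this, mul_zero]
    simp [this]
  · intro w
    exact (hsub w).trans (div_le_self hD0 (by linarith [abs_nonneg w.im]))
  · refine squeeze_zero' (Filter.Eventually.of_forall fun t => uu_nonneg _ _)
      (g := fun t : ℝ => D / (1 + t)) ?_ ?_
    · filter_upwards [Filter.eventually_ge_atTop 0] with t ht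
      have := hsub (t * Complex.I)
      simpa [abs_of_nonneg ht] using this
    · exact Filter.Tendsto.const_div_atTop (Filter.tendsto_atTop_add_const_left _ _ Filter.tendsto_id) D

/-- Reproduction formula. -/
lemma reprod {N : ℕ} (hN : 2 ≤ N) {F : ℂ → ℂ} (hF : Differentiable ℂ F) {C : ℝ}
    (hC : ∀ z, ‖F z‖ ≤ C * Real.exp (2 * π / 3 * |z.im|)) (ζ : ℝ) :
    HasSum (fun k : ℤ => F k * Phi N (ζ - k)) (F ζ) := by
  obtain ⟨C1, hC1, h1⟩ := SS_bound (N := N) (by omega)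
  have hC0 : 0 ≤ C := by
    have := (norm_nonneg _).trans (hC 0); simpa using this
  have h := sampling (G := fun w => F w * SS N (ζ - w))
    (hF.mul ((SS_diff N).comp (differentiable_id.const_sub _))) (C := C * C1 * (1 + ‖(ζ:ℂ)‖) ^ 2) ?_ ζ
  · simp only [sub_self, SS_zero, mul_one] at h
    convert h using 2 with k
    unfold Phi; ring
  · intro w
    rw [norm_mul]
    have h2 := h1 (ζ - w)
    simp only [Complex.sub_im, Complex.ofReal_im, zero_sub, abs_neg] at h2
    have h3 : C1 * Real.exp (π / 3 * |w.im|) / (1 + ‖(ζ:ℂ) - w‖) ^ N ≤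
        C1 * Real.exp (π / 3 * |w.im|) * (1 + ‖(ζ:ℂ)‖) ^ 2 / (1 + ‖w‖) ^ 2 := by
      rw [div_le_div_iff₀ (by positivity) (by positivity), mul_assoc _ (_ ^ 2)]
      gcongr
      calc (1 + ‖w‖) ^ 2 ≤ ((1 + ‖(ζ:ℂ)‖) * (1 + ‖(ζ:ℂ) - w‖)) ^ 2 := by
            gcongr; exact one_add_norm_mul _ _
        _ = (1 + ‖(ζ:ℂ)‖) ^ 2 * (1 + ‖(ζ:ℂ) - w‖) ^ 2 := by ring
        _ ≤ _ := by gcongr; linarith [norm_nonneg ((ζ:ℂ) - w)]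
    calc ‖F w‖ * ‖SS N (ζ - w)‖ ≤ (C * Real.exp (2 * π / 3 * |w.im|)) *
          (C1 * Real.exp (π / 3 * |w.im|) * (1 + ‖(ζ:ℂ)‖) ^ 2 / (1 + ‖w‖) ^ 2) := by
          gcongr
          · exact hC w
          · exact h2.trans h3
      _ = C * C1 * (1 + ‖(ζ:ℂ)‖) ^ 2 * (Real.exp (2 * π / 3 * |w.im|) * Real.exp (π / 3 * |w.im|)) / (1 + ‖w‖) ^ 2 := by ring
      _ = _ := by rw [← Real.exp_add]; congr 3; ring

end ZqAux

namespace ZqAux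

/-- coefficient functionals -/
noncomputable def cc (N j : ℕ) (k : ℤ) (f : ℂ → ℂ) : ℂ :=
  ∑' n : ℤ, (-1 : ℂ) ^ n * f n * Phi N (n / 2 ^ j - k)

/-- product of cosines -/
noncomputable def DD (j : ℕ) (z : ℂ) : ℂ := ∏ i ∈ Finset.range j, Complex.cos (π * z / 2 ^ (i + 1))

/-- atoms -/
noncomputable def at' (N j : ℕ) (k : ℤ) (z : ℂ) : ℂ := DD j z * Phi N ((z - 2 ^ j * k) / 2 ^ (j + 1))

lemma norm_neg_one_zpow (n : ℤ) : ‖(-1 : ℂ) ^ n‖ = 1 := by simp [norm_zpow]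

lemma Phi_real_bound {N : ℕ} (hN : 2 ≤ N) : ∃ C : ℝ, 0 < C ∧ ∀ x : ℝ,
    ‖Phi N x‖ ≤ C / (1 + |x|) ^ 2 := by
  obtain ⟨C, hC, h⟩ := Phi_bound (N := N) (by omega)
  refine ⟨C, hC, fun x => ?_⟩
  have := h x
  simp only [Complex.ofReal_im, abs_zero, mul_zero, Real.exp_zero, mul_one, Complex.norm_real,
    Real.norm_eq_abs] at this
  refine this.trans ?_
  gcongr
  linarith [abs_nonneg x]

lemma Phi_summable0 {N : ℕ} (hN : 2 ≤ N) (j : ℕ) :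
    Summable (fun n : ℤ => ‖Phi N (n / 2 ^ j)‖) := by
  obtain ⟨C, hC, h⟩ := Phi_real_bound hN
  refine Summable.of_nonneg_of_le (fun _ => norm_nonneg _) (fun n => ?_)
    (summable_int_sq.mul_left (C * (2 ^ j) ^ 2))
  have h1 := h (n / 2 ^ j)
  push_cast at h1
  refine h1.trans ?_
  rw [div_eq_mul_inv, mul_assoc]
  gcongr
  rw [← div_eq_mul_inv, inv_eq_one_div, div_le_div_iff₀ (by positivity) (by positivity), one_mul,
    ← mul_pow]
  gcongr
  rw [mul_add, abs_div, abs_of_pos (show (0:ℝ) < 2 ^ j by positivity),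
    mul_div_cancel₀ _ (by positivity)]
  have : (1:ℝ) ≤ 2 ^ j := one_le_pow₀ (by norm_num)
  linarith

lemma Phi_shift (N j : ℕ) (k n : ℤ) : Phi N (n / 2 ^ j - k) = Phi N ((n - 2 ^ j * k : ℤ) / 2 ^ j) := by
  congr 1
  push_cast
  field_simp

lemma Phi_summable {N : ℕ} (hN : 2 ≤ N) (j : ℕ) (k : ℤ) :
    Summable (fun n : ℤ => ‖Phi N (n / 2 ^ j - k)‖) := by
  have h := (Equiv.subRight (2 ^ j * k : ℤ)).summable_iff.2 (Phi_summable0 hN j)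
  refine h.congr fun n => ?_
  simp only [Function.comp, Equiv.subRight_apply, Phi_shift]

lemma Phi_tsum (N j : ℕ) (k : ℤ) :
    ∑' n : ℤ, ‖Phi N (n / 2 ^ j - k)‖ = ∑' n : ℤ, ‖Phi N (n / 2 ^ j)‖ := by
  rw [← (Equiv.subRight (2 ^ j * k : ℤ)).tsum_eq (fun n : ℤ => ‖Phi N (n / 2 ^ j)‖)]
  simp only [Equiv.subRight_apply, Phi_shift]

lemma cc_summable {N : ℕ} (hN : 2 ≤ N) (j : ℕ) (k : ℤ) {f : ℂ → ℂ} {M : ℝ} (hf : ∀ n : ℤ, ‖f n‖ ≤ M) :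
    Summable (fun n : ℤ => ‖(-1 : ℂ) ^ n * f n * Phi N (n / 2 ^ j - k)‖) := by
  refine Summable.of_nonneg_of_le (fun _ => norm_nonneg _) (fun n => ?_)
    ((Phi_summable hN j k).mul_left M)
  rw [norm_mul, norm_mul, norm_neg_one_zpow, one_mul]
  gcongr
  exact hf n

lemma cc_zero_level (N : ℕ) (k : ℤ) (f : ℂ → ℂ) : cc N 0 k f = (-1) ^ k * f k := by
  unfold cc
  rw [tsum_eq_single k]
  · simp [Phi_zero]
  · intro n hn
    have := Phi_int N (n := n - k) (by omega)
    push_cast at this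
    simp [this]

lemma Phi_dil_bound {N : ℕ} (hN : 2 ≤ N) (m : ℕ) (hm : 1 ≤ m) (i : ℤ) : ∃ C : ℝ, ∀ z : ℂ,
    ‖Phi N (z / 2 ^ m - i)‖ ≤ C * Real.exp (2 * π / 3 * |z.im|) := by
  obtain ⟨C, hC, h⟩ := Phi_bound (N := N) (by omega)
  refine ⟨C, fun z => (h _).trans ?_⟩
  have him : (z / 2 ^ m - i).im = z.im / 2 ^ m := by
    have : z / 2 ^ m = ((1 / 2 ^ m : ℝ) : ℂ) * z := by push_cast; ring
    rw [Complex.sub_im, this, Complex.im_ofReal_mul]; simp; ring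
  rw [him, abs_div, abs_of_pos (show (0:ℝ) < 2 ^ m by positivity)]
  refine (div_le_self (by positivity) (one_le_pow₀ (by linarith [norm_nonneg (z / 2 ^ m - (i:ℂ))]))).trans ?_
  refine mul_le_mul_of_nonneg_left (Real.exp_le_exp.2 ?_) hC.le
  have : (2:ℝ) ≤ 2 ^ m := by
    calc (2:ℝ) = 2 ^ 1 := by norm_num
      _ ≤ _ := pow_le_pow_right₀ (by norm_num) hm
  rw [mul_div_assoc', div_le_iff₀ (by positivity)]
  have h2 : 0 ≤ π * |z.im| := by positivity
  nlinarith

lemma Phi_dil_diff (N m : ℕ) (i : ℤ) : Differentiable ℂ (fun z : ℂ => Phi N (z / 2 ^ m - i)) :=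
  (Phi_diff N).comp ((differentiable_id.div_const _).sub_const _)

lemma refine_step {N : ℕ} (hN : 2 ≤ N) (j : ℕ) (i : ℤ) {f : ℂ → ℂ} {M : ℝ} (hf : ∀ n : ℤ, ‖f n‖ ≤ M) :
    cc N (j + 1) i f = ∑' k : ℤ, cc N j k f * Phi N (k / 2 - i) := by
  have hM : 0 ≤ M := (norm_nonneg _).trans (hf 0)
  have hR : ∀ n : ℤ, HasSum (fun k : ℤ => Phi N (k / 2 - i) * Phi N (n / 2 ^ j - k)) (Phi N (n / 2 ^ (j + 1) - i)) := by
    intro n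
    obtain ⟨C, hC⟩ := Phi_dil_bound hN 1 le_rfl i
    have := reprod hN (Phi_dil_diff N 1 i) hC ((n : ℝ) / 2 ^ j)
    push_cast at this
    rw [pow_one] at this
    convert this using 2
    rw [pow_succ, div_div]
  set g : ℤ × ℤ → ℂ := fun p => (-1 : ℂ) ^ p.2 * f p.2 * (Phi N (p.1 / 2 - i) * Phi N (p.2 / 2 ^ j - p.1)) with hg
  have hs : Summable g := by
    apply Summable.of_norm
    have hb : Summable (fun p : ℤ × ℤ => M * (‖Phi N (p.1 / 2 - i)‖ * ‖Phi N (p.2 / 2 ^ j - p.1)‖)) := by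
      refine (Summable.mul_left M ?_)
      rw [summable_prod_of_nonneg (fun p => by positivity)]
      refine ⟨fun k => ?_, ?_⟩
      · have := Phi_summable hN j k
        exact Summable.mul_left (‖Phi N (k / 2 - i)‖) this
      · have := Phi_summable hN 1 i
        rw [pow_one] at this
        have := this.mul_right (∑' n : ℤ, ‖Phi N (n / 2 ^ j)‖)
        refine this.congr fun k => ?_
        rw [← Phi_tsum N j k, ← tsum_mul_left]
    refine Summable.of_nonneg_of_le (fun _ => norm_nonneg _) (fun p => ?_) hb
    simp only [hg]
    rw [norm_mul, norm_mul, norm_neg_one_zpow, one_mul, norm_mul]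
    gcongr
    exact hf _
  calc cc N (j + 1) i f = ∑' n : ℤ, ∑' k : ℤ, g (k, n) := by
        unfold cc
        congr 1; funext n
        rw [← (hR n).tsum_eq, ← tsum_mul_left]
    _ = ∑' k : ℤ, ∑' n : ℤ, g (k, n) := (Summable.tsum_comm (f := fun k n => g (k, n)) hs)
    _ = _ := by
        congr 1; funext k
        unfold cc
        rw [← tsum_mul_right]
        congr 1; funext n
        simp only [hg]; ring

lemma refine_odd {N : ℕ} (hN : 2 ≤ N) (j : ℕ) (i : ℤ) {f : ℂ → ℂ} {M : ℝ} (hf : ∀ n : ℤ, ‖f n‖ ≤ M)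
    (h0 : ∀ k : ℤ, Odd k → cc N j k f = 0) : cc N (j + 1) i f = cc N j (2 * i) f := by
  rw [refine_step hN j i hf, tsum_eq_single (2 * i)]
  · have : ((2 * i : ℤ) : ℂ) / 2 - i = 0 := by push_cast; ring
    rw [this, Phi_zero, mul_one]
  · intro k hk
    rcases Int.even_or_odd k with ⟨l, rfl⟩ | h
    · have := Phi_int N (n := l - i) (by omega)
      push_cast at this ⊢
      rw [show ((l:ℂ) + l) / 2 - i = l - i by ring, this, mul_zero]
    · rw [h0 k h, zero_mul]

lemma refine_pow {N : ℕ} (hN : 2 ≤ N) (m j : ℕ) (i : ℤ) {f : ℂ → ℂ} {M : ℝ} (hf : ∀ n : ℤ, ‖f n‖ ≤ M)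
    (h0 : ∀ j, ∀ k : ℤ, Odd k → cc N j k f = 0) : cc N j (2 ^ m * i) f = cc N (j + m) i f := by
  induction m generalizing j with
  | zero => simp
  | succ m ih =>
    rw [pow_succ', mul_assoc, ← refine_odd hN j _ hf (h0 j), ih (j + 1)]
    congr 1; omega

lemma vanish_int {N : ℕ} (hN : 2 ≤ N) {f : ℂ → ℂ} {M : ℝ} (hf : ∀ n : ℤ, ‖f n‖ ≤ M)
    (h0 : ∀ j, ∀ k : ℤ, Odd k → cc N j k f = 0)
    (hlim : Filter.Tendsto (fun m : ℕ => cc N m 0 f) Filter.atTop (nhds 0)) (n : ℤ) : f n = 0 := by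
  have key : cc N 0 n f = 0 := by
    by_cases hn : n = 0
    · subst hn
      have : ∀ m : ℕ, cc N m 0 f = cc N 0 0 f := by
        intro m
        have := refine_pow hN m 0 0 hf h0
        simpa using this.symm
      simp_rw [this] at hlim
      exact tendsto_nhds_unique tendsto_const_nhds hlim
    · obtain ⟨m, r, hr, e⟩ := Nat.exists_eq_two_pow_mul_odd (n := n.natAbs) (by omega)
      obtain ⟨s, hs, hs2⟩ : ∃ s : ℤ, n = 2 ^ m * s ∧ Odd s := by
        rcases Int.natAbs_eq n with h | h
        · exact ⟨r, by rw [h, e]; push_cast; ring, by exact_mod_cast hr⟩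
        · refine ⟨-r, by rw [h, e]; push_cast; ring, ?_⟩
          rw [odd_neg]; exact_mod_cast hr
      rw [hs, refine_pow hN m 0 s hf h0, h0 _ _ hs2]
  rw [cc_zero_level] at key
  rcases mul_eq_zero.1 key with h | h
  · have := norm_neg_one_zpow n
    rw [h] at this; simp at this
  · exact h

lemma DD_succ (j : ℕ) (z : ℂ) : DD (j + 1) z = DD j z * Complex.cos (π * z / 2 ^ (j + 1)) := by
  unfold DD; rw [Finset.prod_range_succ]

lemma cos_int_pi (r : ℤ) : Complex.cos (π * r) = (-1) ^ r := by
  have := Real.cos_int_mul_pi r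
  rw [mul_comm]
  have h2 : ((Real.cos (r * π) : ℝ) : ℂ) = (((-1) ^ r : ℝ) : ℂ) := by rw [this]
  push_cast at h2
  exact h2

lemma DD_int (j : ℕ) : (∀ l : ℤ, (-1 : ℂ) ^ (2 ^ j * l) * DD j (2 ^ j * l) = (-1) ^ l) ∧
    ∀ n : ℤ, ¬ ((2:ℤ) ^ j ∣ n) → DD j n = 0 := by
  induction j with
  | zero => exact ⟨fun l => by simp [DD], fun n hn => by simp at hn⟩
  | succ j ih =>
    obtain ⟨h1, h2⟩ := ih
    constructor
    · intro l
      have := h1 (2 * l)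
      push_cast at this
      rw [DD_succ, ← mul_assoc]
      rw [show (2:ℤ) ^ (j + 1) * l = 2 ^ j * (2 * l) by ring, show (2:ℂ) ^ (j + 1) * l = 2 ^ j * (2 * l) by ring,
        this]
      have e : (π:ℂ) * (2 ^ j * (2 * l)) / 2 ^ (j + 1) = π * l := by rw [pow_succ]; field_simp
      rw [e, cos_int_pi, zpow_mul]
      norm_num
    · intro n hn
      rw [DD_succ]
      by_cases hd : (2:ℤ) ^ j ∣ n
      · obtain ⟨l, rfl⟩ := hd
        rcases Int.even_or_odd' l with ⟨r, rfl | rfl⟩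
        · exact absurd ⟨r, by ring⟩ hn
        · have e : (π:ℂ) * ((2 ^ j * (2 * r + 1) : ℤ) : ℂ) / 2 ^ (j + 1) = (2 * r + 1) * π / 2 := by
            push_cast; rw [pow_succ]; field_simp
          have : Complex.cos ((2 * r + 1) * π / 2) = 0 := Complex.cos_eq_zero_iff.2 ⟨r, rfl⟩
          rw [e, this, mul_zero]
      · rw [h2 n hd, zero_mul]

lemma bio_even {N : ℕ} (hN : 2 ≤ N) {m : ℕ} (hm : 1 ≤ m) {k k' : ℤ} :
    HasSum (fun r : ℤ => Phi N ((2 * r - k) / 2) * Phi N (2 * r / 2 ^ m - k')) (Phi N (k / 2 ^ m - k')) := by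
  have e1 : ∀ r : ℤ, Phi N ((2 * r - k) / 2) = Phi N (k / 2 - r) := by
    intro r; rw [← Phi_neg]; congr 1; ring
  simp_rw [e1]
  rcases Nat.lt_or_ge m 2 with h | h
  · obtain rfl : m = 1 := by omega
    rw [pow_one]
    have e : Phi N ((k:ℂ) / 2 - k') = Phi N (k / 2 - k') * Phi N (2 * k' / 2 - k') := by
      rw [show (2 * (k':ℂ)) / 2 - k' = 0 by ring, Phi_zero, mul_one]
    rw [e]
    apply hasSum_single k'
    intro r hr
    have := Phi_int N (n := r - k') (by omega)
    push_cast at this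
    rw [show (2 * (r:ℂ)) / 2 - k' = r - k' by ring, this, mul_zero]
  · obtain ⟨C, hC⟩ := Phi_dil_bound hN (m - 1) (by omega) k'
    have := reprod hN (Phi_dil_diff N (m - 1) k') hC ((k : ℝ) / 2)
    push_cast at this
    have hp : (2:ℂ) ^ m = 2 * 2 ^ (m - 1) := by
      rw [← pow_succ']; congr 1; omega
    convert this using 1
    · funext r
      rw [mul_comm, hp]
      congr 2
      field_simp
    · rw [hp, div_div]

lemma bio_sum {N : ℕ} (hN : 2 ≤ N) (j j' : ℕ) {k k' : ℤ} (hk : Odd k) (hk' : Odd k') :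
    HasSum (fun l : ℤ => (-1 : ℂ) ^ l * Phi N ((l - k) / 2) * Phi N (2 ^ j * l / 2 ^ j' - k'))
      (if j = j' ∧ k = k' then -1 else 0) := by
  rcases lt_trichotomy j' j with h | h | h
  · rw [if_neg (by omega)]
    convert hasSum_zero using 2 with l
    obtain ⟨m, rfl⟩ : ∃ m, j = j' + (m + 1) := ⟨j - j' - 1, by omega⟩
    have := Phi_int N (n := 2 ^ (m + 1) * l - k') (by
      intro h
      obtain ⟨r, hr⟩ := hk'
      have : 2 * (2 ^ m * l) = 2 * r + 1 := by rw [← hr, ← mul_assoc, ← pow_succ']; linarith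
      omega)
    push_cast at this
    rw [show (2:ℂ) ^ (j' + (m + 1)) * l / 2 ^ j' = 2 ^ (m + 1) * l by rw [pow_add]; field_simp, this, mul_zero]
  · subst h
    have e : (if j' = j' ∧ k = k' then (-1:ℂ) else 0) =
        (-1 : ℂ) ^ k' * Phi N ((k' - k) / 2) * Phi N (2 ^ j' * k' / 2 ^ j' - k') := by
      rw [show (2:ℂ) ^ j' * k' / 2 ^ j' - k' = 0 by field_simp; ring, Phi_zero, mul_one, hk'.neg_one_zpow]
      obtain ⟨r, hr⟩ := hk
      obtain ⟨r', hr'⟩ := hk'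
      have e2 : ((k':ℂ) - k) / 2 = ((r' - r : ℤ) : ℂ) := by rw [hr, hr']; push_cast; ring
      rw [e2]
      by_cases h : k = k'
      · have : r' - r = 0 := by omega
        rw [this]; simp [h, Phi_zero]
      · rw [Phi_int N (by omega)]; simp [h]
    rw [e]
    apply hasSum_single k'
    intro l hl
    have := Phi_int N (n := l - k') (by omega)
    push_cast at this
    rw [show (2:ℂ) ^ j' * l / 2 ^ j' - k' = l - k' by field_simp, this, mul_zero]
  · rw [if_neg (by omega)]
    obtain ⟨m, hm, rfl⟩ : ∃ m, 1 ≤ m ∧ j' = j + m := ⟨j' - j, by omega, by omega⟩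
    have e : ∀ l : ℤ, (2:ℂ) ^ j * l / 2 ^ (j + m) = l / 2 ^ m := by
      intro l; rw [pow_add]; field_simp
    simp_rw [e]
    set F : ℤ → ℂ := fun l => (-1 : ℂ) ^ l * Phi N ((l - k) / 2) * Phi N (l / 2 ^ m - k') with hF
    have h1 : HasSum (fun l : ℤ => if Even l then F l else 0) (Phi N (k / 2 ^ m - k')) := by
      have hinj : Function.Injective (fun r : ℤ => 2 * r) := fun a b h => by simpa using h
      rw [← hinj.hasSum_iff]
      · convert bio_even hN hm (k := k) (k' := k') using 2 with r
        simp [hF, (even_two_mul r).neg_one_zpow]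
      · intro x hx
        rw [if_neg]
        rintro ⟨r, rfl⟩
        exact hx ⟨r, by simp; ring⟩
    have h2 : HasSum (fun l : ℤ => if Even l then 0 else F l) (- Phi N (k / 2 ^ m - k')) := by
      have e3 : - Phi N (k / 2 ^ m - k') = if Even k then 0 else F k := by
        rw [if_neg (Int.not_even_iff_odd.2 hk)]
        simp [hF, hk.neg_one_zpow, Phi_zero]
      rw [e3]
      apply hasSum_single k
      intro l hl
      by_cases hle : Even l
      · rw [if_pos hle]
      · rw [if_neg hle]
        obtain ⟨r, hr⟩ := hk
        obtain ⟨r', hr'⟩ := Int.not_even_iff_odd.1 hle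
        have e2 : ((l:ℂ) - k) / 2 = ((r' - r : ℤ) : ℂ) := by rw [hr, hr']; push_cast; ring
        simp only [hF]
        rw [e2, Phi_int N (by omega)]; simp
    have h3 := h1.add h2
    rw [add_neg_cancel] at h3
    convert h3 using 2 with l
    split_ifs <;> simp

lemma biorth {N : ℕ} (hN : 2 ≤ N) (j j' : ℕ) {k k' : ℤ} (hk : Odd k) (hk' : Odd k') :
    cc N j' k' (at' N j k) = if j = j' ∧ k = k' then -1 else 0 := by
  have h := bio_sum hN j j' hk hk'
  unfold cc
  apply HasSum.tsum_eq
  have hinj : Function.Injective (fun l : ℤ => 2 ^ j * l) := fun a b h => by simpa using h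
  rw [← hinj.hasSum_iff]
  · convert h using 2 with l
    have := (DD_int j).1 l
    simp only [Function.comp, at']
    push_cast
    rw [← mul_assoc, this]
    congr 3
    rw [pow_succ]
    field_simp
  · intro n hn
    have := (DD_int j).2 n (by rintro ⟨l, rfl⟩; exact hn ⟨l, rfl⟩)
    simp [at', this]

end ZqAux

namespace ZqAux

/-- horizontal part -/
noncomputable def Hh (Y : ℝ) (P : ℂ → ℂ) : ℂ :=
  (∫ x in (-(1/2:ℝ))..(1/2), P (x + (-Y:ℝ) * I) / Complex.sin (π * (x + (-Y:ℝ) * I))) -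
  (∫ x in (-(1/2:ℝ))..(1/2), P (x + Y * I) / Complex.sin (π * (x + Y * I)))

/-- right vertical part -/
noncomputable def Vv (Y : ℝ) (P : ℂ → ℂ) (s : ℝ) : ℂ :=
  I * ∫ y in (-Y)..Y, P (s + y * I) / Complex.sin (π * (s + y * I))

lemma sin_ne_far (x Y : ℝ) (hY : 1 ≤ |Y|) : Complex.sin (π * (x + Y * I)) ≠ 0 := by
  have := sinpi_far (z := x + Y * I) (by simpa using hY)
  have h2 := Real.exp_pos (π * |((x:ℂ) + Y * I).im|)
  rw [← norm_pos_iff]; linarith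

lemma sin_ne_side (s y : ℝ) (hs : |s| = 1 / 2) : Complex.sin (π * (s + y * I)) ≠ 0 := by
  have := sinpi_side (z := s + y * I) 0 (by simpa using hs)
  have h2 := Real.cosh_pos (π * ((s:ℂ) + y * I).im)
  rw [← norm_pos_iff]; linarith

lemma cont_h {P : ℂ → ℂ} (hP : Continuous P) (Y : ℝ) (hY : 1 ≤ |Y|) :
    Continuous (fun x : ℝ => P (x + Y * I) / Complex.sin (π * (x + Y * I))) :=
  Continuous.div (by fun_prop) (by fun_prop) (fun x => sin_ne_far x Y hY)

lemma cont_v {P : ℂ → ℂ} (hP : Continuous P) (s : ℝ) (hs : |s| = 1 / 2) :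
    Continuous (fun y : ℝ => P (s + y * I) / Complex.sin (π * (s + y * I))) :=
  Continuous.div (by fun_prop) (by fun_prop) (fun y => sin_ne_side s y hs)

lemma sc_ne {w : ℂ} (h : |w.re| ≤ 1 / 2) : sc w ≠ 0 := by
  by_cases h0 : w = 0
  · rw [h0, sc_zero]; exact one_ne_zero
  · intro h1
    have h2 := sc_mul w
    rw [h1, mul_zero] at h2
    obtain ⟨n, hn⟩ := sinpi_zero h2.symm
    have : |(n:ℝ)| ≤ 1 / 2 := by rw [hn] at h; simpa using h
    have h3 : |(n:ℝ)| < 1 := by linarith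
    have h4 : |n| < 1 := by exact_mod_cast h3
    rw [Int.abs_lt_one_iff] at h4
    exact h0 (by rw [hn, h4]; simp)

lemma rect0 {P : ℂ → ℂ} (hP : Differentiable ℂ P) {Y : ℝ} (hY : 1 ≤ Y) :
    Hh Y P + Vv Y P (1/2) - Vv Y P (-(1/2)) =
      P 0 * (Hh Y (fun _ => 1) + Vv Y (fun _ => 1) (1/2) - Vv Y (fun _ => 1) (-(1/2))) := by
  set h : ℂ → ℂ := fun z => dslope P 0 z / (π * sc z) with hh
  have hds : Differentiable ℂ (dslope P 0) := by
    have := hP.differentiableOn (s := Set.univ)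
    rw [← differentiableOn_univ]
    exact (Complex.differentiableOn_dslope Filter.univ_mem).2 this
  have hform : ∀ z, Complex.sin (π * z) ≠ 0 →
      h z = P z / Complex.sin (π * z) - P 0 * (1 / Complex.sin (π * z)) := by
    intro z hz
    have hz0 : z ≠ 0 := by rintro rfl; simp at hz
    simp only [hh]
    rw [dslope_of_ne _ hz0, slope_def_field, sub_zero]
    have h1 : sc z ≠ 0 := by intro h1; rw [← sc_mul, h1, mul_zero] at hz; exact hz rfl
    rw [← sc_mul]
    have := pi_ne
    field_simp
  have key := Complex.integral_boundary_rect_eq_zero_of_differentiableOn h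
    (((-(1/2) : ℝ) : ℂ) + (-Y : ℝ) * I) (((1/2 : ℝ) : ℂ) + (Y : ℝ) * I) ?_
  · have e1 : (((-(1/2) : ℝ) : ℂ) + (-Y : ℝ) * I).re = -(1/2) := by simp
    have e2 : (((-(1/2) : ℝ) : ℂ) + (-Y : ℝ) * I).im = -Y := by simp
    have e3 : (((1/2 : ℝ) : ℂ) + (Y : ℝ) * I).re = 1/2 := by simp
    have e4 : (((1/2 : ℝ) : ℂ) + (Y : ℝ) * I).im = Y := by simp
    rw [e1, e2, e3, e4] at key
    have hh1 : ∀ Z : ℝ, 1 ≤ |Z| → (∫ x in (-(1/2:ℝ))..(1/2), h (x + Z * I)) =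
        (∫ x in (-(1/2:ℝ))..(1/2), P (x + Z * I) / Complex.sin (π * (x + Z * I))) -
        P 0 * ∫ x in (-(1/2:ℝ))..(1/2), 1 / Complex.sin (π * (x + Z * I)) := by
      intro Z hZ
      rw [← intervalIntegral.integral_const_mul, ← intervalIntegral.integral_sub]
      · apply intervalIntegral.integral_congr
        intro x _
        exact hform _ (sin_ne_far x Z hZ)
      · exact (cont_h hP.continuous Z hZ).intervalIntegrable _ _
      · exact ((cont_h (P := fun _ => 1) continuous_const Z hZ).const_mul _).intervalIntegrable _ _
    have hv1 : ∀ s : ℝ, |s| = 1 / 2 → (∫ y in (-Y)..Y, h (s + y * I)) =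
        (∫ y in (-Y)..Y, P (s + y * I) / Complex.sin (π * (s + y * I))) -
        P 0 * ∫ y in (-Y)..Y, 1 / Complex.sin (π * (s + y * I)) := by
      intro s hs
      rw [← intervalIntegral.integral_const_mul, ← intervalIntegral.integral_sub]
      · apply intervalIntegral.integral_congr
        intro y _
        exact hform _ (sin_ne_side s y hs)
      · exact (cont_v hP.continuous s hs).intervalIntegrable _ _
      · exact ((cont_v (P := fun _ => 1) continuous_const s hs).const_mul _).intervalIntegrable _ _
    have a1 : |(1/2:ℝ)| = 1/2 := by rw [abs_of_pos]; norm_num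
    have a2 : |(-(1/2):ℝ)| = 1/2 := by rw [abs_neg, a1]
    have a3 : 1 ≤ |Y| := hY.trans (le_abs_self _)
    rw [hh1 _ (by rwa [abs_neg]), hh1 _ a3, hv1 _ a1, hv1 _ a2] at key
    simp only [smul_eq_mul] at key
    unfold Hh Vv
    linear_combination key
  · intro z hz
    have hz1 : z.re ∈ Set.uIcc (-(1/2:ℝ)) (1/2) := by
      have := (Complex.mem_reProdIm.1 hz).1
      simpa using this
    rw [Set.uIcc_of_le (by norm_num)] at hz1
    have hre : |z.re| ≤ 1 / 2 := abs_le.2 ⟨hz1.1, hz1.2⟩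
    exact ((hds z).div ((sc_diff z).const_mul _) (mul_ne_zero pi_ne (sc_ne hre))).differentiableWithinAt

/-- residue constant -/
noncomputable def KK (Y : ℝ) : ℂ :=
  Hh Y (fun _ => 1) + Vv Y (fun _ => 1) (1/2) - Vv Y (fun _ => 1) (-(1/2))

lemma sin_half (y : ℝ) : Complex.sin (π * ((1/2:ℝ) + y * I)) = (Real.cosh (π * y) : ℝ) := by
  have : (π:ℂ) * ((1/2:ℝ) + y * I) = ((π * y : ℝ) : ℂ) * I + π / 2 := by push_cast; ring
  rw [this, Complex.sin_add_pi_div_two, Complex.cos_mul_I, Complex.ofReal_cosh]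

lemma sin_neg_half (y : ℝ) : Complex.sin (π * ((-(1/2):ℝ) + y * I)) = - Complex.sin (π * ((1/2:ℝ) + y * I)) := by
  have : (π:ℂ) * ((-(1/2):ℝ) + y * I) = π * ((1/2:ℝ) + y * I) - π := by push_cast; ring
  rw [this, Complex.sin_sub_pi]

lemma Hh_norm {P : ℂ → ℂ} {Y B : ℝ} (hY : 1 ≤ Y)
    (hB : ∀ x : ℝ, |x| ≤ 1 / 2 → ∀ s : ℝ, |s| = Y → ‖P (x + s * I)‖ ≤ B * Real.exp (π * Y)) :
    ‖Hh Y P‖ ≤ 8 * B := by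
  have h1 : ∀ s : ℝ, |s| = Y → ‖∫ x in (-(1/2:ℝ))..(1/2), P (x + s * I) / Complex.sin (π * (x + s * I))‖ ≤ 4 * B := by
    intro s hs
    have := intervalIntegral.norm_integral_le_of_norm_le_const (a := (-(1/2:ℝ))) (b := 1/2) (C := 4 * B)
      (f := fun x : ℝ => P (x + s * I) / Complex.sin (π * (x + s * I))) ?_
    · refine this.trans (le_of_eq ?_); norm_num
    · intro x hx
      rw [Set.uIoc_of_le (by norm_num)] at hx
      have h2 := hB x (abs_le.2 ⟨hx.1.le, hx.2⟩) s hs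
      have h3 := sinpi_far (z := x + s * I) (by simp [hs, hY])
      have e : |((x:ℂ) + s * I).im| = Y := by simp [hs]
      rw [e] at h3
      have hp := Real.exp_pos (π * Y)
      rw [norm_div, div_le_iff₀ (by linarith)]
      have hB0 : 0 ≤ B * Real.exp (π * Y) := (norm_nonneg _).trans h2
      have hB1 : 0 ≤ B := nonneg_of_mul_nonneg_left hB0 hp
      calc _ ≤ _ := h2
        _ = 4 * B * (Real.exp (π * Y) / 4) := by ring
        _ ≤ _ := by gcongr
  have hY' : |Y| = Y := abs_of_pos (by linarith)
  unfold Hh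
  refine (norm_sub_le _ _).trans ?_
  linarith [h1 (-Y) (by rw [abs_neg, hY']), h1 Y hY']

lemma KK_lower : ∃ κ : ℝ, 0 < κ ∧ ∀ Y : ℝ, 1 ≤ Y → κ ≤ ‖KK Y‖ := by
  have hexp : 4 < Real.exp (π / 2) := by
    have h1 : Real.exp (1.5) ≤ Real.exp (π / 2) := Real.exp_le_exp.2 (by linarith [Real.pi_gt_three])
    have h2 : (4:ℝ) < Real.exp 1.5 := by
      have h3 : Real.exp 1.5 ^ 2 = Real.exp 1 ^ 3 := by
        rw [← Real.exp_nat_mul, ← Real.exp_nat_mul]; norm_num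
      have h4 := Real.exp_one_gt_d9
      have h5 : (16:ℝ) < Real.exp 1 ^ 3 := by
        calc (16:ℝ) < 2.7 ^ 3 := by norm_num
          _ ≤ _ := by gcongr; linarith
      nlinarith [Real.exp_pos 1.5]
    linarith
  have hp := Real.exp_pos (-(π / 2))
  have hee : Real.exp (π / 2) * Real.exp (-(π/2)) = 1 := by rw [← Real.exp_add]; simp
  have hpi : Real.exp (-π) = Real.exp (-(π/2)) ^ 2 := by
    rw [← Real.exp_nat_mul]; congr 1; push_cast; ring
  refine ⟨2 * Real.exp (-(π/2)) - 8 * Real.exp (-π), by rw [hpi]; nlinarith, fun Y hY => ?_⟩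
  have hH : ‖Hh Y (fun _ => 1)‖ ≤ 8 * Real.exp (-π) := by
    apply Hh_norm hY
    intro x _ s _
    rw [norm_one, ← Real.exp_add]
    apply Real.one_le_exp
    nlinarith [Real.pi_pos]
  have hV : Vv Y (fun _ => 1) (1/2) - Vv Y (fun _ => 1) (-(1/2)) =
      I * ((∫ y in (-Y)..Y, 2 / Real.cosh (π * y) : ℝ) : ℂ) := by
    have e1 : Vv Y (fun _ => 1) (1/2) = I * ((∫ y in (-Y)..Y, 1 / Real.cosh (π * y) : ℝ) : ℂ) := by
      unfold Vv
      rw [← intervalIntegral.integral_ofReal]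
      congr 1
      apply intervalIntegral.integral_congr
      intro y _
      simp only
      rw [sin_half]; push_cast; rfl
    have e2 : Vv Y (fun _ => 1) (-(1/2)) = - (I * ((∫ y in (-Y)..Y, 1 / Real.cosh (π * y) : ℝ) : ℂ)) := by
      unfold Vv
      rw [← intervalIntegral.integral_ofReal, ← mul_neg, ← intervalIntegral.integral_neg]
      congr 1
      apply intervalIntegral.integral_congr
      intro y _
      simp only
      rw [sin_neg_half, sin_half, div_neg]; push_cast; rfl
    rw [e1, e2]
    have : (∫ y in (-Y)..Y, 2 / Real.cosh (π * y)) = 2 * ∫ y in (-Y)..Y, 1 / Real.cosh (π * y) := by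
      rw [← intervalIntegral.integral_const_mul]
      congr 1; funext y; ring
    rw [this]; push_cast; ring
  have hcont : Continuous (fun y : ℝ => 2 / Real.cosh (π * y)) :=
    Continuous.div continuous_const (Real.continuous_cosh.comp (by fun_prop)) (fun y => (Real.cosh_pos _).ne')
  have hI : 2 * Real.exp (-(π/2)) ≤ ∫ y in (-Y)..Y, 2 / Real.cosh (π * y) := by
    calc 2 * Real.exp (-(π/2)) = ∫ y in (-(1/2:ℝ))..(1/2), 2 * Real.exp (-(π/2)) := by
          rw [intervalIntegral.integral_const]; norm_num
      _ ≤ ∫ y in (-(1/2:ℝ))..(1/2), 2 / Real.cosh (π * y) := by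
          apply intervalIntegral.integral_mono_on (by norm_num) (by simp) (hcont.intervalIntegrable _ _)
          intro y hy
          rw [le_div_iff₀ (Real.cosh_pos _)]
          have h1 : Real.cosh (π * y) ≤ Real.exp (π / 2) := by
            rw [← Real.cosh_abs, Real.cosh_eq]
            have h2 : |π * y| ≤ π / 2 := by
              rw [abs_mul, abs_of_pos Real.pi_pos]
              have : |y| ≤ 1 / 2 := abs_le.2 hy
              nlinarith [Real.pi_pos]
            have h3 := Real.exp_le_exp.2 h2
            have h4 : Real.exp (-|π * y|) ≤ Real.exp (π / 2) := Real.exp_le_exp.2 (by linarith [abs_nonneg (π * y), Real.pi_pos])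
            linarith
          nlinarith
      _ ≤ _ := by
          apply intervalIntegral.integral_mono_interval (by linarith) (by norm_num) (by linarith) _ (hcont.intervalIntegrable _ _)
          filter_upwards with y
          have := Real.cosh_pos (π * y)
          simp only [Pi.zero_apply]
          positivity
  unfold KK
  rw [add_sub_assoc, hV]
  have h1 : ‖I * ((∫ y in (-Y)..Y, 2 / Real.cosh (π * y) : ℝ) : ℂ)‖ = ∫ y in (-Y)..Y, 2 / Real.cosh (π * y) := by
    rw [norm_mul, Complex.norm_I, one_mul, Complex.norm_real, Real.norm_eq_abs, abs_of_nonneg]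
    linarith
  have h2 := norm_sub_norm_le (I * ((∫ y in (-Y)..Y, 2 / Real.cosh (π * y) : ℝ) : ℂ)) (-Hh Y (fun _ => 1))
  rw [norm_neg, sub_neg_eq_add, add_comm _ (Hh Y _), h1] at h2
  linarith

/-- Summation lemma. -/
lemma sum_formula {P : ℂ → ℂ} (hP : Differentiable ℂ P) {Y : ℝ} (hY : 1 ≤ Y) {D : ℝ}
    (hD : ∀ n : ℤ, ∀ y : ℝ, |y| ≤ Y → ‖P (n + (1/2:ℝ) + y * I)‖ ≤ D * ((1 + |(n:ℝ)|) ^ 2)⁻¹)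
    (hs : Summable (fun n : ℤ => (-1 : ℂ) ^ n * P n)) :
    HasSum (fun n : ℤ => (-1 : ℂ) ^ n * Hh Y (fun z => P (n + z))) ((∑' n : ℤ, (-1 : ℂ) ^ n * P n) * KK Y) := by
  set V : ℤ → ℂ := fun n => (-1 : ℂ) ^ n * Vv Y (fun z => P (n + z)) (1/2) with hV
  have hVb : ∀ n, ‖V n‖ ≤ (D * (2 * Y)) * ((1 + |(n:ℝ)|) ^ 2)⁻¹ := by
    intro n
    simp only [hV]
    rw [norm_mul, norm_neg_one_zpow, one_mul]
    unfold Vv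
    rw [norm_mul, Complex.norm_I, one_mul]
    have := intervalIntegral.norm_integral_le_of_norm_le_const (a := -Y) (b := Y)
      (C := D * ((1 + |(n:ℝ)|) ^ 2)⁻¹)
      (f := fun y : ℝ => P (n + ((1/2:ℝ) + y * I)) / Complex.sin (π * ((1/2:ℝ) + y * I))) ?_
    · refine this.trans (le_of_eq ?_)
      rw [abs_of_pos (show 0 < Y - -Y by linarith)]; ring
    · intro y hy
      rw [Set.uIoc_of_le (by linarith)] at hy
      have h1 := hD n y (abs_le.2 ⟨hy.1.le, hy.2⟩)
      rw [norm_div, sin_half, Complex.norm_real, Real.norm_eq_abs, abs_of_pos (Real.cosh_pos _), ← add_assoc]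
      exact (div_le_self (norm_nonneg _) (Real.one_le_cosh _)).trans h1
  have hVs : Summable V := Summable.of_norm_bounded (summable_int_sq.mul_left _) hVb
  have hVs' : HasSum (fun n : ℤ => V (n - 1)) (∑' n, V n) :=
    (Equiv.subRight (1:ℤ)).hasSum_iff.2 hVs.hasSum
  have key : ∀ n : ℤ, (-1 : ℂ) ^ n * Hh Y (fun z => P (n + z)) =
      (-1 : ℂ) ^ n * P n * KK Y - V n + V (n - 1) := by
    intro n
    have h1 := rect0 (P := fun z => P (n + z)) (hP.comp (differentiable_id.const_add _)) hY
    rw [← KK, add_zero] at h1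
    have h2 : V (n - 1) = (-1 : ℂ) ^ n * Vv Y (fun z => P (n + z)) (-(1/2)) := by
      simp only [hV]
      rw [zpow_sub₀ (by norm_num), zpow_one, div_neg, div_one, neg_mul, ← mul_neg]
      congr 1
      unfold Vv
      rw [← mul_neg, ← intervalIntegral.integral_neg]
      congr 1
      apply intervalIntegral.integral_congr
      intro y _
      simp only
      rw [sin_neg_half, div_neg]
      congr 3
      push_cast; ring
    rw [h2]
    simp only [hV]
    linear_combination (-1 : ℂ) ^ n * h1
  simp_rw [key]
  have := ((hs.hasSum.mul_right (KK Y)).sub hVs.hasSum).add hVs'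
  simpa using this

end ZqAux

namespace ZqAux

lemma sum_rpow_le {ι : Type*} (s : Finset ι) (x : ι → ℝ≥0∞) {q : ℝ} (hq : 0 < q) (hq1 : q ≤ 1) :
    (∑ i ∈ s, x i) ^ q ≤ ∑ i ∈ s, x i ^ q := by
  classical
  induction s using Finset.induction_on with
  | empty => simp [hq]
  | insert a s ha ih =>
    rw [Finset.sum_insert ha, Finset.sum_insert ha]
    exact (ENNReal.rpow_add_le_add_rpow _ _ hq.le hq1).trans (by gcongr)

lemma tsum_rpow_le {ι : Type*} (x : ι → ℝ≥0∞) {q : ℝ} (hq : 0 < q) (hq1 : q ≤ 1) :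
    (∑' i, x i) ^ q ≤ ∑' i, x i ^ q := by
  rw [← ENNReal.le_rpow_inv_iff hq, ENNReal.tsum_eq_iSup_sum]
  refine iSup_le fun s => ?_
  rw [ENNReal.le_rpow_inv_iff hq]
  exact (sum_rpow_le s x hq hq1).trans (ENNReal.sum_le_tsum s)

lemma tsum_div (d : ℕ) [NeZero d] (g : ℤ → ℝ≥0∞) : ∑' n : ℤ, g (n / d) = d * ∑' m, g m := by
  have h1 : ∑' n : ℤ, g (n / d) = ∑' n : ℤ, g (Int.divModEquiv d n).1 := rfl
  have h2 := (Int.divModEquiv d).tsum_eq (fun x : ℤ × Fin d => g x.1)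
  have h3 : ∑' x : ℤ × Fin d, g x.1 = ∑' (m : ℤ) (_ : Fin d), g m := ENNReal.tsum_prod (f := fun m _ => g m)
  rw [h1, h2, h3, ← ENNReal.tsum_mul_left]
  congr 1; funext m
  rw [tsum_fintype]; simp

lemma tsum_ind_le {ι : Type*} (S : Set ι) (F : Finset ι) (h : S ⊆ F) (c : ℝ≥0∞) (hc : F.card ≤ c) :
    ∑' i, S.indicator (1 : ι → ℝ≥0∞) i ≤ c := by
  refine le_trans ?_ hc
  rw [tsum_eq_sum (s := F)]
  · calc ∑ i ∈ F, S.indicator (1 : ι → ℝ≥0∞) i ≤ ∑ i ∈ F, 1 := by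
          refine Finset.sum_le_sum fun i _ => ?_
          exact Set.indicator_le_self' (by simp) i
      _ = _ := by simp
  · intro i hi
    rw [Set.indicator_of_notMem]
    exact fun h' => hi (h h')

/-- Whitney-type boxes -/
def Bx (j : ℕ) (m : ℤ) : Set ℂ :=
  {z | |z.re - 2 ^ j * m| ≤ 2 * 2 ^ j ∧ (2:ℝ) ^ j / 2 ≤ |z.im| ∧ |z.im| ≤ 2 * 2 ^ j}

lemma Bx_meas (j : ℕ) (m : ℤ) : MeasurableSet (Bx j m) := by
  have h1 : MeasurableSet {z : ℂ | |z.re - 2 ^ j * m| ≤ 2 * 2 ^ j} :=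
    (isClosed_le (by fun_prop) continuous_const).measurableSet
  have h2 : MeasurableSet {z : ℂ | (2:ℝ) ^ j / 2 ≤ |z.im|} :=
    (isClosed_le continuous_const (by fun_prop)).measurableSet
  have h3 : MeasurableSet {z : ℂ | |z.im| ≤ 2 * 2 ^ j} :=
    (isClosed_le (by fun_prop) continuous_const).measurableSet
  exact h1.inter (h2.inter h3)

lemma Bx_m (z : ℂ) (j : ℕ) : ∑' m : ℤ, (Bx j m).indicator (1 : ℂ → ℝ≥0∞) z ≤
    9 * ({i : ℕ | (2:ℝ) ^ i / 2 ≤ |z.im| ∧ |z.im| ≤ 2 * 2 ^ i}).indicator (1 : ℕ → ℝ≥0∞) j := by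
  by_cases hj : (2:ℝ) ^ j / 2 ≤ |z.im| ∧ |z.im| ≤ 2 * 2 ^ j
  · rw [Set.indicator_of_mem (by exact hj)]
    have e : ∀ m : ℤ, (Bx j m).indicator (1 : ℂ → ℝ≥0∞) z = ({m : ℤ | z ∈ Bx j m}).indicator 1 m := by
      intro m; by_cases h : z ∈ Bx j m
      · rw [Set.indicator_of_mem h, Set.indicator_of_mem (by exact h)]; rfl
      · rw [Set.indicator_of_notMem h, Set.indicator_of_notMem (by exact h)]
    simp_rw [e]
    by_cases hne : ∃ m0, z ∈ Bx j m0
    · obtain ⟨m0, h0⟩ := hne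
      apply tsum_ind_le _ (Finset.Icc (m0 - 4) (m0 + 4))
      · intro m hm
        have h1 := hm.1
        have h2 := h0.1
        rw [abs_le] at h1 h2
        have hp : (0:ℝ) < 2 ^ j := by positivity
        have h3 : (m:ℝ) ≤ m0 + 4 := by nlinarith
        have h4 : (m0:ℝ) - 4 ≤ m := by nlinarith
        rw [Finset.mem_coe, Finset.mem_Icc]
        constructor
        · exact_mod_cast h4
        · exact_mod_cast h3
      · rw [Int.card_Icc, show m0 + 4 + 1 - (m0 - 4) = 9 by ring]; norm_num
    · push Not at hne
      have : ({m : ℤ | z ∈ Bx j m}) = ∅ := by ext m; simpa using hne m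
      rw [this]; simp
  · have : ∀ m : ℤ, (Bx j m).indicator (1 : ℂ → ℝ≥0∞) z = 0 := by
      intro m
      rw [Set.indicator_of_notMem]
      exact fun h => hj h.2
    simp [this]

lemma Bx_j (z : ℂ) : ∑' j : ℕ, ({i : ℕ | (2:ℝ) ^ i / 2 ≤ |z.im| ∧ |z.im| ≤ 2 * 2 ^ i}).indicator
    (1 : ℕ → ℝ≥0∞) j ≤ 5 := by
  by_cases hne : ∃ j0 : ℕ, (2:ℝ) ^ j0 / 2 ≤ |z.im| ∧ |z.im| ≤ 2 * 2 ^ j0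
  · obtain ⟨j0, h0⟩ := hne
    have cmp : ∀ a b : ℕ, (2:ℝ) ^ a / 2 ≤ |z.im| → |z.im| ≤ 2 * 2 ^ b → a ≤ b + 2 := by
      intro a b h1 h2
      have : (2:ℝ) ^ a ≤ 2 ^ (b + 2) := by rw [pow_add]; linarith
      exact (pow_le_pow_iff_right₀ (by norm_num : (1:ℝ) < 2)).1 this
    apply tsum_ind_le _ (Finset.Icc (j0 - 2) (j0 + 2))
    · intro j hj
      have h1 := cmp j j0 hj.1 h0.2
      have h2 := cmp j0 j h0.1 hj.2
      rw [Finset.mem_coe, Finset.mem_Icc]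
      omega
    · rw [Nat.card_Icc]
      have : j0 + 2 + 1 - (j0 - 2) ≤ 5 := by omega
      exact_mod_cast this
  · push Not at hne
    have : ({i : ℕ | (2:ℝ) ^ i / 2 ≤ |z.im| ∧ |z.im| ≤ 2 * 2 ^ i}) = ∅ := by
      ext m; simpa using hne m
    rw [this]; simp

lemma Bx_sum {g : ℂ → ℝ≥0∞} (hg : Measurable g) :
    ∑' j : ℕ, ∑' m : ℤ, ∫⁻ z in Bx j m, g z ≤ 45 * ∫⁻ z, g z := by
  have h1 : ∀ j m, ∫⁻ z in Bx j m, g z = ∫⁻ z, (Bx j m).indicator (1 : ℂ → ℝ≥0∞) z * g z := by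
    intro j m
    rw [← lintegral_indicator (Bx_meas j m)]
    congr 1; funext z
    by_cases h : z ∈ Bx j m
    · simp [h]
    · simp [h]
  have hm : ∀ j m, Measurable (fun z => (Bx j m).indicator (1 : ℂ → ℝ≥0∞) z * g z) := fun j m =>
    (measurable_one.indicator (Bx_meas j m)).mul hg
  calc ∑' j : ℕ, ∑' m : ℤ, ∫⁻ z in Bx j m, g z
      = ∫⁻ z, ∑' j : ℕ, ∑' m : ℤ, (Bx j m).indicator (1 : ℂ → ℝ≥0∞) z * g z := by
        simp_rw [h1]
        rw [lintegral_tsum]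
        · congr 1; funext j
          rw [lintegral_tsum]
          exact fun m => (hm j m).aemeasurable
        · exact fun j => (Measurable.tsum (hm j)).aemeasurable
    _ ≤ ∫⁻ z, 45 * g z := by
        apply lintegral_mono
        intro z
        simp only
        simp_rw [ENNReal.tsum_mul_right]
        gcongr
        calc ∑' j : ℕ, ∑' m : ℤ, (Bx j m).indicator (1 : ℂ → ℝ≥0∞) z ≤ _ :=
              ENNReal.tsum_le_tsum fun j => Bx_m z j
          _ ≤ 9 * 5 := by rw [ENNReal.tsum_mul_left]; gcongr; exact Bx_j z
          _ = 45 := by norm_num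
    _ = _ := lintegral_const_mul _ hg

end ZqAux

namespace ZqAux

lemma div_pow_re (z : ℂ) (j : ℕ) (k : ℤ) : (z / 2 ^ j - k).re = z.re / 2 ^ j - k := by
  have : z / 2 ^ j = ((1 / 2 ^ j : ℝ) : ℂ) * z := by push_cast; ring
  rw [Complex.sub_re, this, Complex.re_ofReal_mul]; simp; ring

lemma div_pow_im (z : ℂ) (j : ℕ) (k : ℤ) : (z / 2 ^ j - k).im = z.im / 2 ^ j := by
  have : z / 2 ^ j = ((1 / 2 ^ j : ℝ) : ℂ) * z := by push_cast; ring
  rw [Complex.sub_im, this, Complex.im_ofReal_mul]; simp; ring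

lemma near_div (j : ℕ) (n : ℤ) {x : ℝ} (hx : |x| ≤ 1 / 2) :
    |(n + x) - 2 ^ j * ((n / (2 ^ j : ℕ) : ℤ) : ℝ)| ≤ 3 / 2 * 2 ^ j := by
  have hd : (0:ℤ) < ((2 ^ j : ℕ) : ℤ) := by positivity
  have h1 := Int.emod_nonneg n hd.ne'
  have h2 := Int.emod_lt_of_pos n hd
  have h3 := Int.mul_ediv_add_emod n ((2 ^ j : ℕ) : ℤ)
  set m := n / ((2 ^ j : ℕ) : ℤ)
  set r := n % ((2 ^ j : ℕ) : ℤ)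
  have h4 : (n:ℝ) = 2 ^ j * m + r := by rw [← h3]; push_cast; ring
  have h5 : (0:ℝ) ≤ r := by exact_mod_cast h1
  have h6 : (r:ℝ) ≤ 2 ^ j := by
    have : (r:ℝ) < ((2 ^ j : ℕ) : ℝ) := by exact_mod_cast h2
    push_cast at this; exact this.le
  have h7 : (1:ℝ) ≤ 2 ^ j := one_le_pow₀ (by norm_num)
  rw [h4, abs_le]
  rw [abs_le] at hx
  constructor <;> linarith [hx.1, hx.2]

lemma Phi_pt {N : ℕ} (hN : 0 < N) : ∃ C : ℝ, 0 < C ∧ ∀ (j : ℕ) (n k : ℤ) (x s : ℝ), |x| ≤ 1 / 2 →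
    |s| = 2 ^ j → ‖Phi N ((n + (x + s * I)) / 2 ^ j - k)‖ ≤
      C * ((1 + |((n / (2 ^ j : ℕ) : ℤ) : ℝ) - k|) ^ N)⁻¹ := by
  obtain ⟨C, hC, h⟩ := Phi_bound hN
  refine ⟨C * Real.exp (4 * π / 3) * (5 / 2) ^ N, by positivity, fun j n k x s hx hs => ?_⟩
  refine (h _).trans ?_
  have hX : (0:ℝ) < 2 ^ j := by positivity
  set w := ((n:ℂ) + (x + s * I)) / 2 ^ j - k with hw
  have him : |w.im| = 1 := by
    rw [hw, div_pow_im]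
    simp only [Complex.add_im, Complex.intCast_im, Complex.ofReal_im, Complex.mul_im, Complex.I_re,
      Complex.ofReal_re, Complex.I_im]
    rw [show (0 + (0 + (s * 1 + 0 * 0)) : ℝ) = s by ring, abs_div, hs, abs_of_pos hX, div_self hX.ne']
  have hre : w.re = (n + x) / 2 ^ j - k := by
    rw [hw, div_pow_re]; simp
  set m : ℤ := n / (2 ^ j : ℕ) with hm
  set a : ℝ := (n + x) / 2 ^ j with ha
  have h1 : |a - m| ≤ 3 / 2 := by
    have := near_div j n hx
    rw [← hm] at this
    have e : a - m = ((n + x) - 2 ^ j * (m:ℝ)) / 2 ^ j := by rw [ha]; field_simp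
    rw [e, abs_div, abs_of_pos hX, div_le_iff₀ hX]
    exact this
  have h2 : |a - k| ≤ ‖w‖ := by rw [ha, ← hre]; exact Complex.abs_re_le_norm w
  have h3 : 1 + |(m:ℝ) - k| ≤ 5 / 2 * (1 + ‖w‖) := by
    have : |(m:ℝ) - k| ≤ |a - m| + |a - k| := by
      have := abs_sub (a - k) (a - m)
      rw [show (m:ℝ) - k = (a - k) - (a - m) by ring]; linarith
    linarith [norm_nonneg w]
  rw [him, mul_one]
  calc C * (Real.exp (4 * π / 3)) / (1 + ‖w‖) ^ N = C * Real.exp (4 * π / 3) * (5 / 2) ^ N * ((5 / 2 * (1 + ‖w‖)) ^ N)⁻¹ := by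
        rw [mul_pow]; field_simp
    _ ≤ C * Real.exp (4 * π / 3) * (5 / 2) ^ N * ((1 + |(m:ℝ) - k|) ^ N)⁻¹ := by gcongr

/-- local energy -/
noncomputable def Aj (p q : ℝ) (f : ℂ → ℂ) (j : ℕ) (m : ℤ) : ℝ≥0∞ :=
  ∫⁻ z in Bx j m, ENNReal.ofReal (|z.im| ^ (q / p - 2) * uu f z ^ q)

lemma Aj_le (p q : ℝ) (f : ℂ → ℂ) (j : ℕ) (m : ℤ) : Aj p q f j m ≤ JJ p q f :=
  setLIntegral_le_lintegral _ _

lemma uu_box {f : ℂ → ℂ} (hf : Differentiable ℂ f) {p q : ℝ} (hq : 0 < q) (j : ℕ) (n : ℤ)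
    {x s : ℝ} (hx : |x| ≤ 1 / 2) (hs : |s| = 2 ^ j) :
    ENNReal.ofReal (((2:ℝ) ^ j) ^ (q / p) * uu f (n + (x + s * I)) ^ q) ≤
      ENNReal.ofReal (8 / π * 2 ^ |q / p - 2|) * Aj p q f j (n / (2 ^ j : ℕ)) := by
  set c : ℂ := n + (x + s * I) with hc
  set X : ℝ := 2 ^ j with hX
  have hX0 : 0 < X := by positivity
  have hcim : |c.im| = X := by simp [hc, hs]
  have hcre : c.re = n + x := by simp [hc]
  set m : ℤ := n / (2 ^ j : ℕ) with hm
  set α := q / p - 2 with hα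
  have h1 := uu_far hf hq (c := c) (by rw [hcim]; exact hX0)
  rw [hcim] at h1
  have hsub : Metric.ball c (X / 2) ⊆ Bx j m := by
    intro z hz
    rw [Metric.mem_ball, dist_eq_norm] at hz
    have a1 := Complex.abs_re_le_norm (z - c)
    have a2 := Complex.abs_im_le_norm (z - c)
    rw [Complex.sub_re] at a1
    rw [Complex.sub_im] at a2
    have a3 := near_div j n hx
    rw [← hm, ← hcre, ← hX] at a3
    have a4 := abs_abs_sub_abs_le z.im c.im
    rw [hcim, abs_le] at a4
    refine ⟨?_, ?_, ?_⟩
    · rw [← hX]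
      calc |z.re - X * m| = |(z.re - c.re) + (c.re - X * m)| := by ring_nf
        _ ≤ |z.re - c.re| + |c.re - X * m| := abs_add_le _ _
        _ ≤ _ := by linarith
    · rw [← hX]; linarith
    · rw [← hX]; linarith
  have h2 : ENNReal.ofReal (X ^ α) * ∫⁻ z in Bx j m, ENNReal.ofReal (uu f z ^ q) ≤
      ENNReal.ofReal (2 ^ |α|) * Aj p q f j m := by
    unfold Aj
    rw [← lintegral_const_mul' _ _ ENNReal.ofReal_ne_top, ← lintegral_const_mul' _ _ ENNReal.ofReal_ne_top]
    apply setLIntegral_mono' (Bx_meas j m)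
    intro z hz
    rw [← ENNReal.ofReal_mul (by positivity), ← ENNReal.ofReal_mul (by positivity)]
    apply ENNReal.ofReal_le_ofReal
    rw [← mul_assoc]
    have := uu_nonneg f z
    gcongr
    exact rpow_comp α hX0 hz.2.1 hz.2.2
  have h3 : ENNReal.ofReal (X ^ (q / p) * uu f c ^ q) =
      ENNReal.ofReal (8 / π) * (ENNReal.ofReal (X ^ α) * ENNReal.ofReal (π / 8 * X ^ 2 * uu f c ^ q)) := by
    have := uu_nonneg f c
    rw [← ENNReal.ofReal_mul (by positivity), ← ENNReal.ofReal_mul (by positivity)]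
    congr 1
    have e : X ^ (q / p) = X ^ α * X ^ 2 := by
      rw [← Real.rpow_natCast, ← Real.rpow_add hX0]; congr 1; rw [hα]; push_cast; ring
    rw [e]
    have := Real.pi_ne_zero
    field_simp
  rw [h3, show ENNReal.ofReal (8 / π * 2 ^ |α|) = ENNReal.ofReal (8 / π) * ENNReal.ofReal (2 ^ |α|) from ENNReal.ofReal_mul (by positivity), mul_assoc (ENNReal.ofReal (8 / π))]
  refine mul_le_mul' le_rfl (le_trans (mul_le_mul' le_rfl ?_) h2)
  exact h1.trans (lintegral_mono_set hsub)

lemma P_decay {N : ℕ} (hN : 2 ≤ N) {f : ℂ → ℂ} {M : ℝ} (hM : ∀ z, uu f z ≤ M) (j : ℕ) (k : ℤ) :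
    ∃ D : ℝ, ∀ n : ℤ, ∀ y : ℝ, |y| ≤ 2 ^ j →
      ‖f (n + (1/2:ℝ) + y * I) * Phi N ((n + (1/2:ℝ) + y * I) / 2 ^ j - k)‖ ≤ D * ((1 + |(n:ℝ)|) ^ 2)⁻¹ := by
  obtain ⟨C, hC, h⟩ := Phi_bound (N := N) (by omega)
  have hM0 : 0 ≤ M := (uu_nonneg f 0).trans (hM 0)
  refine ⟨M * Real.exp (π * 2 ^ j) * (C * Real.exp (4 * π / 3)) * (3 / 2 * 2 ^ j * (1 + |(k:ℝ)|)) ^ 2, fun n y hy => ?_⟩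
  set z : ℂ := n + (1/2:ℝ) + y * I with hz
  have hzim : z.im = y := by simp [hz]
  have hzre : z.re = n + 1/2 := by simp [hz]
  have hX : (0:ℝ) < 2 ^ j := by positivity
  have hX1 : (1:ℝ) ≤ 2 ^ j := one_le_pow₀ (by norm_num)
  have h1 : ‖f z‖ ≤ M * Real.exp (π * 2 ^ j) := by
    rw [norm_eq_uu, hzim]
    have := hM z
    gcongr
  set w := z / 2 ^ j - k with hw
  have h2 := h w
  have him : |w.im| ≤ 1 := by
    rw [hw, div_pow_im, hzim, abs_div, abs_of_pos hX, div_le_one hX]; exact hy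
  have hre : |w.re| ≤ ‖w‖ := Complex.abs_re_le_norm w
  have hnw : 1 + |(n:ℝ)| ≤ 3 / 2 * 2 ^ j * (1 + |(k:ℝ)|) * (1 + ‖w‖) := by
    have e : (n:ℝ) = 2 ^ j * (w.re + k) - 1/2 := by
      rw [hw, div_pow_re, hzre]; field_simp; ring
    have a1 : |(n:ℝ)| ≤ 2 ^ j * (|w.re| + |(k:ℝ)|) + 1/2 := by
      calc |(n:ℝ)| = |2 ^ j * (w.re + k) - 1/2| := by rw [← e]
        _ ≤ |2 ^ j * (w.re + k)| + |1/2| := abs_sub _ _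
        _ = 2 ^ j * |w.re + k| + 1/2 := by rw [abs_mul, abs_of_pos hX, abs_of_pos (by norm_num : (0:ℝ) < 1/2)]
        _ ≤ _ := by gcongr; exact abs_add_le _ _
    have a2 : 0 ≤ |(k:ℝ)| := abs_nonneg _
    have a3 : 0 ≤ ‖w‖ := norm_nonneg _
    have a4 : |w.re| + |(k:ℝ)| + 1 ≤ (1 + |(k:ℝ)|) * (1 + ‖w‖) := by nlinarith
    have a5 : 2 ^ j * (|w.re| + |(k:ℝ)| + 1) ≤ 2 ^ j * ((1 + |(k:ℝ)|) * (1 + ‖w‖)) := by gcongr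
    have a6 : 1 ≤ (2:ℝ) ^ j * ((1 + |(k:ℝ)|) * (1 + ‖w‖)) :=
      one_le_mul_of_one_le_of_one_le hX1 (one_le_mul_of_one_le_of_one_le (by linarith) (by linarith))
    nlinarith
  have h3 : ‖Phi N w‖ ≤ C * Real.exp (4 * π / 3) * ((1 + ‖w‖) ^ 2)⁻¹ := by
    refine h2.trans ?_
    rw [div_eq_mul_inv]
    gcongr
    · have : 0 ≤ 4 * π / 3 := by positivity
      nlinarith
    · linarith [norm_nonneg w]
  rw [norm_mul]
  calc ‖f z‖ * ‖Phi N w‖ ≤ (M * Real.exp (π * 2 ^ j)) * (C * Real.exp (4 * π / 3) * ((1 + ‖w‖) ^ 2)⁻¹) := by gcongr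
    _ = (M * Real.exp (π * 2 ^ j)) * (C * Real.exp (4 * π / 3)) * ((1 + ‖w‖) ^ 2)⁻¹ := by ring
    _ ≤ (M * Real.exp (π * 2 ^ j)) * (C * Real.exp (4 * π / 3)) * ((3 / 2 * 2 ^ j * (1 + |(k:ℝ)|)) ^ 2 * ((1 + |(n:ℝ)|) ^ 2)⁻¹) := by
        gcongr
        rw [inv_eq_one_div, ← div_eq_mul_inv, div_le_div_iff₀ (by positivity) (by positivity), one_mul, ← mul_pow]
        gcongr
    _ = _ := by ring

end ZqAux

namespace ZqAux

/-- summable weights -/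
noncomputable def w2 (n : ℤ) : ℝ≥0∞ := ENNReal.ofReal (((1 + |(n:ℝ)|) ^ 2)⁻¹)

lemma w2_sum : ∑' n, w2 n ≠ ⊤ := by
  unfold w2
  rw [← ENNReal.ofReal_tsum_of_nonneg (fun n => by positivity) summable_int_sq]
  exact ENNReal.ofReal_ne_top

lemma cc_bound {p q : ℝ} (hp : 0 < p) (hpq : p < q) (hq1 : q < 1) {N : ℕ} (hN : 2 ≤ N) (hNq : 2 ≤ N * q) :
    ∃ C : ℝ, 0 < C ∧ ∀ f : ℂ → ℂ, Differentiable ℂ f → JJ p q f ≠ ⊤ → ∀ (j : ℕ) (k : ℤ),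
      ENNReal.ofReal ((((2:ℝ) ^ j) ^ (1 / p - 1) * ‖cc N j k f‖) ^ q) ≤
        ENNReal.ofReal C * ∑' m : ℤ, Aj p q f j m * w2 (m - k) := by
  have hq : 0 < q := hp.trans hpq
  obtain ⟨C, hC, hPhi⟩ := Phi_pt (N := N) (by omega)
  obtain ⟨κ, hκ, hKK⟩ := KK_lower
  set c0 : ℝ := 8 / π * 2 ^ |q / p - 2| with hc0
  have hc0p : 0 < c0 := by positivity
  refine ⟨(8 * C / κ) ^ q * c0, by positivity, fun f hf hJ j k => ?_⟩
  obtain ⟨M, hM0, hM⟩ := uu_bounded hf hp hq hJ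
  set X : ℝ := 2 ^ j with hX
  have hX0 : 0 < X := by positivity
  have hX1 : 1 ≤ X := one_le_pow₀ (by norm_num)
  set E : ℤ → ℝ≥0∞ := fun m => ENNReal.ofReal c0 * Aj p q f j m with hE
  have hEtop : ∀ m, E m ≠ ⊤ := fun m =>
    ENNReal.mul_ne_top ENNReal.ofReal_ne_top (ne_top_of_le_ne_top hJ (Aj_le p q f j m))
  set e : ℤ → ℝ := fun m => (E m ^ (1 / q)).toReal with he
  have heE : ∀ m, ENNReal.ofReal (e m) = E m ^ (1 / q) := fun m =>
    ENNReal.ofReal_toReal (ENNReal.rpow_ne_top_of_nonneg (by positivity) (hEtop m))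
  have he0 : ∀ m, 0 ≤ e m := fun m => ENNReal.toReal_nonneg
  set w : ℤ → ℝ := fun m => ((1 + |(m:ℝ) - k|) ^ N)⁻¹ with hw
  have hw0 : ∀ m, 0 ≤ w m := fun m => by positivity
  set P : ℂ → ℂ := fun z => f z * Phi N (z / 2 ^ j - k) with hPdef
  have hP : Differentiable ℂ P :=
    hf.mul ((Phi_diff N).comp ((differentiable_id.div_const _).sub_const _))
  obtain ⟨D, hD⟩ := P_decay hN hM j k
  have hfn : ∀ n : ℤ, ‖f n‖ ≤ M := fun n => by
    have := hM n
    rw [norm_eq_uu]; simpa using this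
  have hccP : ∀ n : ℤ, (-1:ℂ) ^ n * f n * Phi N (n / 2 ^ j - k) = (-1:ℂ) ^ n * P n := fun n => by
    rw [hPdef]; ring
  have hs : Summable (fun n : ℤ => (-1:ℂ) ^ n * P n) := by
    have := (cc_summable hN j k hfn).of_norm
    simpa only [hccP] using this
  have hsum := sum_formula hP hX1 hD hs
  have hcc : ∑' n : ℤ, (-1:ℂ) ^ n * P n = cc N j k f := by
    unfold cc; simp only [hccP]
  rw [hcc] at hsum
  -- pointwise
  have hu : ∀ (n : ℤ) (x s : ℝ), |x| ≤ 1 / 2 → |s| = X →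
      uu f (n + (x + s * I)) ≤ X ^ (-(1 / p)) * e (n / (2 ^ j : ℕ)) := by
    intro n x s hx hs
    have h1 := uu_box hf (p := p) hq j n hx hs
    rw [← hX, ← hc0] at h1
    set u := uu f (n + (x + s * I))
    have hu0 : 0 ≤ u := uu_nonneg _ _
    have h2 : X ^ (q / p) * u ^ q ≤ (E (n / (2 ^ j : ℕ))).toReal := by
      rw [← ENNReal.ofReal_le_iff_le_toReal (hEtop _)]; exact h1
    have h3 : (X ^ (q / p) * u ^ q) ^ (1 / q) ≤ e (n / (2 ^ j : ℕ)) := by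
      rw [he]; dsimp only
      rw [← ENNReal.toReal_rpow]
      exact Real.rpow_le_rpow (by positivity) h2 (by positivity)
    rw [Real.mul_rpow (by positivity) (by positivity), ← Real.rpow_mul hX0.le, ← Real.rpow_mul hu0,
      mul_one_div_cancel hq.ne', Real.rpow_one, show q / p * (1 / q) = 1 / p by field_simp] at h3
    rw [Real.rpow_neg hX0.le, inv_mul_eq_div, le_div_iff₀ (by positivity)]
    linarith
  have hH : ∀ n : ℤ, ‖(-1:ℂ) ^ n * Hh X (fun z => P (n + z))‖ₑ ≤
      ENNReal.ofReal (8 * C * X ^ (-(1 / p))) * (E (n / (2 ^ j : ℕ)) ^ (1 / q) * ENNReal.ofReal (w (n / (2 ^ j : ℕ)))) := by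
    intro n
    rw [← heE, ← ENNReal.ofReal_mul (he0 _), ← ENNReal.ofReal_mul (by positivity), ← ofReal_norm_eq_enorm]
    apply ENNReal.ofReal_le_ofReal
    rw [norm_mul, norm_neg_one_zpow, one_mul]
    refine (Hh_norm (B := X ^ (-(1 / p)) * e (n / (2 ^ j : ℕ)) * (C * w (n / (2 ^ j : ℕ)))) hX1 ?_).trans (le_of_eq (by ring))
    intro x hx s hs
    have a1 := hu n x s hx hs
    have a2 := hPhi j n k x s hx hs
    have a3 := he0 (n / (2 ^ j : ℕ))
    rw [hPdef]; dsimp only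
    rw [norm_mul, norm_eq_uu]
    have him : |((n:ℂ) + (x + s * I)).im| = X := by simp [hs]
    rw [him]
    calc _ ≤ (X ^ (-(1 / p)) * e (n / (2 ^ j : ℕ)) * Real.exp (π * X)) * (C * w (n / (2 ^ j : ℕ))) := by
          gcongr
      _ = _ := by ring
  have h1 : ‖cc N j k f * KK X‖ₑ ≤ ENNReal.ofReal (8 * C * X ^ (1 - 1 / p)) *
      ∑' m, E m ^ (1 / q) * ENNReal.ofReal (w m) := by
    rw [← hsum.tsum_eq]
    refine (enorm_tsum_le_tsum_enorm).trans ?_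
    refine (ENNReal.tsum_le_tsum hH).trans ?_
    rw [ENNReal.tsum_mul_left]
    haveI : NeZero (2 ^ j : ℕ) := ⟨by positivity⟩
    rw [tsum_div (2 ^ j) (fun m => E m ^ (1 / q) * ENNReal.ofReal (w m)), ← mul_assoc]
    gcongr
    rw [show (((2 ^ j : ℕ) : ℝ≥0∞)) = ENNReal.ofReal X by rw [hX, ← ENNReal.ofReal_natCast]; push_cast; rfl,
      ← ENNReal.ofReal_mul (by positivity)]
    apply ENNReal.ofReal_le_ofReal
    rw [sub_eq_add_neg, Real.rpow_add hX0, Real.rpow_one]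
    exact le_of_eq (by ring)
  have h2 : ENNReal.ofReal (κ * ‖cc N j k f‖) ≤ ENNReal.ofReal (8 * C * X ^ (1 - 1 / p)) *
      ∑' m, E m ^ (1 / q) * ENNReal.ofReal (w m) := by
    refine le_trans ?_ h1
    rw [← ofReal_norm_eq_enorm, norm_mul, mul_comm κ]
    apply ENNReal.ofReal_le_ofReal
    gcongr
    exact hKK X hX1
  have h3 : ENNReal.ofReal (X ^ (1 / p - 1) * ‖cc N j k f‖) ≤ ENNReal.ofReal (8 * C / κ) *
      ∑' m, E m ^ (1 / q) * ENNReal.ofReal (w m) := by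
    calc ENNReal.ofReal (X ^ (1 / p - 1) * ‖cc N j k f‖)
        = ENNReal.ofReal (X ^ (1 / p - 1) / κ) * ENNReal.ofReal (κ * ‖cc N j k f‖) := by
          rw [← ENNReal.ofReal_mul (by positivity)]; congr 1; field_simp
      _ ≤ ENNReal.ofReal (X ^ (1 / p - 1) / κ) * (ENNReal.ofReal (8 * C * X ^ (1 - 1 / p)) *
          ∑' m, E m ^ (1 / q) * ENNReal.ofReal (w m)) := by gcongr
      _ = _ := by
          rw [← mul_assoc, ← ENNReal.ofReal_mul (by positivity)]; congr 2
          have : X ^ (1 / p - 1) * X ^ (1 - 1 / p) = 1 := by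
            rw [← Real.rpow_add hX0]; simp
          calc X ^ (1 / p - 1) / κ * (8 * C * X ^ (1 - 1 / p)) = 8 * C / κ * (X ^ (1 / p - 1) * X ^ (1 - 1 / p)) := by ring
            _ = _ := by rw [this, mul_one]
  have h4 := ENNReal.rpow_le_rpow h3 hq.le
  rw [ENNReal.ofReal_rpow_of_nonneg (by positivity) hq.le, ENNReal.mul_rpow_of_nonneg _ _ hq.le,
    ENNReal.ofReal_rpow_of_nonneg (by positivity) hq.le] at h4
  refine h4.trans ?_
  rw [ENNReal.ofReal_mul (by positivity), mul_assoc]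
  gcongr
  refine (tsum_rpow_le _ hq hq1.le).trans ?_
  rw [← ENNReal.tsum_mul_left]
  refine ENNReal.tsum_le_tsum fun m => ?_
  rw [ENNReal.mul_rpow_of_nonneg _ _ hq.le, ← ENNReal.rpow_mul, one_div_mul_cancel hq.ne', ENNReal.rpow_one,
    ← mul_assoc]
  gcongr
  unfold w2
  rw [ENNReal.ofReal_rpow_of_nonneg (hw0 _) hq.le]
  apply ENNReal.ofReal_le_ofReal
  rw [hw]; dsimp only
  push_cast
  set b := 1 + |(m:ℝ) - k| with hb
  have hb1 : 1 ≤ b := by rw [hb]; linarith [abs_nonneg ((m:ℝ) - k)]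
  rw [Real.inv_rpow (by positivity)]
  apply inv_anti₀ (by positivity)
  rw [← Real.rpow_natCast b N, ← Real.rpow_mul (by positivity), ← Real.rpow_natCast b 2]
  exact Real.rpow_le_rpow_of_exponent_le hb1 (by exact_mod_cast hNq)

lemma uu_cont {f : ℂ → ℂ} (hf : Differentiable ℂ f) : Continuous (uu f) := by
  unfold uu
  have := hf.continuous
  fun_prop

lemma JJ_meas {f : ℂ → ℂ} (hf : Differentiable ℂ f) (p q : ℝ) :
    Measurable fun z : ℂ => ENNReal.ofReal (|z.im| ^ (q / p - 2) * uu f z ^ q) := by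
  have h1 := (uu_cont hf).measurable
  have h2 : Measurable fun z : ℂ => |z.im| := (continuous_abs.comp Complex.continuous_im).measurable
  fun_prop

lemma analysis {p q : ℝ} (hp : 0 < p) (hpq : p < q) (hq1 : q < 1) {N : ℕ} (hN : 2 ≤ N) (hNq : 2 ≤ N * q) :
    ∃ C : ℝ, 0 < C ∧ ∀ f : ℂ → ℂ, Differentiable ℂ f → JJ p q f ≠ ⊤ →
      ∑' j : ℕ, ∑' k : ℤ, ENNReal.ofReal ((((2:ℝ) ^ j) ^ (1 / p - 1) * ‖cc N j k f‖) ^ q) ≤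
        ENNReal.ofReal C * JJ p q f := by
  obtain ⟨C, hC, h⟩ := cc_bound hp hpq hq1 hN hNq
  set W := ∑' n, w2 n with hW
  have hWt : W ≠ ⊤ := w2_sum
  refine ⟨C * (W.toReal + 1) * 45, by positivity, fun f hf hJ => ?_⟩
  have h1 : ∀ j : ℕ, ∑' k : ℤ, ENNReal.ofReal ((((2:ℝ) ^ j) ^ (1 / p - 1) * ‖cc N j k f‖) ^ q) ≤
      ENNReal.ofReal C * W * ∑' m : ℤ, Aj p q f j m := by
    intro j
    refine (ENNReal.tsum_le_tsum (h f hf hJ j)).trans ?_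
    rw [ENNReal.tsum_mul_left, ENNReal.tsum_comm, mul_assoc]
    gcongr
    rw [← ENNReal.tsum_mul_left]
    refine ENNReal.tsum_le_tsum fun m => ?_
    rw [ENNReal.tsum_mul_left, mul_comm]
    gcongr
    exact le_of_eq ((Equiv.subLeft m).tsum_eq w2)
  refine (ENNReal.tsum_le_tsum h1).trans ?_
  rw [ENNReal.tsum_mul_left]
  have h2 := Bx_sum (JJ_meas hf p q)
  have h3 : W ≤ ENNReal.ofReal (W.toReal + 1) := by
    rw [← ENNReal.ofReal_toReal hWt]
    apply ENNReal.ofReal_le_ofReal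
    rw [ENNReal.toReal_ofReal ENNReal.toReal_nonneg]; linarith
  rw [ENNReal.ofReal_mul (by positivity), ENNReal.ofReal_mul hC.le, mul_assoc _ _ (JJ p q f)]
  refine mul_le_mul' (mul_le_mul' le_rfl h3) ?_
  rw [show ENNReal.ofReal 45 = 45 by norm_num]
  exact h2

end ZqAux

namespace ZqAux

lemma lint_abs {a b : ℝ} (ha : -1 < a) (hb : 0 < b) :
    ∫⁻ y : ℝ, ENNReal.ofReal (|y| ^ a * Real.exp (-b * |y|)) ≠ ⊤ := by
  have h0 : IntegrableOn (fun x : ℝ => |x| ^ a * Real.exp (-b * |x|)) (Set.Ioi 0) := by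
    refine (integrableOn_rpow_mul_exp_neg_mul_rpow (p := 1) ha one_pos hb).congr_fun ?_ measurableSet_Ioi
    intro x hx
    simp only [Real.rpow_one]
    rw [abs_of_pos hx]
  have h1 : Integrable (fun x : ℝ => |x| ^ a * Real.exp (-b * |x|)) := by
    rw [← integrableOn_univ, ← @Set.Iio_union_Ici _ _ (0 : ℝ), integrableOn_union,
      integrableOn_Ici_iff_integrableOn_Ioi]
    refine ⟨?_, h0⟩
    rw [← (Measure.measurePreserving_neg (volume : Measure ℝ)).integrableOn_comp_preimage
      (Homeomorph.neg ℝ).measurableEmbedding]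
    simpa only [Function.comp_def, abs_neg, Set.neg_preimage, Set.neg_Iio, neg_zero] using h0
  have h2 := h1.lintegral_lt_top
  exact h2.ne

lemma lint_scale {g : ℝ → ℝ≥0∞} (hg : Measurable g) {X : ℝ} (hX : 0 < X) :
    ∫⁻ x, g (x / X) = ENNReal.ofReal X * ∫⁻ x, g x := by
  have h := Real.smul_map_volume_mul_left (a := X⁻¹) (inv_ne_zero hX.ne')
  have h1 : ∫⁻ x, g x = ENNReal.ofReal X⁻¹ * ∫⁻ x, g (X⁻¹ * x) := by
    conv_lhs => rw [← h]
    rw [lintegral_smul_measure, lintegral_map hg (measurable_const_mul _), abs_of_pos (inv_pos.2 hX), smul_eq_mul]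
  rw [h1, ← mul_assoc, ← ENNReal.ofReal_mul hX.le, mul_inv_cancel₀ hX.ne', ENNReal.ofReal_one, one_mul]
  simp_rw [div_eq_inv_mul]

/-- singular bump -/
noncomputable def phi (q : ℝ) (v : ℝ) : ℝ≥0∞ :=
  (Set.Icc (-(1/2:ℝ)) (1/2)).indicator (fun v => ((ENNReal.ofReal (2 * |v|))⁻¹) ^ q) v

lemma phi_meas (q : ℝ) : Measurable (phi q) := by
  unfold phi
  refine Measurable.indicator ?_ measurableSet_Icc
  have : Measurable fun v : ℝ => |v| := continuous_abs.measurable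
  fun_prop

lemma phi_int {q : ℝ} (hq : 0 < q) (hq1 : q < 1) : ∫⁻ v, phi q v ≠ ⊤ := by
  have h1 := lint_abs (a := -q) (b := 1) (by linarith) one_pos
  have h2 : ∫⁻ v, phi q v ≤ ∫⁻ v, ENNReal.ofReal (Real.exp 1) * ENNReal.ofReal (|v| ^ (-q) * Real.exp (-1 * |v|)) := by
    apply lintegral_mono_ae
    have hae : ∀ᵐ v : ℝ, v ≠ 0 := by
      rw [ae_iff]; simp
    filter_upwards [hae] with v hv
    unfold phi
    have hv' : 0 < |v| := abs_pos.2 hv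
    by_cases hm : v ∈ Set.Icc (-(1/2:ℝ)) (1/2)
    · rw [Set.indicator_of_mem hm, ← ENNReal.ofReal_inv_of_pos (by positivity),
        ENNReal.ofReal_rpow_of_nonneg (by positivity) hq.le, ← ENNReal.ofReal_mul (by positivity)]
      apply ENNReal.ofReal_le_ofReal
      have h3 : |v| ≤ 1 := by rw [abs_le]; constructor <;> linarith [hm.1, hm.2]
      have h4 : 1 ≤ Real.exp 1 * Real.exp (-1 * |v|) := by
        rw [← Real.exp_add]; apply Real.one_le_exp; linarith
      have h5 : ((2 * |v|)⁻¹) ^ q ≤ |v| ^ (-q) := by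
        rw [Real.rpow_neg hv'.le, ← Real.inv_rpow hv'.le]
        apply Real.rpow_le_rpow (by positivity) _ hq.le
        apply inv_anti₀ hv'; linarith
      have h6 : 0 ≤ |v| ^ (-q) := by positivity
      nlinarith
    · rw [Set.indicator_of_notMem hm]; exact zero_le
  refine ne_top_of_le_ne_top ?_ h2
  rw [lintegral_const_mul' _ _ ENNReal.ofReal_ne_top]
  exact ENNReal.mul_ne_top ENNReal.ofReal_ne_top h1

/-- horizontal profile -/
noncomputable def FF (N : ℕ) (q : ℝ) (k : ℤ) (x : ℝ) : ℝ≥0∞ :=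
  ((ENNReal.ofReal |Real.sin (π * x)|)⁻¹ * ENNReal.ofReal (((1 + |x - k| / 2) ^ N)⁻¹)) ^ q

lemma FF_meas (N : ℕ) (q : ℝ) (k : ℤ) : Measurable (FF N q k) := by
  unfold FF
  have h1 : Measurable fun x : ℝ => |Real.sin (π * x)| := (by fun_prop : Continuous _).measurable
  have h2 : Measurable fun x : ℝ => ((1 + |x - k| / 2) ^ N)⁻¹ :=
    (by fun_prop : Continuous fun x : ℝ => (1 + |x - k| / 2) ^ N).measurable.inv
  fun_prop

lemma FF_le {N : ℕ} {q : ℝ} (hq : 0 < q) (hNq : 2 ≤ N * q) (k : ℤ) (x : ℝ) :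
    FF N q k x ≤ ENNReal.ofReal ((4 ^ N) ^ q) * ∑' n : ℤ, w2 (n - k) * phi q (x - n) := by
  set n := round x with hn
  set v := x - n with hv
  have hv2 : |v| ≤ 1 / 2 := abs_sub_round x
  have hmem : v ∈ Set.Icc (-(1/2:ℝ)) (1/2) := abs_le.1 hv2
  refine le_trans ?_ (mul_le_mul' le_rfl (ENNReal.le_tsum n))
  unfold FF phi
  rw [← hv, Set.indicator_of_mem hmem, ENNReal.mul_rpow_of_nonneg _ _ hq.le, ← mul_assoc, mul_comm]
  have h1 : |Real.sin (π * x)| = |Real.sin (π * v)| := by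
    rw [hv, mul_sub, mul_comm π (n:ℝ), Real.sin_sub_int_mul_pi, abs_mul, abs_zpow]; simp
  have h2 : 2 * |v| ≤ |Real.sin (π * x)| := by
    rw [h1]
    have := Real.mul_abs_le_abs_sin (x := π * v) (by
      rw [abs_mul, abs_of_pos Real.pi_pos]; nlinarith [Real.pi_pos])
    rw [abs_mul, abs_of_pos Real.pi_pos] at this
    calc 2 * |v| = 2 / π * (π * |v|) := by have := Real.pi_ne_zero; field_simp
      _ ≤ _ := this
  refine mul_le_mul' ?_ (ENNReal.rpow_le_rpow (ENNReal.inv_le_inv.2 (ENNReal.ofReal_le_ofReal h2)) hq.le)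
  unfold w2
  rw [ENNReal.ofReal_rpow_of_nonneg (by positivity) hq.le, ← ENNReal.ofReal_mul (by positivity)]
  apply ENNReal.ofReal_le_ofReal
  push_cast
  set b := 1 + |(n:ℝ) - k| with hb
  have hb1 : 1 ≤ b := by rw [hb]; linarith [abs_nonneg ((n:ℝ) - k)]
  have h3 : b ≤ 4 * (1 + |x - k| / 2) := by
    have : |(n:ℝ) - k| ≤ |x - k| + |v| := by
      rw [show (n:ℝ) - k = (x - k) - v by rw [hv]; ring]; exact abs_sub _ _
    rw [hb]; linarith [abs_nonneg (x - k)]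
  have hx : 0 < 1 + |x - k| / 2 := by positivity
  calc (((1 + |x - k| / 2) ^ N)⁻¹) ^ q ≤ (4 ^ N * (b ^ N)⁻¹) ^ q := by
        apply Real.rpow_le_rpow (by positivity) _ hq.le
        rw [inv_eq_one_div, ← div_eq_mul_inv, div_le_div_iff₀ (by positivity) (by positivity), one_mul, ← mul_pow]
        gcongr
    _ = (4 ^ N) ^ q * ((b ^ N)⁻¹) ^ q := Real.mul_rpow (by positivity) (by positivity)
    _ ≤ (4 ^ N) ^ q * (b ^ 2)⁻¹ := by
        gcongr
        rw [Real.inv_rpow (by positivity)]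
        apply inv_anti₀ (by positivity)
        rw [← Real.rpow_natCast b N, ← Real.rpow_mul (by positivity), ← Real.rpow_natCast b 2]
        exact Real.rpow_le_rpow_of_exponent_le hb1 (by exact_mod_cast hNq)

lemma FF_int {N : ℕ} {q : ℝ} (hq : 0 < q) (hq1 : q < 1) (hNq : 2 ≤ N * q) :
    ∃ K : ℝ≥0∞, K ≠ ⊤ ∧ ∀ k : ℤ, ∫⁻ x, FF N q k x ≤ K := by
  refine ⟨ENNReal.ofReal ((4 ^ N) ^ q) * ((∑' n, w2 n) * ∫⁻ v, phi q v),
    ENNReal.mul_ne_top ENNReal.ofReal_ne_top (ENNReal.mul_ne_top w2_sum (phi_int hq hq1)), fun k => ?_⟩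
  refine (lintegral_mono (FF_le hq hNq k)).trans ?_
  rw [lintegral_const_mul' _ _ ENNReal.ofReal_ne_top]
  refine mul_le_mul' le_rfl ?_
  have hm : ∀ n : ℤ, AEMeasurable (fun x : ℝ => w2 (n - k) * phi q (x - n)) :=
    fun n => (((phi_meas q).comp (measurable_id.sub_const (n:ℝ))).const_mul _).aemeasurable
  rw [lintegral_tsum hm]
  have : ∀ n : ℤ, ∫⁻ x, w2 (n - k) * phi q (x - n) = w2 (n - k) * ∫⁻ v, phi q v := by
    intro n
    rw [lintegral_const_mul' _ _ (by unfold w2; exact ENNReal.ofReal_ne_top), lintegral_sub_right_eq_self]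
  simp_rw [this]
  rw [ENNReal.tsum_mul_right]
  exact le_of_eq (congrArg (· * _) ((Equiv.subRight k).tsum_eq w2))

lemma DD_sin (j : ℕ) (z : ℂ) : DD j z * 2 ^ j * Complex.sin (π * z / 2 ^ j) = Complex.sin (π * z) := by
  induction j with
  | zero => simp [DD]
  | succ j ih =>
    rw [DD_succ, ← ih]
    have : (π * z / 2 ^ j : ℂ) = 2 * (π * z / 2 ^ (j + 1)) := by rw [pow_succ]; field_simp
    rw [this, Complex.sin_two_mul]; ring

lemma DD_norm (j : ℕ) (z : ℂ) : ‖DD j z‖ * Real.exp (π * |z.im| / 2 ^ j) ≤ Real.exp (π * |z.im|) := by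
  induction j with
  | zero => simp [DD]
  | succ j ih =>
    rw [DD_succ, norm_mul]
    refine le_trans ?_ ih
    have h1 : ‖Complex.cos (π * z / 2 ^ (j + 1))‖ ≤ Real.exp (π * |z.im| / 2 ^ (j + 1)) := by
      rw [← Complex.sin_add_pi_div_two]
      refine (norm_sin_le _).trans (Real.exp_le_exp.2 (le_of_eq ?_))
      have : (π * z / 2 ^ (j + 1) + π / 2 : ℂ) = ((π / 2 ^ (j + 1) : ℝ) : ℂ) * z + ((π / 2 : ℝ) : ℂ) := by
        push_cast; ring
      rw [this, Complex.add_im, Complex.im_ofReal_mul, Complex.ofReal_im, add_zero, abs_mul, abs_of_pos (by positivity)]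
      ring
    calc ‖DD j z‖ * ‖Complex.cos (π * z / 2 ^ (j + 1))‖ * Real.exp (π * |z.im| / 2 ^ (j + 1))
        ≤ ‖DD j z‖ * Real.exp (π * |z.im| / 2 ^ (j + 1)) * Real.exp (π * |z.im| / 2 ^ (j + 1)) := by gcongr
      _ = ‖DD j z‖ * Real.exp (π * |z.im| / 2 ^ j) := by
        rw [mul_assoc, ← Real.exp_add]; congr 2; rw [pow_succ]; field_simp; ring

lemma at_diff (N j : ℕ) (k : ℤ) : Differentiable ℂ (at' N j k) := by
  unfold at' DD
  apply Differentiable.mul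
  · fun_prop
  · exact (Phi_diff N).comp (by fun_prop)

lemma at_arg (j : ℕ) (k : ℤ) (z : ℂ) : ((z - 2 ^ j * k) / 2 ^ (j + 1)).re = (z.re / 2 ^ j - k) / 2 ∧
    ((z - 2 ^ j * k) / 2 ^ (j + 1)).im = z.im / 2 ^ j / 2 := by
  have e : ((z - 2 ^ j * k) / 2 ^ (j + 1) : ℂ) = ((1 / 2 : ℝ) : ℂ) * (z / 2 ^ j - k) := by
    push_cast; rw [pow_succ]; field_simp
  rw [e, Complex.re_ofReal_mul, Complex.im_ofReal_mul, div_pow_re, div_pow_im]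
  constructor <;> ring

lemma at_uu_bound {N : ℕ} (hN : 0 < N) : ∃ C : ℝ, 0 < C ∧ ∀ j k z, uu (at' N j k) z ≤ C := by
  obtain ⟨C, hC, h⟩ := Phi_bound hN
  refine ⟨C, hC, fun j k z => ?_⟩
  unfold uu at'
  rw [norm_mul]
  have h1 := DD_norm j z
  have h2 := h ((z - 2 ^ j * k) / 2 ^ (j + 1))
  rw [(at_arg j k z).2, abs_div, abs_div, abs_of_pos (by positivity : (0:ℝ) < 2 ^ j), abs_of_pos (by norm_num : (0:ℝ) < 2)] at h2
  have h3 : ‖Phi N ((z - 2 ^ j * k) / 2 ^ (j + 1))‖ ≤ C * Real.exp (π * |z.im| / 2 ^ j) := by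
    refine h2.trans ?_
    refine (div_le_self (by positivity) (one_le_pow₀ (by linarith [norm_nonneg ((z - 2 ^ j * k) / 2 ^ (j + 1))]))).trans ?_
    gcongr
    have : 0 ≤ π * |z.im| / 2 ^ j := by positivity
    calc 4 * π / 3 * (|z.im| / 2 ^ j / 2) = 2 / 3 * (π * |z.im| / 2 ^ j) := by ring
      _ ≤ _ := by linarith
  calc ‖DD j z‖ * ‖Phi N ((z - 2 ^ j * k) / 2 ^ (j + 1))‖ * Real.exp (-π * |z.im|)
      ≤ ‖DD j z‖ * (C * Real.exp (π * |z.im| / 2 ^ j)) * Real.exp (-π * |z.im|) := by gcongr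
    _ = C * (‖DD j z‖ * Real.exp (π * |z.im| / 2 ^ j)) * Real.exp (-π * |z.im|) := by ring
    _ ≤ C * Real.exp (π * |z.im|) * Real.exp (-π * |z.im|) := by gcongr
    _ = C := by rw [mul_assoc, ← Real.exp_add]; simp

lemma at_pt {N : ℕ} (hN : 0 < N) : ∃ C : ℝ, 0 < C ∧ ∀ (j : ℕ) (k : ℤ) (z : ℂ),
    uu (at' N j k) z * |Real.sin (π * (z.re / 2 ^ j))| ≤
      C / 2 ^ j * Real.exp (-(π / 3) * |z.im / 2 ^ j|) * ((1 + |z.re / 2 ^ j - k| / 2) ^ N)⁻¹ := by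
  obtain ⟨C, hC, h⟩ := Phi_bound hN
  refine ⟨2 * C, by positivity, fun j k z => ?_⟩
  have hX : (0:ℝ) < 2 ^ j := by positivity
  set x := z.re / 2 ^ j with hx
  set t := z.im / 2 ^ j with ht
  have h2 := h ((z - 2 ^ j * k) / 2 ^ (j + 1))
  set b := (z - 2 ^ j * k) / 2 ^ (j + 1) with hb
  have hbre : b.re = (x - k) / 2 := (at_arg j k z).1
  have hbim : b.im = t / 2 := (at_arg j k z).2
  have h3 : ‖Phi N b‖ ≤ C * Real.exp (2 * π / 3 * |t|) * ((1 + |x - k| / 2) ^ N)⁻¹ := by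
    refine h2.trans ?_
    rw [div_eq_mul_inv, hbim]
    have h4 : |x - k| / 2 ≤ ‖b‖ := by
      have := Complex.abs_re_le_norm b
      rwa [hbre, abs_div, abs_of_pos (by norm_num : (0:ℝ) < 2)] at this
    have h5 : 4 * π / 3 * |t / 2| = 2 * π / 3 * |t| := by
      rw [abs_div, abs_of_pos (by norm_num : (0:ℝ) < 2)]; ring
    rw [h5]
    gcongr
  have hs : ‖DD j z‖ * 2 ^ j * (|Real.sin (π * x)| * (Real.exp (π * |t|) / 2)) ≤ Real.exp (π * |z.im|) := by
    have e := congrArg norm (DD_sin j z)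
    rw [norm_mul, norm_mul, norm_pow, Complex.norm_two] at e
    have a1 : ‖Complex.sin (π * z)‖ ≤ Real.exp (π * |z.im|) := by
      refine (norm_sin_le _).trans (le_of_eq ?_)
      rw [Complex.im_ofReal_mul, abs_mul, abs_of_pos Real.pi_pos]
    rw [← e] at a1
    refine le_trans ?_ a1
    have a2 := norm_sin_ge_cosh (π * z / 2 ^ j)
    have e2 : (π * z / 2 ^ j : ℂ) = ((π / 2 ^ j : ℝ) : ℂ) * z := by push_cast; ring
    have e3 : (π * z / 2 ^ j : ℂ).re = π * x := by rw [e2, Complex.re_ofReal_mul, hx]; ring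
    have e4 : (π * z / 2 ^ j : ℂ).im = π * t := by rw [e2, Complex.im_ofReal_mul, ht]; ring
    rw [e3, e4] at a2
    have a3 := exp_abs_le_cosh (π * t)
    rw [abs_mul, abs_of_pos Real.pi_pos] at a3
    calc _ ≤ ‖DD j z‖ * 2 ^ j * (|Real.sin (π * x)| * Real.cosh (π * t)) := by gcongr
      _ ≤ _ := by gcongr
  have hs2 : ‖DD j z‖ * |Real.sin (π * x)| * Real.exp (-π * |z.im|) ≤ 2 / 2 ^ j * Real.exp (-π * |t|) := by
    have p1 : Real.exp (-π * |z.im|) = (Real.exp (π * |z.im|))⁻¹ := by rw [← Real.exp_neg]; congr 1; ring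
    have p2 : Real.exp (-π * |t|) = (Real.exp (π * |t|))⁻¹ := by rw [← Real.exp_neg]; congr 1; ring
    rw [p1, p2, ← div_eq_mul_inv, div_le_iff₀ (Real.exp_pos _)]
    have := mul_le_mul_of_nonneg_left hs (by positivity : 0 ≤ 2 / 2 ^ j * (Real.exp (π * |t|))⁻¹)
    refine le_trans (le_of_eq ?_) this
    have := Real.exp_ne_zero (π * |t|)
    field_simp
  unfold uu at'
  rw [← hb, norm_mul]
  calc ‖DD j z‖ * ‖Phi N b‖ * Real.exp (-π * |z.im|) * |Real.sin (π * x)|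
      = (‖DD j z‖ * |Real.sin (π * x)| * Real.exp (-π * |z.im|)) * ‖Phi N b‖ := by ring
    _ ≤ (2 / 2 ^ j * Real.exp (-π * |t|)) * (C * Real.exp (2 * π / 3 * |t|) * ((1 + |x - k| / 2) ^ N)⁻¹) := by gcongr
    _ = 2 * C / 2 ^ j * (Real.exp (-π * |t|) * Real.exp (2 * π / 3 * |t|)) * ((1 + |x - k| / 2) ^ N)⁻¹ := by ring
    _ = _ := by rw [← Real.exp_add]; congr 3; ring

end ZqAux

namespace ZqAux

lemma lint_reim {F G : ℝ → ℝ≥0∞} (hF : Measurable F) (hG : Measurable G) :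
    ∫⁻ z : ℂ, F z.re * G z.im = (∫⁻ x, F x) * ∫⁻ y, G y := by
  rw [← lintegral_prod_mul hF.aemeasurable hG.aemeasurable]
  have := (Complex.volume_preserving_equiv_real_prod).lintegral_comp_emb
    Complex.measurableEquivRealProd.measurableEmbedding (fun w : ℝ × ℝ => F w.1 * G w.2)
  exact this

lemma at_norm {p q : ℝ} (hp : 0 < p) (hpq : p < q) (hq1 : q < 1) {N : ℕ} (hN : 2 ≤ N) (hNq : 2 ≤ N * q) :
    ∃ C : ℝ, 0 < C ∧ ∀ (j : ℕ) (k : ℤ),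
      JJ p q (at' N j k) ≤ ENNReal.ofReal (C * (((2:ℝ) ^ j) ^ (1 / p - 1)) ^ q) := by
  have hq : 0 < q := hp.trans hpq
  obtain ⟨C, hC, h⟩ := at_pt (N := N) (by omega)
  obtain ⟨K, hK, hF⟩ := FF_int (N := N) hq hq1 hNq
  set α := q / p - 2 with hα
  have hα1 : -1 < α := by
    have : 1 < q / p := by rw [one_lt_div hp]; exact hpq
    rw [hα]; linarith
  set L := ∫⁻ y : ℝ, ENNReal.ofReal (|y| ^ α * Real.exp (-(π / 3 * q) * |y|)) with hL
  have hLt : L ≠ ⊤ := lint_abs hα1 (by positivity)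
  refine ⟨C ^ q * (K.toReal * L.toReal) + 1, by positivity, fun j k => ?_⟩
  set X : ℝ := 2 ^ j with hX
  have hX0 : 0 < X := by positivity
  set G : ℝ → ℝ≥0∞ := fun y => ENNReal.ofReal (|y| ^ α * Real.exp (-(π / 3 * q) * |y|)) with hG
  have hGm : Measurable G := by
    have : Measurable fun v : ℝ => |v| := continuous_abs.measurable
    rw [hG]; fun_prop
  have hpt : ∀ z : ℂ, ENNReal.ofReal (|z.im| ^ α * uu (at' N j k) z ^ q) ≤
      ENNReal.ofReal ((C / X) ^ q * X ^ α) * (FF N q k (z.re / X) * G (z.im / X)) := by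
    intro z
    have h1 := h j k z
    rw [← hX] at h1
    have hu := uu_nonneg (at' N j k) z
    set u := uu (at' N j k) z
    set s := |Real.sin (π * (z.re / X))| with hs
    set b := ((1 + |z.re / X - k| / 2) ^ N)⁻¹ with hb
    have hb0 : 0 < b := by positivity
    set e := Real.exp (-(π / 3) * |z.im / X|) with he
    have h2 : ENNReal.ofReal u ≤ ENNReal.ofReal (C / X * e) * ((ENNReal.ofReal s)⁻¹ * ENNReal.ofReal b) := by
      have h3 : ENNReal.ofReal u * ENNReal.ofReal s ≤ ENNReal.ofReal (C / X * e * b) := by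
        rw [← ENNReal.ofReal_mul hu]; exact ENNReal.ofReal_le_ofReal h1
      have h4 : ENNReal.ofReal u ≤ ENNReal.ofReal (C / X * e * b) / ENNReal.ofReal s := by
        rw [ENNReal.le_div_iff_mul_le]
        · exact h3
        · right
          rw [ne_eq, ENNReal.ofReal_eq_zero, not_le]; positivity
        · left; exact ENNReal.ofReal_ne_top
      refine h4.trans (le_of_eq ?_)
      rw [ENNReal.ofReal_mul (by positivity), div_eq_mul_inv]; ring
    have h5 := ENNReal.rpow_le_rpow h2 hq.le
    rw [ENNReal.mul_rpow_of_nonneg _ _ hq.le, ENNReal.ofReal_rpow_of_nonneg hu hq.le,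
      ENNReal.ofReal_rpow_of_nonneg (by positivity) hq.le] at h5
    rw [ENNReal.ofReal_mul (by positivity)]
    refine (mul_le_mul' le_rfl h5).trans (le_of_eq ?_)
    have h6 : ENNReal.ofReal (|z.im| ^ α) * ENNReal.ofReal ((C / X * e) ^ q) =
        ENNReal.ofReal ((C / X) ^ q * X ^ α) * G (z.im / X) := by
      rw [hG]; dsimp only
      rw [← ENNReal.ofReal_mul (by positivity), ← ENNReal.ofReal_mul (by positivity)]
      congr 1
      rw [Real.mul_rpow (by positivity) (by positivity)]
      have e1 : e ^ q = Real.exp (-(π / 3 * q) * |z.im / X|) := by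
        rw [he, ← Real.exp_mul]; congr 1; ring
      have e2 : |z.im| ^ α = X ^ α * |z.im / X| ^ α := by
        rw [← Real.mul_rpow hX0.le (abs_nonneg _), abs_div, abs_of_pos hX0]; congr 1; field_simp
      rw [e1, e2]; ring
    unfold FF
    rw [← hs, ← hb, ← mul_assoc, h6]; ring
  unfold JJ
  refine (lintegral_mono hpt).trans ?_
  rw [lintegral_const_mul' _ _ ENNReal.ofReal_ne_top]
  rw [lint_reim (F := fun x => FF N q k (x / X)) (G := fun y => G (y / X))
    ((FF_meas N q k).comp (measurable_id.div_const X)) (hGm.comp (measurable_id.div_const X)),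
    lint_scale (FF_meas N q k) hX0, lint_scale hGm hX0]
  have hX2 : (X ^ (1 / p - 1)) ^ q = X ^ (-q) * X ^ α * (X * X) := by
    rw [show X * X = X ^ (2:ℝ) by rw [Real.rpow_two]; ring, ← Real.rpow_mul hX0.le, ← Real.rpow_add hX0,
      ← Real.rpow_add hX0]
    congr 1; rw [hα]; field_simp; ring
  calc _ ≤ ENNReal.ofReal ((C / X) ^ q * X ^ α) * (ENNReal.ofReal X * ENNReal.ofReal K.toReal * (ENNReal.ofReal X * ENNReal.ofReal L.toReal)) := by
        rw [ENNReal.ofReal_toReal hK, ENNReal.ofReal_toReal hLt]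
        gcongr
        exact hF k
    _ = ENNReal.ofReal (C ^ q * (K.toReal * L.toReal) * (X ^ (1 / p - 1)) ^ q) := by
        rw [← ENNReal.ofReal_mul (by positivity), ← ENNReal.ofReal_mul (by positivity), ← ENNReal.ofReal_mul (by positivity),
          ← ENNReal.ofReal_mul (by positivity), hX2, Real.div_rpow hC.le hX0.le, Real.rpow_neg hX0.le]
        congr 1; ring
    _ ≤ _ := by
        apply ENNReal.ofReal_le_ofReal
        gcongr; linarith

end ZqAux

namespace ZqAux

/-- weights -/
noncomputable def Wt (p : ℝ) (j : ℕ) : ℝ := ((2:ℝ) ^ j) ^ (1 / p - 1)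

lemma Wt_pos (p : ℝ) (j : ℕ) : 0 < Wt p j := by unfold Wt; positivity

lemma Wt_one {p : ℝ} (hp : 0 < p) (hp1 : p < 1) (j : ℕ) : 1 ≤ Wt p j := by
  unfold Wt
  apply Real.one_le_rpow (one_le_pow₀ (by norm_num))
  have : 1 < 1 / p := by rw [one_lt_div hp]; exact hp1
  linarith

/-- normalized atoms -/
noncomputable def Am (p : ℝ) (N : ℕ) (i : ℕ × ℤ) (z : ℂ) : ℂ :=
  ((-(Wt p i.1)⁻¹ : ℝ) : ℂ) * at' N i.1 (2 * i.2 + 1) z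

/-- coefficient functionals -/
noncomputable def la (p : ℝ) (N : ℕ) (i : ℕ × ℤ) (f : ℂ → ℂ) : ℂ :=
  (Wt p i.1 : ℂ) * cc N i.1 (2 * i.2 + 1) f

lemma cc_smul (N j : ℕ) (k : ℤ) (c : ℂ) (f : ℂ → ℂ) :
    cc N j k (fun z => c * f z) = c * cc N j k f := by
  unfold cc
  rw [← tsum_mul_left]
  congr 1; ext n; ring

lemma la_Am (p : ℝ) {N : ℕ} (hN : 2 ≤ N) (i i' : ℕ × ℤ) :
    la p N i' (Am p N i) = if i = i' then 1 else 0 := by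
  unfold la
  have : Am p N i = fun z => ((-(Wt p i.1)⁻¹ : ℝ) : ℂ) * at' N i.1 (2 * i.2 + 1) z := rfl
  rw [this, cc_smul, biorth hN i.1 i'.1 ⟨i.2, rfl⟩ ⟨i'.2, rfl⟩]
  by_cases h : i = i'
  · subst h
    have := (Wt_pos p i.1).ne'
    have h2 : (Wt p i.1 : ℂ) ≠ 0 := by exact_mod_cast this
    simp [h2]
  · have : ¬ (i.1 = i'.1 ∧ 2 * i.2 + 1 = 2 * i'.2 + 1) := by
      rintro ⟨h1, h2⟩; exact h (Prod.ext h1 (by omega))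
    rw [if_neg this, if_neg h]; simp

lemma uu_smul (c : ℝ) (f : ℂ → ℂ) (z : ℂ) : uu (fun z => (c : ℂ) * f z) z = |c| * uu f z := by
  unfold uu; rw [norm_mul, Complex.norm_real, Real.norm_eq_abs]; ring

lemma Am_diff (p : ℝ) (N : ℕ) (i : ℕ × ℤ) : Differentiable ℂ (Am p N i) :=
  (at_diff N i.1 (2 * i.2 + 1)).const_mul _

lemma Am_bound {p : ℝ} (hp : 0 < p) (hp1 : p < 1) {N : ℕ} (hN : 0 < N) :
    ∃ C : ℝ, 0 < C ∧ ∀ i z, uu (Am p N i) z ≤ C := by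
  obtain ⟨C, hC, h⟩ := at_uu_bound hN
  refine ⟨C, hC, fun i z => ?_⟩
  unfold Am
  rw [uu_smul, abs_neg, abs_of_pos (inv_pos.2 (Wt_pos p _))]
  have h1 : (Wt p i.1)⁻¹ ≤ 1 := inv_le_one_of_one_le₀ (Wt_one hp hp1 _)
  have h2 := h i.1 (2 * i.2 + 1) z
  have h3 := uu_nonneg (at' N i.1 (2 * i.2 + 1)) z
  have h4 := (inv_pos.2 (Wt_pos p i.1)).le
  nlinarith

lemma Am_JJ {p q : ℝ} (hp : 0 < p) (hpq : p < q) (hq1 : q < 1) {N : ℕ} (hN : 2 ≤ N) (hNq : 2 ≤ N * q) :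
    ∃ C : ℝ, 0 < C ∧ ∀ i, JJ p q (Am p N i) ≤ ENNReal.ofReal C := by
  have hq : 0 < q := hp.trans hpq
  obtain ⟨C, hC, h⟩ := at_norm hp hpq hq1 hN hNq
  refine ⟨C, hC, fun i => ?_⟩
  have hw := Wt_pos p i.1
  have e : JJ p q (Am p N i) = ENNReal.ofReal (((Wt p i.1)⁻¹) ^ q) * JJ p q (at' N i.1 (2 * i.2 + 1)) := by
    unfold JJ
    rw [← lintegral_const_mul' _ _ ENNReal.ofReal_ne_top]
    congr 1; ext z
    rw [← ENNReal.ofReal_mul (by positivity)]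
    unfold Am
    rw [uu_smul, abs_neg, abs_of_pos (inv_pos.2 hw), Real.mul_rpow (by positivity) (uu_nonneg _ _)]
    congr 1; ring
  rw [e]
  refine (mul_le_mul' le_rfl (h i.1 _)).trans ?_
  rw [← ENNReal.ofReal_mul (by positivity)]
  apply ENNReal.ofReal_le_ofReal
  change ((Wt p i.1)⁻¹) ^ q * (C * (Wt p i.1) ^ q) ≤ C
  rw [Real.inv_rpow hw.le]
  have : (Wt p i.1) ^ q ≠ 0 := by positivity
  field_simp
  exact le_rfl

/-- synthesis operator -/
noncomputable def Sy (p : ℝ) (N : ℕ) (a : ℕ × ℤ → ℂ) (z : ℂ) : ℂ := ∑' i, a i * Am p N i z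

lemma norm_le_uu {f : ℂ → ℂ} {C : ℝ} {z : ℂ} (h : uu f z ≤ C) : ‖f z‖ ≤ C * Real.exp (π * |z.im|) := by
  rw [norm_eq_uu]; gcongr

lemma Sy_summable {p : ℝ} (hp : 0 < p) (hp1 : p < 1) {N : ℕ} (hN : 0 < N) {a : ℕ × ℤ → ℂ}
    (ha : Summable fun i => ‖a i‖) (z : ℂ) : Summable fun i => ‖a i * Am p N i z‖ := by
  obtain ⟨C, hC, h⟩ := Am_bound hp hp1 hN
  refine Summable.of_nonneg_of_le (fun i => norm_nonneg _) (fun i => ?_) (ha.mul_right (C * Real.exp (π * |z.im|)))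
  rw [norm_mul]
  gcongr
  exact norm_le_uu (h i z)

lemma Sy_diff {p : ℝ} (hp : 0 < p) (hp1 : p < 1) {N : ℕ} (hN : 0 < N) {a : ℕ × ℤ → ℂ}
    (ha : Summable fun i => ‖a i‖) : Differentiable ℂ (Sy p N a) := by
  obtain ⟨C, hC, h⟩ := Am_bound hp hp1 hN
  intro z
  have h1 : DifferentiableOn ℂ (Sy p N a) (Metric.ball 0 (‖z‖ + 1)) := by
    refine differentiableOn_tsum_of_summable_norm (ha.mul_right (C * Real.exp (π * (‖z‖ + 1))))
      (fun i => ((Am_diff p N i).const_mul (a i)).differentiableOn) Metric.isOpen_ball ?_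
    intro i w hw
    rw [norm_mul]
    gcongr
    refine (norm_le_uu (h i w)).trans ?_
    gcongr
    refine (Complex.abs_im_le_norm w).trans ?_
    rw [mem_ball_zero_iff] at hw; exact hw.le
  exact h1.differentiableAt (Metric.isOpen_ball.mem_nhds (by rw [mem_ball_zero_iff]; linarith))

lemma Sy_uu {p : ℝ} (hp : 0 < p) (hp1 : p < 1) {N : ℕ} (hN : 0 < N) {a : ℕ × ℤ → ℂ}
    (ha : Summable fun i => ‖a i‖) (z : ℂ) :
    ENNReal.ofReal (uu (Sy p N a) z) ≤ ∑' i, ENNReal.ofReal (‖a i‖ * uu (Am p N i) z) := by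
  have hs := Sy_summable hp hp1 hN ha z
  have h1 : uu (Sy p N a) z ≤ ∑' i, ‖a i‖ * uu (Am p N i) z := by
    unfold uu Sy
    refine (mul_le_mul_of_nonneg_right (norm_tsum_le_tsum_norm hs) (Real.exp_pos _).le).trans (le_of_eq ?_)
    rw [← tsum_mul_right]
    congr 1; ext i; rw [norm_mul]; ring
  have h2 : Summable fun i => ‖a i‖ * uu (Am p N i) z := by
    refine (hs.mul_right (Real.exp (-π * |z.im|))).congr fun i => ?_
    unfold uu; rw [norm_mul]; ring
  rw [← ENNReal.ofReal_tsum_of_nonneg (fun i => mul_nonneg (norm_nonneg _) (uu_nonneg _ _)) h2]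
  exact ENNReal.ofReal_le_ofReal h1

lemma Sy_JJ {p q : ℝ} (hp : 0 < p) (hpq : p < q) (hq1 : q < 1) {N : ℕ} (hN : 2 ≤ N) (hNq : 2 ≤ N * q) :
    ∃ C : ℝ, 0 < C ∧ ∀ a : ℕ × ℤ → ℂ, Summable (fun i => ‖a i‖) →
      JJ p q (Sy p N a) ≤ ENNReal.ofReal C * ∑' i, ENNReal.ofReal (‖a i‖ ^ q) := by
  have hq : 0 < q := hp.trans hpq
  obtain ⟨C, hC, h⟩ := Am_JJ hp hpq hq1 hN hNq
  refine ⟨C, hC, fun a ha => ?_⟩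
  have hpt : ∀ z : ℂ, ENNReal.ofReal (|z.im| ^ (q / p - 2) * uu (Sy p N a) z ^ q) ≤
      ∑' i, ENNReal.ofReal (‖a i‖ ^ q) * ENNReal.ofReal (|z.im| ^ (q / p - 2) * uu (Am p N i) z ^ q) := by
    intro z
    have h1 := ENNReal.rpow_le_rpow (Sy_uu hp (hpq.trans hq1) (N := N) (by omega) ha z) hq.le
    rw [ENNReal.ofReal_rpow_of_nonneg (uu_nonneg _ _) hq.le] at h1
    have h2 := h1.trans (tsum_rpow_le _ hq hq1.le)
    rw [ENNReal.ofReal_mul (by positivity)]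
    refine (mul_le_mul' le_rfl h2).trans (le_of_eq ?_)
    rw [← ENNReal.tsum_mul_left]
    congr 1; ext i
    have := uu_nonneg (Am p N i) z
    rw [ENNReal.ofReal_rpow_of_nonneg (by positivity) hq.le, ← ENNReal.ofReal_mul (by positivity),
      ← ENNReal.ofReal_mul (by positivity), Real.mul_rpow (by positivity) (by positivity)]
    congr 1; ring
  refine (lintegral_mono hpt).trans ?_
  rw [lintegral_tsum (fun i => ((JJ_meas (Am_diff p N i) p q).const_mul _).aemeasurable), ← ENNReal.tsum_mul_left]
  refine ENNReal.tsum_le_tsum fun i => ?_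
  rw [lintegral_const_mul' _ _ ENNReal.ofReal_ne_top, mul_comm]
  exact mul_le_mul' (h i) le_rfl

lemma cc_Sy {p : ℝ} (hp : 0 < p) (hp1 : p < 1) {N : ℕ} (hN : 2 ≤ N) {a : ℕ × ℤ → ℂ}
    (ha : Summable fun i => ‖a i‖) (j : ℕ) (k : ℤ) :
    cc N j k (Sy p N a) = ∑' i, a i * cc N j k (Am p N i) := by
  obtain ⟨C, hC, h⟩ := Am_bound hp hp1 (N := N) (by omega)
  have hC' : ∀ i (n : ℤ), ‖Am p N i n‖ ≤ C := fun i n => by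
    have := norm_le_uu (h i n); simpa using this
  have hθ : Summable fun n : ℤ => ‖(-1:ℂ) ^ n * 1 * Phi N (n / 2 ^ j - k)‖ :=
    cc_summable hN j k (f := fun _ => 1) (M := 1) (by simp)
  have hs : Summable (Function.uncurry fun (n : ℤ) (i : ℕ × ℤ) =>
      a i * ((-1:ℂ) ^ n * Am p N i n * Phi N (n / 2 ^ j - k))) := by
    apply Summable.of_norm
    have h1 := (hθ.mul_of_nonneg ha (fun _ => norm_nonneg _) (fun _ => norm_nonneg _)).mul_right C
    refine Summable.of_nonneg_of_le (fun _ => norm_nonneg _) ?_ h1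
    rintro ⟨n, i⟩
    simp only [Function.uncurry]
    rw [mul_one, norm_mul, norm_mul, norm_mul, norm_mul]
    calc ‖a i‖ * (‖(-1:ℂ) ^ n‖ * ‖Am p N i n‖ * ‖Phi N (n / 2 ^ j - k)‖)
        ≤ ‖a i‖ * (‖(-1:ℂ) ^ n‖ * C * ‖Phi N (n / 2 ^ j - k)‖) := by gcongr; exact hC' i n
      _ = _ := by ring
  have e1 : cc N j k (Sy p N a) = ∑' (n : ℤ) (i : ℕ × ℤ), a i * ((-1:ℂ) ^ n * Am p N i n * Phi N (n / 2 ^ j - k)) := by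
    unfold cc Sy
    congr 1; ext n
    rw [← tsum_mul_left, ← tsum_mul_right]
    congr 1; ext i; ring
  rw [e1, ← hs.tsum_comm]
  congr 1; ext i
  unfold cc
  rw [tsum_mul_left]

lemma la_Sy {p : ℝ} (hp : 0 < p) (hp1 : p < 1) {N : ℕ} (hN : 2 ≤ N) {a : ℕ × ℤ → ℂ}
    (ha : Summable fun i => ‖a i‖) (i : ℕ × ℤ) : la p N i (Sy p N a) = a i := by
  have e : la p N i (Sy p N a) = ∑' i', a i' * la p N i (Am p N i') := by
    unfold la
    rw [cc_Sy hp hp1 hN ha, ← tsum_mul_left]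
    congr 1; ext i'; ring
  rw [e, tsum_eq_single i]
  · rw [la_Am p hN, if_pos rfl, mul_one]
  · intro i' hi'
    rw [la_Am p hN, if_neg hi', mul_zero]

/-- domain of the coefficient functionals -/
def Dm (N : ℕ) : Submodule ℂ (ℂ → ℂ) where
  carrier := {f | ∀ (j : ℕ) (k : ℤ), Summable fun n : ℤ => (-1 : ℂ) ^ n * f n * Phi N (n / 2 ^ j - k)}
  zero_mem' := by intro j k; simp [summable_zero]
  add_mem' := by
    intro f g hf hg j k
    refine ((hf j k).add (hg j k)).congr fun n => ?_
    simp only [Pi.add_apply]; ring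
  smul_mem' := by
    intro c f hf j k
    refine ((hf j k).mul_left c).congr fun n => ?_
    simp only [Pi.smul_apply, smul_eq_mul]; ring

lemma la_add (p : ℝ) {N : ℕ} {f g : ℂ → ℂ} (hf : f ∈ Dm N) (hg : g ∈ Dm N) (i : ℕ × ℤ) :
    la p N i (f + g) = la p N i f + la p N i g := by
  unfold la cc
  rw [← mul_add, ← (hf i.1 (2 * i.2 + 1)).tsum_add (hg i.1 (2 * i.2 + 1))]
  congr 2; ext n; simp only [Pi.add_apply]; ring

lemma la_smul (p : ℝ) (N : ℕ) (c : ℂ) (f : ℂ → ℂ) (i : ℕ × ℤ) :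
    la p N i (c • f) = c * la p N i f := by
  unfold la
  have : c • f = fun z => c * f z := rfl
  rw [this, cc_smul]; ring

/-- the coefficient map on its domain -/
noncomputable def T0 (p : ℝ) (N : ℕ) (e : ℕ ≃ ℕ × ℤ) : Dm N →ₗ[ℂ] (ℕ → ℂ) where
  toFun f n := la p N (e n) f
  map_add' f g := by ext n; exact la_add p f.2 g.2 _
  map_smul' c f := by ext n; exact la_smul p N c f _

lemma mem_Dm {p q : ℝ} (hp : 0 < p) (hq : 0 < q) {N : ℕ} (hN : 2 ≤ N) {f : ℂ → ℂ} (hf : Differentiable ℂ f)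
    (hJ : JJ p q f ≠ ⊤) : f ∈ Dm N := by
  obtain ⟨M, hM0, hM⟩ := uu_bounded hf hp hq hJ
  intro j k
  refine (cc_summable hN j k (M := M) fun n => ?_).of_norm
  have := norm_le_uu (hM n); simpa using this

lemma la_upper {p q : ℝ} (hp : 0 < p) (hpq : p < q) (hq1 : q < 1) {N : ℕ} (hN : 2 ≤ N) (hNq : 2 ≤ N * q) :
    ∃ C : ℝ, 0 < C ∧ ∀ f : ℂ → ℂ, Differentiable ℂ f → JJ p q f ≠ ⊤ →
      ∑' i, ENNReal.ofReal (‖la p N i f‖ ^ q) ≤ ENNReal.ofReal C * JJ p q f := by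
  obtain ⟨C, hC, h⟩ := analysis hp hpq hq1 hN hNq
  refine ⟨C, hC, fun f hf hJ => le_trans ?_ (h f hf hJ)⟩
  rw [ENNReal.tsum_prod']
  refine ENNReal.tsum_le_tsum fun j => ?_
  have inj : Function.Injective fun m : ℤ => 2 * m + 1 := fun a b hab => by
    simp only at hab; omega
  refine le_trans (le_of_eq ?_) (ENNReal.tsum_comp_le_tsum_of_injective inj
    (fun k => ENNReal.ofReal ((((2:ℝ) ^ j) ^ (1 / p - 1) * ‖cc N j k f‖) ^ q)))
  congr 1; ext m
  unfold la
  rw [norm_mul, Complex.norm_real, Real.norm_eq_abs, abs_of_pos (Wt_pos p _)]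
  rfl

lemma la_inj {p q : ℝ} (hp : 0 < p) (hpq : p < q) (hq1 : q < 1) {N : ℕ} (hN : 2 ≤ N) (hNq : 2 ≤ N * q)
    {f : ℂ → ℂ} (hf : Differentiable ℂ f) (hJ : JJ p q f ≠ ⊤) (h0 : ∀ i, la p N i f = 0) : f = 0 := by
  have hq : 0 < q := hp.trans hpq
  obtain ⟨M, hM0, hM⟩ := uu_bounded hf hp hq hJ
  have hfn : ∀ n : ℤ, ‖f n‖ ≤ M := fun n => by
    have := norm_le_uu (hM n); simpa using this
  obtain ⟨C, hC, h⟩ := analysis hp hpq hq1 hN hNq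
  have hfin : ∑' j : ℕ, ENNReal.ofReal ((((2:ℝ) ^ j) ^ (1 / p - 1) * ‖cc N j 0 f‖) ^ q) ≠ ⊤ := by
    refine ne_top_of_le_ne_top (ENNReal.mul_ne_top ENNReal.ofReal_ne_top hJ) (le_trans ?_ (h f hf hJ))
    exact ENNReal.tsum_le_tsum fun j => ENNReal.le_tsum (0:ℤ)
  have ht := ENNReal.tendsto_atTop_zero_of_tsum_ne_top hfin
  have ht2 : Filter.Tendsto (fun j : ℕ => ENNReal.ofReal (‖cc N j 0 f‖)) Filter.atTop (nhds 0) := by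
    have h1 := ht.ennrpow_const (1 / q)
    rw [ENNReal.zero_rpow_of_pos (by positivity)] at h1
    refine tendsto_of_tendsto_of_tendsto_of_le_of_le tendsto_const_nhds h1 (fun _ => zero_le) fun j => ?_
    dsimp only
    have hw := Wt_one hp (hpq.trans hq1) j
    have hw0 := Wt_pos p j
    change _ ≤ ENNReal.ofReal ((Wt p j * ‖cc N j 0 f‖) ^ q) ^ (1 / q)
    rw [ENNReal.ofReal_rpow_of_nonneg (by positivity) (by positivity), ← Real.rpow_mul (by positivity),
      mul_one_div_cancel hq.ne', Real.rpow_one]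
    apply ENNReal.ofReal_le_ofReal
    nlinarith [norm_nonneg (cc N j 0 f)]
  have ht3 : Filter.Tendsto (fun j : ℕ => cc N j 0 f) Filter.atTop (nhds 0) := by
    rw [tendsto_zero_iff_norm_tendsto_zero]
    have := (ENNReal.tendsto_toReal ENNReal.zero_ne_top).comp ht2
    simpa [Function.comp_def, ENNReal.toReal_ofReal] using this
  have hz : ∀ n : ℤ, f n = 0 := by
    refine vanish_int hN hfn ?_ ht3
    rintro j k ⟨m, rfl⟩
    have := h0 (j, m)
    unfold la at this
    have h2 : (Wt p j : ℂ) ≠ 0 := by exact_mod_cast (Wt_pos p j).ne'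
    exact (mul_eq_zero.1 this).resolve_left h2
  ext z
  exact uniq hf hz hM (uu_tendsto hf hp hq hJ) z

lemma JJ_sub {p q : ℝ} (hq : 0 < q) (hq1 : q < 1) {f g : ℂ → ℂ} (hf : Differentiable ℂ f)
    (hJf : JJ p q f ≠ ⊤) (hJg : JJ p q g ≠ ⊤) : JJ p q (f - g) ≠ ⊤ := by
  have h : JJ p q (f - g) ≤ JJ p q f + JJ p q g := by
    unfold JJ
    rw [← lintegral_add_left (JJ_meas hf p q)]
    refine lintegral_mono fun z => ?_
    have h1 := uu_nonneg f z
    have h2 := uu_nonneg g z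
    rw [← ENNReal.ofReal_add (by positivity) (by positivity), ← mul_add]
    apply ENNReal.ofReal_le_ofReal
    gcongr
    refine le_trans (Real.rpow_le_rpow (uu_nonneg _ _) ?_ hq.le) (Real.rpow_add_le_add_rpow h1 h2 hq.le hq1.le)
    unfold uu
    rw [← add_mul]
    gcongr
    exact norm_sub_le _ _
  exact ne_top_of_le_ne_top (ENNReal.add_ne_top.2 ⟨hJf, hJg⟩) h

end ZqAux

namespace ZqAux

lemma tsum_ofReal_equiv {q : ℝ} (e : ℕ ≃ ℕ × ℤ) (a : ℕ × ℤ → ℂ) :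
    ∑' n, ENNReal.ofReal (‖a (e n)‖ ^ q) = ∑' i, ENNReal.ofReal (‖a i‖ ^ q) :=
  e.tsum_eq (fun i => ENNReal.ofReal (‖a i‖ ^ q))

lemma summable_of_q {q : ℝ} (hq : 0 < q) (hq1 : q < 1) {a : ℕ × ℤ → ℂ}
    (ha : ∑' i, ENNReal.ofReal (‖a i‖ ^ q) ≠ ⊤) : Summable fun i => ‖a i‖ := by
  have h1 : (∑' i, ENNReal.ofReal ‖a i‖) ^ q ≤ ∑' i, ENNReal.ofReal (‖a i‖ ^ q) := by
    refine (tsum_rpow_le _ hq hq1.le).trans (le_of_eq ?_)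
    congr 1; ext i
    rw [ENNReal.ofReal_rpow_of_nonneg (norm_nonneg _) hq.le]
  have h2 : ∑' i, ENNReal.ofReal ‖a i‖ ≠ ⊤ := by
    intro h
    rw [h, ENNReal.top_rpow_of_pos hq] at h1
    exact ha (top_le_iff.1 h1)
  have := ENNReal.summable_toReal h2
  refine this.congr fun i => ENNReal.toReal_ofReal (norm_nonneg _)

lemma MemZq_iff {p q : ℝ} (hq : 0 < q) (f : ℂ → ℂ) : MemZq p q f ↔ Differentiable ℂ f ∧ JJ p q f ≠ ⊤ := by
  unfold MemZq
  rw [ZqNorm_eq p q hq f, ENNReal.rpow_lt_top_iff_of_pos (by positivity), lt_top_iff_ne_top]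

end ZqAux

namespace ZqAux

theorem main_result (p q : ℝ) (hp0 : 0 < p) (hpq : p < q) (hq1 : q < 1) :
    ∃ (T : (ℂ → ℂ) →ₗ[ℂ] (ℕ → ℂ)) (C : ℝ), 0 < C ∧
      Set.InjOn T {f : ℂ → ℂ | MemZq p q f} ∧
      (∀ a : ℕ → ℂ, Summable (fun n => ‖a n‖ ^ q) →
        ∃ f : ℂ → ℂ, MemZq p q f ∧ T f = a) ∧
      (∀ f : ℂ → ℂ, MemZq p q f →
        Summable (fun n => ‖T f n‖ ^ q) ∧
        C⁻¹ * (ZqNorm p q f).toReal ≤ (∑' n : ℕ, ‖T f n‖ ^ q) ^ (1 / q) ∧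
        (∑' n : ℕ, ‖T f n‖ ^ q) ^ (1 / q) ≤ C * (ZqNorm p q f).toReal) := by
  have hq : 0 < q := hp0.trans hpq
  have hp1 : p < 1 := hpq.trans hq1
  obtain ⟨N0, hN0⟩ := exists_nat_ge (2 / q)
  set N := N0 + 2 with hNdef
  have hN : 2 ≤ N := by omega
  have hNq : 2 ≤ (N:ℝ) * q := by
    rw [div_le_iff₀ hq] at hN0
    rw [hNdef]; push_cast; nlinarith
  obtain ⟨C1, hC1, h1⟩ := la_upper hp0 hpq hq1 hN hNq
  obtain ⟨C2, hC2, h2⟩ := Sy_JJ hp0 hpq hq1 hN hNq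
  let e : ℕ ≃ ℕ × ℤ := (Denumerable.eqv (ℕ × ℤ)).symm
  obtain ⟨T, hT⟩ := LinearMap.exists_extend (T0 p N e)
  have hTf : ∀ f ∈ Dm N, ∀ n, T f n = la p N (e n) f := by
    intro f hf n
    have := congrArg (fun φ => φ ⟨f, hf⟩ n) hT
    exact this
  have hTZ : ∀ f, MemZq p q f → ∀ n, T f n = la p N (e n) f := fun f hf n => by
    rw [MemZq_iff hq] at hf
    exact hTf f (mem_Dm hp0 hq hN hf.1 hf.2) n
  -- synthesis lies in the space
  have hSy : ∀ a : ℕ × ℤ → ℂ, ∑' i, ENNReal.ofReal (‖a i‖ ^ q) ≠ ⊤ →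
      MemZq p q (Sy p N a) ∧ ∀ i, la p N i (Sy p N a) = a i := by
    intro a ha
    have hs := summable_of_q hq hq1 ha
    rw [MemZq_iff hq]
    exact ⟨⟨Sy_diff hp0 hp1 (by omega) hs,
      ne_top_of_le_ne_top (ENNReal.mul_ne_top ENNReal.ofReal_ne_top ha) (h2 a hs)⟩,
      fun i => la_Sy hp0 hp1 hN hs i⟩
  have hinj : ∀ f g, MemZq p q f → MemZq p q g → (∀ i, la p N i f = la p N i g) → f = g := by
    intro f g hf hg h
    rw [MemZq_iff hq] at hf hg
    have hd : Differentiable ℂ (f - g) := hf.1.sub hg.1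
    have hJ := JJ_sub (p := p) hq hq1 hf.1 hf.2 hg.2
    have : f - g = 0 := by
      refine la_inj hp0 hpq hq1 hN hNq hd hJ fun i => ?_
      have a1 := la_add p (mem_Dm hp0 hq hN hd hJ) (mem_Dm hp0 hq hN hg.1 hg.2) i
      rw [sub_add_cancel, h i] at a1
      exact left_eq_add.1 (by rw [add_comm]; exact a1)
    exact sub_eq_zero.1 this
  refine ⟨T, (C1 + C2) ^ (1 / q), by positivity, ?_, ?_, ?_⟩
  · intro f hf g hg hfg
    refine hinj f g hf hg fun i => ?_
    have := congrFun hfg (e.symm i)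
    rwa [hTZ f hf, hTZ g hg, e.apply_symm_apply] at this
  · intro a ha
    have ha2 : ∑' i, ENNReal.ofReal (‖a (e.symm i)‖ ^ q) ≠ ⊤ := by
      rw [e.symm.tsum_eq (fun n => ENNReal.ofReal (‖a n‖ ^ q)),
        ← ENNReal.ofReal_tsum_of_nonneg (fun n => by positivity) ha]
      exact ENNReal.ofReal_ne_top
    obtain ⟨b1, b2⟩ := hSy (fun i => a (e.symm i)) ha2
    refine ⟨_, b1, ?_⟩
    ext n
    rw [hTZ _ b1, b2, e.symm_apply_apply]
  · intro f hf
    have hf' := (MemZq_iff hq f).1 hf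
    set a : ℕ × ℤ → ℂ := fun i => la p N i f with ha
    have u1 : ∑' i, ENNReal.ofReal (‖a i‖ ^ q) ≤ ENNReal.ofReal C1 * JJ p q f := h1 f hf'.1 hf'.2
    have u2 : ∑' i, ENNReal.ofReal (‖a i‖ ^ q) ≠ ⊤ :=
      ne_top_of_le_ne_top (ENNReal.mul_ne_top ENNReal.ofReal_ne_top hf'.2) u1
    obtain ⟨b1, b2⟩ := hSy a u2
    have hfe : f = Sy p N a := hinj f _ hf b1 fun i => (b2 i).symm
    have u3 : JJ p q f ≤ ENNReal.ofReal C2 * ∑' i, ENNReal.ofReal (‖a i‖ ^ q) := by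
      have := h2 a (summable_of_q hq hq1 u2)
      rwa [← hfe] at this
    have hTn : ∀ n, ‖T f n‖ ^ q = ‖a (e n)‖ ^ q := fun n => by rw [hTZ f hf]
    simp only [hTn]
    rw [← tsum_ofReal_equiv e] at u1 u2 u3
    have hsum : Summable fun n => ‖a (e n)‖ ^ q := by
      refine (ENNReal.summable_toReal u2).congr fun n => ENNReal.toReal_ofReal (by positivity)
    rw [← ENNReal.ofReal_tsum_of_nonneg (fun n => by positivity) hsum] at u1 u3
    set S := ∑' n, ‖a (e n)‖ ^ q with hS
    have hS0 : 0 ≤ S := tsum_nonneg fun n => by positivity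
    set J := (JJ p q f).toReal with hJ
    have hJ0 : 0 ≤ J := ENNReal.toReal_nonneg
    rw [← ENNReal.ofReal_toReal hf'.2, ← hJ, ← ENNReal.ofReal_mul hC1.le, ENNReal.ofReal_le_ofReal_iff (by positivity)] at u1
    rw [← ENNReal.ofReal_toReal hf'.2, ← hJ, ← ENNReal.ofReal_mul hC2.le, ENNReal.ofReal_le_ofReal_iff (by positivity)] at u3
    have hZ : (ZqNorm p q f).toReal = J ^ (1 / q) := by
      rw [ZqNorm_eq p q hq, ← ENNReal.toReal_rpow]
    rw [hZ]
    refine ⟨hsum, ?_, ?_⟩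
    · rw [inv_mul_le_iff₀ (by positivity), ← Real.mul_rpow (by positivity) hS0]
      apply Real.rpow_le_rpow hJ0 _ (by positivity)
      nlinarith
    · rw [← Real.mul_rpow (by positivity) hJ0]
      apply Real.rpow_le_rpow hS0 _ (by positivity)
      nlinarith

end ZqAux

/-- **`Eᵖ_{c,q} ≈ ℓ^q`.** For `0 < p < q < 1`, the space `Z_q` of entire functions
with finite quasi-norm `(∫_ℂ e^{-qπ|Im z|} |Im z|^{q/p-2} |f(z)|^q dA(z))^{1/q}`
(the `q`-Banach envelope of `Eᵖ`) is isomorphic to `ℓ^q`: there is a linear map `T`,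
bijective from `Z_q` onto `ℓ^q(ℕ, ℂ)`, with
`C⁻¹ ‖f‖_{Z_q} ≤ ‖Tf‖_{ℓ^q} ≤ C ‖f‖_{Z_q}`. -/
theorem Zq_isomorphic_to_ellq (p q : ℝ) (hp0 : 0 < p) (hpq : p < q) (hq1 : q < 1) :
    ∃ (T : (ℂ → ℂ) →ₗ[ℂ] (ℕ → ℂ)) (C : ℝ), 0 < C ∧
      Set.InjOn T {f : ℂ → ℂ | MemZq p q f} ∧
      (∀ a : ℕ → ℂ, Summable (fun n => ‖a n‖ ^ q) →
        ∃ f : ℂ → ℂ, MemZq p q f ∧ T f = a) ∧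
      (∀ f : ℂ → ℂ, MemZq p q f →
        Summable (fun n => ‖T f n‖ ^ q) ∧
        C⁻¹ * (ZqNorm p q f).toReal ≤ (∑' n : ℕ, ‖T f n‖ ^ q) ^ (1 / q) ∧
        (∑' n : ℕ, ‖T f n‖ ^ q) ^ (1 / q) ≤ C * (ZqNorm p q f).toReal) :=
  ZqAux.main_result p q hp0 hpq hq1
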